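/- For every ε > 0 there exist constants C = C(ε) and δ = δ(ε) with the following property. For every collection T of n pairwise disjoint non-vertical triangles in ℝ³, each triangle of T can be partitioned into connected semialgebraic pieces — each piece definable by at most δ polynomial equalities and inequalities of degree at most δ — with at most C·n^{3/2+ε} pieces in total over all triangles, such that the depth relation ≺ on the resulting collection of pieces is acyclic. -/

import Mathlib

/-- A set in `ℝ³` is a non-vertical triangle if it is the convex hull of three affinely
independent points whose spanning plane is not parallel to the `z`-axis. -/
def IsNonVerticalTriangle (s : Set (Fin 3 → ℝ)) : Prop :=
  ∃ a b c : Fin 3 → ℝ, AffineIndependent ℝ ![a, b, c] ∧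
    s = convexHull ℝ {a, b, c} ∧
    (![0, 0, 1] : Fin 3 → ℝ) ∉ (affineSpan ℝ ({a, b, c} : Set (Fin 3 → ℝ))).direction

/-- The depth relation: `o₁ ≺ o₂` if some vertical line meets both sets, with the
intersection with `o₁` lower (in `z`-coordinate) than the intersection with `o₂`. -/
def Below (o₁ o₂ : Set (Fin 3 → ℝ)) : Prop :=
  ∃ p ∈ o₁, ∃ q ∈ o₂, p 0 = q 0 ∧ p 1 = q 1 ∧ p 2 < q 2

/-- The depth relation on a collection `O` of pieces is acyclic: there is no cyclic
sequence `o₀ ≺ o₁ ≺ ⋯ ≺ o_k ≺ o₀` of members of `O`. -/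
def DepthAcyclic (O : Set (Set (Fin 3 → ℝ))) : Prop :=
  ¬ ∃ (k : ℕ) (o : Fin (k + 1) → Set (Fin 3 → ℝ)),
      (∀ i, o i ∈ O) ∧ ∀ i, Below (o i) (o (i + 1))

/-- A set `s ⊆ ℝ³` is semialgebraic of description complexity `δ`: it is defined by at
most `δ` polynomial equalities and inequalities, each of degree at most `δ`. -/
def SemialgOfComplexity (δ : ℕ) (s : Set (Fin 3 → ℝ)) : Prop :=
  ∃ m : ℕ, m ≤ δ ∧
    ∃ (f : Fin m → MvPolynomial (Fin 3) ℝ) (c : Fin m → (ℝ → Prop)),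
      (∀ i, (f i).totalDegree ≤ δ) ∧
      (∀ i, c i = (· = 0) ∨ c i = (· < 0) ∨ c i = (· ≤ 0) ∨
            c i = (0 < ·) ∨ c i = (0 ≤ ·)) ∧
      s = {p | ∀ i, c i (MvPolynomial.eval p (f i))}

/-- `N` vectors chosen among the `v x` are always linearly independent. -/
def GenericFamily {M : Type*} {N : ℕ} (v : M → Fin N → ℝ) : Prop :=
  ∀ g : Fin N → M, Function.Injective g → (Matrix.of fun i => v (g i)).det ≠ 0

lemma GenericFamily.eq_zero_of_dotProduct {M : Type*} {N : ℕ} {v : M → Fin N → ℝ}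
    (hv : GenericFamily v) {Z : Finset M} (hZ : N ≤ Z.card) {f : Fin N → ℝ}
    (hf : ∀ z ∈ Z, v z ⬝ᵥ f = 0) : f = 0 := by
  classical
  obtain ⟨Z', hZ', hc⟩ := Finset.exists_subset_card_eq hZ
  let g : Fin N → M := fun i => ((Z'.equivFinOfCardEq hc).symm i : M)
  have hg : Function.Injective g := fun i j h => by
    simpa [g, Subtype.ext_iff] using h
  have := hv g hg
  refine Matrix.eq_zero_of_mulVec_eq_zero this ?_
  ext i
  exact hf _ (hZ' ((Z'.equivFinOfCardEq hc).symm i).2)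

lemma GenericFamily.coeff_eq_zero {M : Type*} {N : ℕ} {v : M → Fin N → ℝ}
    (hv : GenericFamily v) {Z : Finset M} (hZ : Z.card = N) {a : M → ℝ}
    (ha : ∑ z ∈ Z, a z • v z = 0) : ∀ z ∈ Z, a z = 0 := by
  classical
  let g : Fin N → M := fun i => ((Z.equivFinOfCardEq hZ).symm i : M)
  have hg : Function.Injective g := fun i j h => by
    simpa [g, Subtype.ext_iff] using h
  have h0 : (fun i => a (g i)) = 0 := by
    refine Matrix.eq_zero_of_vecMul_eq_zero (hv g hg) ?_
    rw [Matrix.vecMul_eq_sum]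
    have : ∑ i, a (g i) • v (g i) = ∑ z ∈ Z, a z • v z := by
      rw [← Finset.sum_coe_sort Z]
      exact Fintype.sum_equiv (Z.equivFinOfCardEq hZ).symm _ _ (fun i => rfl)
    rw [ha] at this
    exact this
  intro z hz
  have := congrFun h0 (Z.equivFinOfCardEq hZ ⟨z, hz⟩)
  simpa [g] using this

lemma Real.sign_mul_sign (x y : ℝ) : Real.sign (x * y) = Real.sign x * Real.sign y := by
  rcases lt_trichotomy x 0 with hx | rfl | hx <;> rcases lt_trichotomy y 0 with hy | rfl | hy <;>
    simp [Real.sign_of_pos, Real.sign_of_neg, mul_pos_of_neg_of_neg, mul_neg_of_neg_of_pos,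
      mul_neg_of_pos_of_neg, *]

/-- Signs of hyperplanes through all but two of `N + 1` vectors, evaluated at these two. -/
lemma GenericFamily.sum_offDiag_sign_le {M : Type*} [DecidableEq M] {N : ℕ}
    {v : M → Fin N → ℝ} (hv : GenericFamily v) (F : Finset M → Fin N → ℝ)
    (hF0 : ∀ X, X.card + 1 = N → F X ≠ 0)
    (hF : ∀ X, X.card + 1 = N → ∀ x ∈ X, v x ⬝ᵥ F X = 0)
    {Y Z : Finset M} (hY : Y.card = N + 1) (hZ : Z ⊆ Y) :
    ∑ ab ∈ Z.offDiag, Real.sign (v ab.1 ⬝ᵥ F (Y \ {ab.1, ab.2})) *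
      Real.sign (v ab.2 ⬝ᵥ F (Y \ {ab.1, ab.2})) ≤ Z.card := by
  obtain ⟨l, hl, y0, hy0, hly0⟩ : ∃ l : M → ℝ, ∑ y ∈ Y, l y • v y = 0 ∧ ∃ y ∈ Y, l y ≠ 0 := by
    have hfr : Module.finrank ℝ (Fin N → ℝ) < Y.card := by simp [hY]
    have : ¬ LinearIndepOn ℝ v (Y : Set M) := by
      intro h
      have := LinearIndependent.fintype_card_le_finrank h
      simp at this
      omega
    rw [not_linearIndepOn_finset_iff] at this
    exact this
  have hne : ∀ y ∈ Y, l y ≠ 0 := by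
    intro y hy h0
    have h1 : ∑ z ∈ Y.erase y, l z • v z = 0 := by
      rw [← hl, ← Finset.add_sum_erase Y _ hy, h0]; simp
    have h2 := hv.coeff_eq_zero (Z := Y.erase y) (by rw [Finset.card_erase_of_mem hy, hY]; rfl) h1
    by_cases hyy : y0 = y
    · exact hly0 (hyy ▸ h0)
    · exact hly0 (h2 y0 (Finset.mem_erase.2 ⟨hyy, hy0⟩))
  have key : ∀ ab ∈ Z.offDiag, Real.sign (v ab.1 ⬝ᵥ F (Y \ {ab.1, ab.2})) *
      Real.sign (v ab.2 ⬝ᵥ F (Y \ {ab.1, ab.2})) = -(Real.sign (l ab.1) * Real.sign (l ab.2)) := by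
    rintro ⟨a, b⟩ hab
    simp only [Finset.mem_offDiag] at hab
    obtain ⟨ha, hb, hab⟩ := hab
    replace ha := hZ ha
    replace hb := hZ hb
    set X := Y \ {a, b} with hX
    have hcard : X.card + 2 = N + 1 := by
      rw [← hY, ← Finset.card_sdiff_add_card_eq_card (s := {a, b}) (t := Y)
        (by intro z hz; simp at hz; rcases hz with rfl | rfl <;> assumption), Finset.card_pair hab]
    have hXc : X.card + 1 = N := by omega
    have hf := hF X hXc
    have hf0 := hF0 X hXc
    have e : l a * (v a ⬝ᵥ F X) + l b * (v b ⬝ᵥ F X) = 0 := by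
      have h1 : (∑ y ∈ Y, l y • v y) ⬝ᵥ F X = 0 := by rw [hl]; simp
      rw [sum_dotProduct, ← Finset.sum_sdiff (s₁ := {a, b}) (s₂ := Y)
        (by intro z hz; simp at hz; rcases hz with rfl | rfl <;> assumption),
        Finset.sum_pair hab, Finset.sum_eq_zero] at h1
      · simpa using h1
      · intro x hx
        simp [hf x hx]
    have hb0 : v b ⬝ᵥ F X ≠ 0 := by
      intro h
      refine hf0 (hv.eq_zero_of_dotProduct (Z := insert b X) ?_ ?_)
      · rw [Finset.card_insert_of_notMem (by simp [hX]), hXc]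
      · intro z hz
        rcases Finset.mem_insert.1 hz with rfl | hz
        · exact h
        · exact hf z hz
    have hla := hne a ha
    have hlb := hne b hb
    show Real.sign (v a ⬝ᵥ F X) * Real.sign (v b ⬝ᵥ F X) = -(Real.sign (l a) * Real.sign (l b))
    have e2 : v a ⬝ᵥ F X = -(l b / l a) * (v b ⬝ᵥ F X) := by field_simp; linarith
    have hs : ∀ r : ℝ, r ≠ 0 → Real.sign r * Real.sign r = 1 := fun r hr => by
      rcases Real.sign_apply_eq_of_ne_zero r hr with h | h <;> rw [h] <;> norm_num
    rw [e2, div_eq_mul_inv, neg_mul, Real.sign_neg, Real.sign_mul_sign, Real.sign_mul_sign,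
      Real.sign_inv]
    linear_combination -(Real.sign (l a) * Real.sign (l b)) * hs _ hb0
  rw [Finset.sum_congr rfl key]
  have h1 : ∑ ab ∈ Z ×ˢ Z, Real.sign (l ab.1) * Real.sign (l ab.2)
      = (∑ a ∈ Z, Real.sign (l a)) ^ 2 := by
    rw [sq, Finset.sum_mul_sum, Finset.sum_product]
  have h2 := Finset.sum_union (Finset.disjoint_diag_offDiag Z)
    (f := fun ab => Real.sign (l ab.1) * Real.sign (l ab.2))
  rw [Finset.diag_union_offDiag, h1, Finset.sum_diag] at h2
  have h3 : ∑ a ∈ Z, Real.sign (l a) * Real.sign (l a) ≤ Z.card := by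
    rw [Finset.cast_card]
    refine Finset.sum_le_sum fun a _ => ?_
    rcases Real.sign_apply_eq (l a) with h | h | h <;> rw [h] <;> norm_num
  rw [Finset.sum_neg_distrib]
  nlinarith [sq_nonneg (∑ a ∈ Z, Real.sign (l a))]

/-- The sets containing exactly `q i` elements of each fibre of `c`. -/
def transversals {M J : Type*} [Fintype M] [DecidableEq M] [Fintype J] [DecidableEq J]
    (c : M → J) (q : J → ℕ) : Finset (Finset M) :=
  Finset.univ.filter fun X => ∀ j, (X.filter (c · = j)).card = q j

lemma card_of_mem_transversals {M J : Type*} [Fintype M] [DecidableEq M] [Fintype J]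
    [DecidableEq J] {c : M → J} {q : J → ℕ} {X : Finset M} (hX : X ∈ transversals c q) :
    X.card = ∑ j, q j := by
  simp only [transversals, Finset.mem_filter, Finset.mem_univ, true_and] at hX
  rw [Finset.card_eq_sum_card_fiberwise (f := c) (t := Finset.univ) (by simp)]
  exact Finset.sum_congr rfl fun j _ => hX j

lemma transversals_nonempty {M J : Type*} [Fintype M] [DecidableEq M] [Fintype J]
    [DecidableEq J] {c : M → J} {q : J → ℕ}
    (h : ∀ j, q j ≤ (Finset.univ.filter (c · = j)).card) : (transversals c q).Nonempty := by
  choose S hS hc using fun j => Finset.exists_subset_card_eq (h j)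
  refine ⟨Finset.univ.filter fun x => x ∈ S (c x), ?_⟩
  simp only [transversals, Finset.mem_filter, Finset.mem_univ, true_and]
  intro j
  rw [← hc j]
  congr 1
  ext x
  simp only [Finset.mem_filter, Finset.mem_univ, true_and]
  constructor
  · rintro ⟨h1, rfl⟩; exact h1
  · intro hx
    have := hS j hx
    simp only [Finset.mem_filter, Finset.mem_univ, true_and] at this
    subst this
    exact ⟨hx, rfl⟩

lemma sum_transversals_offDiag {M J : Type*} [Fintype M] [DecidableEq M] [Fintype J]
    [DecidableEq J] (c : M → J) (q : J → ℕ) (j : J) (g : Finset M → M × M → ℝ) :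
    ∑ X ∈ transversals c q, ∑ ab ∈ ((Finset.univ.filter (c · = j)) \ X).offDiag, g X ab =
    ∑ Y ∈ transversals c (Function.update q j (q j + 2)),
      ∑ ab ∈ (Y.filter (c · = j)).offDiag, g (Y \ {ab.1, ab.2}) ab := by
  rw [Finset.sum_sigma', Finset.sum_sigma']
  refine Finset.sum_bij' (fun x _ => ⟨x.1 ∪ {x.2.1, x.2.2}, x.2⟩)
    (fun x _ => ⟨x.1 \ {x.2.1, x.2.2}, x.2⟩) ?_ ?_ ?_ ?_ ?_
  · rintro ⟨X, a, b⟩ h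
    simp only [Finset.mem_sigma, transversals, Finset.mem_filter, Finset.mem_univ, true_and,
      Finset.mem_offDiag, Finset.mem_sdiff, Finset.mem_union, Finset.mem_insert,
      Finset.mem_singleton] at h ⊢
    obtain ⟨hX, ⟨ha, haX⟩, ⟨hb, hbX⟩, hab⟩ := h
    refine ⟨fun i => ?_, by simp [ha], by simp [hb], hab⟩
    rw [Finset.filter_union]
    by_cases hi : i = j
    · subst hi
      rw [Function.update_self, ← hX i, ← Finset.card_pair hab]
      have : ({a, b} : Finset M).filter (c · = i) = {a, b} := by
        ext x; simp only [Finset.mem_filter, Finset.mem_insert, Finset.mem_singleton]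
        constructor
        · exact fun h => h.1
        · rintro (rfl | rfl) <;> simp [*]
      rw [this, Finset.card_union_of_disjoint]
      rw [Finset.disjoint_left]
      intro x hx hx2
      simp only [Finset.mem_filter, Finset.mem_insert, Finset.mem_singleton] at hx hx2
      rcases hx2 with rfl | rfl
      · exact haX hx.1
      · exact hbX hx.1
    · rw [Function.update_of_ne hi, ← hX i]
      have : ({a, b} : Finset M).filter (c · = i) = ∅ := by
        ext x; simp only [Finset.mem_filter, Finset.mem_insert, Finset.mem_singleton]
        constructor
        · rintro ⟨rfl | rfl, h⟩
          · exact absurd (h.symm.trans ha) hi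
          · exact absurd (h.symm.trans hb) hi
        · simp
      rw [this, Finset.union_empty]
  · rintro ⟨Y, a, b⟩ h
    simp only [Finset.mem_sigma, transversals, Finset.mem_filter, Finset.mem_univ, true_and,
      Finset.mem_offDiag, Finset.mem_sdiff, Finset.mem_insert,
      Finset.mem_singleton] at h ⊢
    obtain ⟨hY, ⟨haY, ha⟩, ⟨hbY, hb⟩, hab⟩ := h
    refine ⟨fun i => ?_, ⟨ha, by simp⟩, ⟨hb, by simp⟩, hab⟩
    have hY' := hY i
    by_cases hi : i = j
    · subst hi
      rw [Function.update_self] at hY'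
      have e : (Y \ {a, b}).filter (c · = i) = Y.filter (c · = i) \ {a, b} := by
        ext x; simp only [Finset.mem_filter, Finset.mem_sdiff]; tauto
      rw [e, Finset.card_sdiff_of_subset, hY', Finset.card_pair hab]
      · rfl
      · intro x hx
        simp only [Finset.mem_insert, Finset.mem_singleton] at hx
        rcases hx with rfl | rfl <;> simp [*]
    · rw [Function.update_of_ne hi] at hY'
      rw [← hY']
      congr 1
      ext x; simp only [Finset.mem_filter, Finset.mem_sdiff, Finset.mem_insert,
        Finset.mem_singleton]
      constructor
      · tauto
      · rintro ⟨h1, h2⟩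
        refine ⟨⟨h1, ?_⟩, h2⟩
        rintro (rfl | rfl)
        · exact hi (h2.symm.trans ha)
        · exact hi (h2.symm.trans hb)
  · rintro ⟨X, a, b⟩ h
    simp only [Finset.mem_sigma, Finset.mem_offDiag, Finset.mem_sdiff] at h
    obtain ⟨hX, ⟨ha, haX⟩, ⟨hb, hbX⟩, hab⟩ := h
    simp only [Sigma.mk.injEq, heq_eq_eq, and_true]
    ext x; simp only [Finset.mem_union, Finset.mem_sdiff, Finset.mem_insert,
        Finset.mem_singleton]
    constructor
    · tauto
    · intro hx
      refine ⟨Or.inl hx, ?_⟩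
      rintro (rfl | rfl) <;> contradiction
  · rintro ⟨Y, a, b⟩ h
    simp only [Finset.mem_sigma, Finset.mem_offDiag, Finset.mem_filter] at h
    obtain ⟨hX, ⟨ha, haX⟩, ⟨hb, hbX⟩, hab⟩ := h
    simp only [Sigma.mk.injEq, heq_eq_eq, and_true]
    ext x; simp only [Finset.mem_union, Finset.mem_sdiff, Finset.mem_insert,
        Finset.mem_singleton]
    constructor
    · rintro (h | rfl | rfl)
      · exact h.1
      · exact ha
      · exact hb
    · tauto
  · rintro ⟨X, a, b⟩ h
    simp only [Finset.mem_sigma, Finset.mem_offDiag, Finset.mem_sdiff] at h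
    obtain ⟨hX, ⟨ha, haX⟩, ⟨hb, hbX⟩, hab⟩ := h
    dsimp only
    congr 1
    ext x; simp only [Finset.mem_union, Finset.mem_sdiff, Finset.mem_insert,
        Finset.mem_singleton]
    constructor
    · intro hx
      refine ⟨Or.inl hx, ?_⟩
      rintro (rfl | rfl) <;> contradiction
    · tauto

/-- Approximate simultaneous bisection for generic families. -/
lemma GenericFamily.exists_sum_sq_le {M J : Type*} [Fintype M] [DecidableEq M] [Fintype J]
    [DecidableEq J] {c : M → J} {q N : ℕ} (hN : N = q * Fintype.card J + 1)
    (hc : ∀ j, q + 2 ≤ (Finset.univ.filter (c · = j)).card)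
    {v : M → Fin N → ℝ} (hv : GenericFamily v) :
    ∃ f : Fin N → ℝ, f ≠ 0 ∧
      ∑ j, (∑ x with c x = j, Real.sign (v x ⬝ᵥ f)) ^ 2 /
        ((Finset.univ.filter (c · = j)).card : ℝ) ^ 2 ≤ 2 * Fintype.card J / (q + 1) := by
  have hex : ∀ X : Finset M, ∃ f : Fin N → ℝ, X.card + 1 = N → f ≠ 0 ∧
      ∀ x ∈ X, v x ⬝ᵥ f = 0 := by
    intro X
    by_cases hX : X.card + 1 = N
    · let A : (Fin N → ℝ) →ₗ[ℝ] (X → ℝ) := (Matrix.of fun x : X => v x).mulVecLin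
      have : Module.finrank ℝ (X → ℝ) < Module.finrank ℝ (Fin N → ℝ) := by simp; omega
      obtain ⟨f, hf, hf0⟩ := (Submodule.ne_bot_iff _).1 (LinearMap.ker_ne_bot_of_finrank_lt
        (f := A) this)
      refine ⟨f, fun _ => ⟨hf0, fun x hx => ?_⟩⟩
      exact congrFun (LinearMap.mem_ker.1 hf) ⟨x, hx⟩
    · exact ⟨0, fun h => absurd h hX⟩
  choose F hF using hex
  set T := transversals c fun _ => q with hT
  have hTc : ∀ X ∈ T, X.card + 1 = N := fun X hX => by
    rw [card_of_mem_transversals hX, hN]; simp [mul_comm]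
  let p : J → ℝ := fun j => ((Finset.univ.filter (c · = j)).card : ℝ)
  have hp : ∀ j, (q : ℝ) + 2 ≤ p j := fun j => by simp only [p]; exact_mod_cast hc j
  have hq0 : (0 : ℝ) ≤ q := q.cast_nonneg
  have key : ∀ j, ∑ X ∈ T, (∑ x with c x = j, Real.sign (v x ⬝ᵥ F X)) ^ 2
      ≤ T.card * (2 * p j ^ 2 / (q + 1)) := by
    intro j
    set Y' := transversals c (Function.update (fun _ => q) j (q + 2)) with hY'
    have hYj : ∀ Y ∈ Y', (Y.filter (c · = j)).card = q + 2 := by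
      intro Y hY
      have := (Finset.mem_filter.1 hY).2 j
      simpa using this
    have hYc : ∀ Y ∈ Y', Y.card = N + 1 := by
      intro Y hY
      rw [card_of_mem_transversals hY, Finset.sum_update_of_mem (Finset.mem_univ j), hN]
      have : 0 < Fintype.card J := Fintype.card_pos_iff.2 ⟨j⟩
      simp [Finset.card_sdiff, mul_comm]
      obtain ⟨m, hm⟩ : ∃ m, Fintype.card J = m + 1 := ⟨_, (Nat.succ_pred_eq_of_pos this).symm⟩
      rw [hm]; simp; ring
    have hXj : ∀ X ∈ T, (((Finset.univ.filter (c · = j)) \ X).card : ℝ) = p j - q := by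
      intro X hX
      have h1 := (Finset.mem_filter.1 hX).2 j
      have h2 : (Finset.univ.filter (c · = j)) \ X =
          (Finset.univ.filter (c · = j)) \ X.filter (c · = j) := by
        ext x; simp only [Finset.mem_sdiff, Finset.mem_filter, Finset.mem_univ, true_and]; tauto
      rw [h2, Finset.cast_card_sdiff, h1]
      exact Finset.filter_subset_filter _ (Finset.subset_univ _)
    have cnt := sum_transversals_offDiag c (fun _ => q) j fun _ _ => 1
    have hoff : ∀ s : Finset M, ((s.offDiag.card : ℕ) : ℝ) = s.card * (s.card - 1) := by
      intro s
      rw [Finset.offDiag_card, Nat.cast_sub (Nat.le_mul_self _)]; push_cast; ring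
    have cnt2 : (T.card : ℝ) * ((p j - q) * (p j - q - 1)) =
        (Y'.card : ℝ) * ((q + 2) * (q + 1)) := by
      have e1 : ∑ X ∈ T, ∑ ab ∈ ((Finset.univ.filter (c · = j)) \ X).offDiag, (1 : ℝ)
          = T.card * ((p j - q) * (p j - q - 1)) := by
        rw [Finset.sum_congr rfl (g := fun _ => (p j - q) * (p j - q - 1))]
        · simp
        · intro X hX
          simp only [Finset.sum_const, nsmul_eq_mul, mul_one, hoff, hXj X hX]
      have e2 : ∑ Y ∈ Y', ∑ ab ∈ (Y.filter (c · = j)).offDiag, (1 : ℝ)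
          = Y'.card * ((q + 2) * (q + 1)) := by
        rw [Finset.sum_congr rfl (g := fun _ => ((q + 2) * (q + 1) : ℝ))]
        · simp
        · intro Y hY
          simp only [Finset.sum_const, nsmul_eq_mul, mul_one, hoff, hYj Y hY]
          push_cast; ring
      rw [← e1, ← e2]
      exact cnt
    have hsum := sum_transversals_offDiag c (fun _ => q) j fun X ab =>
      Real.sign (v ab.1 ⬝ᵥ F X) * Real.sign (v ab.2 ⬝ᵥ F X)
    have hle : ∑ Y ∈ Y', ∑ ab ∈ (Y.filter (c · = j)).offDiag,
        Real.sign (v ab.1 ⬝ᵥ F (Y \ {ab.1, ab.2})) * Real.sign (v ab.2 ⬝ᵥ F (Y \ {ab.1, ab.2}))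
        ≤ Y'.card * (q + 2) := by
      rw [← nsmul_eq_mul]
      refine Finset.sum_le_card_nsmul _ _ _ fun Y hY => ?_
      refine (hv.sum_offDiag_sign_le F (fun X hX => (hF X hX).1) (fun X hX => (hF X hX).2)
        (hYc Y hY) (Finset.filter_subset _ _)).trans ?_
      rw [hYj Y hY]; push_cast; rfl
    have hsq : ∀ X ∈ T, (∑ x with c x = j, Real.sign (v x ⬝ᵥ F X)) ^ 2 ≤
        ∑ ab ∈ ((Finset.univ.filter (c · = j)) \ X).offDiag,
          Real.sign (v ab.1 ⬝ᵥ F X) * Real.sign (v ab.2 ⬝ᵥ F X) + p j := by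
      intro X hX
      set Z := (Finset.univ.filter (c · = j)) \ X with hZ
      have e0 : ∑ x with c x = j, Real.sign (v x ⬝ᵥ F X) = ∑ x ∈ Z, Real.sign (v x ⬝ᵥ F X) := by
        symm
        refine Finset.sum_subset Finset.sdiff_subset fun x hx hx' => ?_
        have : x ∈ X := by
          by_contra h
          exact hx' (Finset.mem_sdiff.2 ⟨hx, h⟩)
        rw [(hF X (hTc X hX)).2 x this, Real.sign_zero]
      have h2 := Finset.sum_union (Finset.disjoint_diag_offDiag Z)
        (f := fun ab => Real.sign (v ab.1 ⬝ᵥ F X) * Real.sign (v ab.2 ⬝ᵥ F X))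
      rw [Finset.diag_union_offDiag, Finset.sum_diag, Finset.sum_product] at h2
      rw [e0, sq, Finset.sum_mul_sum, h2, add_comm]
      gcongr
      have h3 : ∑ a ∈ Z, Real.sign (v a ⬝ᵥ F X) * Real.sign (v a ⬝ᵥ F X) ≤ Z.card := by
        rw [Finset.cast_card]
        refine Finset.sum_le_sum fun a _ => ?_
        rcases Real.sign_apply_eq (v a ⬝ᵥ F X) with h | h | h <;> rw [h] <;> norm_num
      rw [hXj X hX] at h3
      linarith
    have h4 : ∑ X ∈ T, (∑ x with c x = j, Real.sign (v x ⬝ᵥ F X)) ^ 2 ≤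
        Y'.card * (q + 2) + T.card * p j := by
      refine (Finset.sum_le_sum hsq).trans ?_
      rw [Finset.sum_add_distrib, hsum]
      simp only [Finset.sum_const, nsmul_eq_mul]
      linarith
    have hq1 : (0 : ℝ) < q + 1 := by positivity
    have h5 : (Y'.card : ℝ) * (q + 2) = T.card * ((p j - q) * (p j - q - 1)) / (q + 1) := by
      rw [cnt2]; field_simp
    refine h4.trans ?_
    rw [h5]
    have hp' := hp j
    have : (p j - q) * (p j - q - 1) / (q + 1) + p j ≤ 2 * p j ^ 2 / (q + 1) := by
      rw [div_add' _ _ _ hq1.ne', div_le_div_iff_of_pos_right hq1]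
      nlinarith
    calc _ = (T.card : ℝ) * ((p j - q) * (p j - q - 1) / (q + 1) + p j) := by ring
      _ ≤ _ := by gcongr
  have hTne : T.Nonempty := transversals_nonempty fun j => by have := hc j; omega
  obtain ⟨X, hX, hle⟩ : ∃ X ∈ T, ∑ j, (∑ x with c x = j, Real.sign (v x ⬝ᵥ F X)) ^ 2 / p j ^ 2
      ≤ 2 * Fintype.card J / (q + 1) := by
    refine Finset.exists_le_of_sum_le hTne ?_
    rw [Finset.sum_comm]
    simp only [Finset.sum_const, nsmul_eq_mul]
    calc _ ≤ ∑ j : J, (T.card : ℝ) * (2 / (q + 1)) := by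
          refine Finset.sum_le_sum fun j _ => ?_
          have hpj : 0 < p j := by linarith [hp j]
          rw [← Finset.sum_div, div_le_iff₀ (by positivity)]
          refine (key j).trans (le_of_eq ?_)
          ring
      _ = _ := by simp; ring
  exact ⟨F X, (hF X (hTc X hX)).1, hle⟩

section

open Filter Topology

/-- The fibres of `c` on which the hyperplane `f` has more than `3/5` of the vectors on one
side. -/
noncomputable def unbalancedFibres {M J : Type*} [Fintype M] [Fintype J] [DecidableEq J]
    {N : ℕ} (c : M → J)
    (v : M → Fin N → ℝ) (f : Fin N → ℝ) : Finset J :=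
  open Classical in
  Finset.univ.filter fun j =>
    3 * (Finset.univ.filter (c · = j)).card <
      5 * (Finset.univ.filter fun x => c x = j ∧ 0 < v x ⬝ᵥ f).card ∨
    3 * (Finset.univ.filter (c · = j)).card <
      5 * (Finset.univ.filter fun x => c x = j ∧ v x ⬝ᵥ f < 0).card

lemma Finset.sum_sign_eq {M : Type*} [DecidableEq M] (s : Finset M) (g : M → ℝ) :
    ∑ x ∈ s, Real.sign (g x) = ((s.filter fun x => 0 < g x).card : ℝ)
      - (s.filter fun x => g x < 0).card := by
  classical
  rw [Finset.card_filter, Finset.card_filter]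
  push_cast
  rw [← Finset.sum_sub_distrib]
  refine Finset.sum_congr rfl fun x _ => ?_
  rcases lt_trichotomy (g x) 0 with h | h | h
  · simp [Real.sign_of_neg h, h, h.not_gt]
  · simp [h]
  · simp [Real.sign_of_pos h, h, h.not_gt]

lemma Finset.card_filter_pos_add_neg_le {M : Type*} (s : Finset M) (g : M → ℝ) :
    (s.filter fun x => 0 < g x).card + (s.filter fun x => g x < 0).card ≤ s.card := by
  classical
  rw [← Finset.card_union_of_disjoint]
  · exact Finset.card_le_card (Finset.union_subset (Finset.filter_subset _ _)
      (Finset.filter_subset _ _))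
  · rw [Finset.disjoint_filter]
    intro x _ h1 h2
    linarith

lemma GenericFamily.exists_card_unbalancedFibres_le {M J : Type*} [Fintype M] [DecidableEq M]
    [Fintype J] [DecidableEq J] {c : M → J} {q N : ℕ} (hN : N = q * Fintype.card J + 1)
    (hc : ∀ j, q + 2 ≤ (Finset.univ.filter (c · = j)).card)
    {v : M → Fin N → ℝ} (hv : GenericFamily v) :
    ∃ f : Fin N → ℝ, f ≠ 0 ∧ (q + 1) * (unbalancedFibres c v f).card ≤ 50 * Fintype.card J := by
  obtain ⟨f, hf0, hf⟩ := hv.exists_sum_sq_le hN hc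
  refine ⟨f, hf0, ?_⟩
  have h1 : ∀ j ∈ unbalancedFibres c v f, (1 / 25 : ℝ) ≤
      (∑ x with c x = j, Real.sign (v x ⬝ᵥ f)) ^ 2 /
        ((Finset.univ.filter (c · = j)).card : ℝ) ^ 2 := by
    intro j hj
    rw [unbalancedFibres, Finset.mem_filter] at hj
    have hj := hj.2
    have e := Finset.sum_sign_eq (Finset.univ.filter (c · = j)) fun x => v x ⬝ᵥ f
    have hle := Finset.card_filter_pos_add_neg_le (Finset.univ.filter (c · = j))
      fun x => v x ⬝ᵥ f
    rw [Finset.filter_filter, Finset.filter_filter] at e hle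
    rw [e]
    have hcj := hc j
    have hp : (0 : ℝ) < ((Finset.univ.filter (c · = j)).card : ℝ) := by
      exact_mod_cast (by omega : 0 < _)
    rw [div_le_div_iff₀ (by norm_num) (by positivity), one_mul]
    generalize hP : (Finset.univ.filter (c · = j)).card = P at *
    generalize hA : (Finset.univ.filter fun x => c x = j ∧ 0 < v x ⬝ᵥ f).card = A at *
    generalize hB : (Finset.univ.filter fun x => c x = j ∧ v x ⬝ᵥ f < 0).card = B at *
    have hle' : (A : ℝ) + B ≤ P := by exact_mod_cast hle
    rcases hj with hj | hj
    · have hj' : (3 : ℝ) * P < 5 * A := by exact_mod_cast hj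
      have : (P : ℝ) ≤ 5 * (A - B) := by linarith
      nlinarith
    · have hj' : (3 : ℝ) * P < 5 * B := by exact_mod_cast hj
      have : (P : ℝ) ≤ 5 * (B - A) := by linarith
      nlinarith
  have h2 : ((unbalancedFibres c v f).card : ℝ) * (1 / 25) ≤ 2 * Fintype.card J / (q + 1) := by
    refine le_trans ?_ hf
    rw [← nsmul_eq_mul]
    refine (Finset.card_nsmul_le_sum _ _ _ h1).trans ?_
    exact Finset.sum_le_univ_sum_of_nonneg fun j => by positivity
  rw [le_div_iff₀ (by positivity)] at h2
  have : ((q : ℝ) + 1) * (unbalancedFibres c v f).card ≤ 50 * Fintype.card J := by linarith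
  exact_mod_cast this

lemma eventually_genericFamily {M : Type*} [Finite M] {N : ℕ} (v : M → Fin N → ℝ) :
    ∃ w : M → Fin N → ℝ, ∀ᶠ ε in 𝓝[>] (0 : ℝ), GenericFamily fun x => v x + ε • w x := by
  classical
  cases nonempty_fintype M
  obtain ⟨t, ht⟩ : ∃ t : M → ℝ, Function.Injective t :=
    ⟨fun x => (Fintype.equivFin M x : ℕ), fun a b h => by
      exact (Fintype.equivFin M).injective (Fin.ext (by
      simpa using (show (((Fintype.equivFin M a : ℕ)) : ℝ) = ((Fintype.equivFin M b : ℕ)) from h)))⟩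
  let w : M → Fin N → ℝ := fun x k => t x ^ (k : ℕ)
  refine ⟨w, ?_⟩
  have hfin : ∀ g : Fin N → M, ∀ᶠ ε in 𝓝[>] (0 : ℝ), Function.Injective g →
      (Matrix.of fun i => v (g i) + ε • w (g i)).det ≠ 0 := by
    intro g
    by_cases hg : Function.Injective g
    swap
    · exact Eventually.of_forall fun _ h => absurd h hg
    let A : Matrix (Fin N) (Fin N) ℝ := Matrix.of fun i => w (g i)
    let B : Matrix (Fin N) (Fin N) ℝ := Matrix.of fun i => v (g i)
    let P : Polynomial ℝ := Matrix.det ((Polynomial.X : Polynomial ℝ) • A.map Polynomial.C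
      + B.map Polynomial.C)
    have hA : A.det ≠ 0 := by
      have : A = Matrix.vandermonde (t ∘ g) := by
        ext i j; simp [A, w, Matrix.vandermonde_apply]
      rw [this, Matrix.det_vandermonde_ne_zero_iff]
      exact ht.comp hg
    have hP : P ≠ 0 := by
      intro h
      have := Polynomial.coeff_det_X_add_C_card A B
      rw [show Matrix.det ((Polynomial.X : Polynomial ℝ) • A.map Polynomial.C
        + B.map Polynomial.C) = 0 from h] at this
      simp at this
      exact hA this.symm
    have hroot : ∀ᶠ ε in 𝓝[>] (0 : ℝ), ε ∉ (P.roots.toFinset : Set ℝ) := by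
      have h1 : ((P.roots.toFinset : Set ℝ) \ {0})ᶜ ∈ 𝓝 (0 : ℝ) :=
        ((P.roots.toFinset.finite_toSet.subset Set.sdiff_subset).isClosed.isOpen_compl).mem_nhds
          (by simp)
      filter_upwards [nhdsWithin_le_nhds h1, self_mem_nhdsWithin] with ε h2 h3 h4
      exact h2 ⟨h4, (ne_of_gt h3 : ε ≠ 0)⟩
    filter_upwards [hroot] with ε hε _ h0
    apply hε
    simp only [Finset.mem_coe, Multiset.mem_toFinset, Polynomial.mem_roots', Polynomial.IsRoot]
    refine ⟨hP, ?_⟩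
    have : (Polynomial.eval ε P) = (Matrix.of fun i => v (g i) + ε • w (g i)).det := by
      rw [← Polynomial.coe_evalRingHom, RingHom.map_det]
      congr 1
      ext i j
      simp [A, B]
      ring
    rw [this, h0]
  have := (eventually_all (ι := Fin N → M)).2 hfin
  exact this.mono fun ε h g hg => h g hg

lemma exists_card_unbalancedFibres_le_of_card_fibre {M J : Type*} [Fintype M] [Fintype J]
    [DecidableEq J] {c : M → J} {q N : ℕ} (hN : N = q * Fintype.card J + 1)
    (hc : ∀ j, q + 2 ≤ (Finset.univ.filter (c · = j)).card) (v : M → Fin N → ℝ) :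
    ∃ f : Fin N → ℝ, f ≠ 0 ∧ (q + 1) * (unbalancedFibres c v f).card ≤ 50 * Fintype.card J := by
  classical
  obtain ⟨w, hw⟩ := eventually_genericFamily v
  have hex : ∀ᶠ ε in 𝓝[>] (0 : ℝ), ∃ f : Fin N → ℝ, ‖f‖ = 1 ∧ (q + 1) *
      (unbalancedFibres c (fun x => v x + ε • w x) f).card ≤ 50 * Fintype.card J := by
    filter_upwards [hw] with ε hε
    obtain ⟨f, hf0, hf⟩ := hε.exists_card_unbalancedFibres_le hN hc
    have hpos : 0 < ‖f‖⁻¹ := inv_pos.2 (norm_pos_iff.2 hf0)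
    have hneg : ∀ r : ℝ, ‖f‖⁻¹ * r < 0 ↔ r < 0 := fun r =>
      ⟨fun h => by by_contra! h2; exact h.not_ge (by positivity), mul_neg_of_pos_of_neg hpos⟩
    refine ⟨‖f‖⁻¹ • f, by rw [norm_smul]; simp [hf0], ?_⟩
    convert hf using 3
    ext j
    simp only [unbalancedFibres, dotProduct_smul, smul_eq_mul, mul_pos_iff_of_pos_left hpos,
      hneg]
  obtain ⟨e, he, hex⟩ := exists_seq_forall_of_frequently hex.frequently
  choose f hf1 hf using hex
  obtain ⟨g, hg, φ, hφ, hlim⟩ := (isCompact_sphere (0 : Fin N → ℝ) 1).tendsto_subseq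
    (x := f) (fun n => by simpa using hf1 n)
  have hg1 : ‖g‖ = 1 := by simpa using hg
  refine ⟨g, fun h => by simp [h] at hg1, ?_⟩
  have hlim2 : ∀ x, Tendsto (fun n => (v x + e (φ n) • w x) ⬝ᵥ f (φ n)) atTop
      (𝓝 (v x ⬝ᵥ g)) := by
    intro x
    have h1 : Tendsto (fun n => v x + e (φ n) • w x) atTop (𝓝 (v x)) := by
      have := ((tendsto_nhdsWithin_iff.1 he).1.comp hφ.tendsto_atTop).smul_const (w x)
      simpa using this.const_add (v x)
    have h2 : Continuous fun y : (Fin N → ℝ) × (Fin N → ℝ) => y.1 ⬝ᵥ y.2 := by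
      unfold dotProduct; fun_prop
    exact (h2.tendsto (v x, g)).comp (h1.prodMk_nhds hlim)
  have hpos : ∀ᶠ n in atTop, ∀ x, 0 < v x ⬝ᵥ g → 0 < (v x + e (φ n) • w x) ⬝ᵥ f (φ n) :=
    eventually_all.2 fun x => by
      by_cases h : 0 < v x ⬝ᵥ g
      · exact ((hlim2 x).eventually (lt_mem_nhds h)).mono fun _ h _ => h
      · exact Eventually.of_forall fun _ h' => absurd h' h
  have hneg : ∀ᶠ n in atTop, ∀ x, v x ⬝ᵥ g < 0 → (v x + e (φ n) • w x) ⬝ᵥ f (φ n) < 0 :=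
    eventually_all.2 fun x => by
      by_cases h : v x ⬝ᵥ g < 0
      · exact ((hlim2 x).eventually (gt_mem_nhds h)).mono fun _ h _ => h
      · exact Eventually.of_forall fun _ h' => absurd h' h
  obtain ⟨n, hn1, hn2⟩ := (hpos.and hneg).exists
  refine le_trans ?_ (hf (φ n))
  gcongr
  intro j hj
  simp only [unbalancedFibres, Finset.mem_filter, Finset.mem_univ, true_and] at hj ⊢
  rcases hj with hj | hj
  · refine Or.inl (hj.trans_le ?_)
    refine Nat.mul_le_mul_left _ (Finset.card_le_card fun x => ?_)
    simp only [Finset.mem_filter, Finset.mem_univ, true_and]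
    exact fun h => ⟨h.1, hn1 x h.2⟩
  · refine Or.inr (hj.trans_le ?_)
    refine Nat.mul_le_mul_left _ (Finset.card_le_card fun x => ?_)
    simp only [Finset.mem_filter, Finset.mem_univ, true_and]
    exact fun h => ⟨h.1, hn2 x h.2⟩

/-- Approximate simultaneous bisection: a hyperplane in `ℝ ^ (q m + 1)` can be chosen so that it
is unbalanced on few of `m` prescribed families of vectors. -/
theorem exists_card_unbalancedFibres_le {M J : Type*} [Fintype M]
    [Fintype J] [DecidableEq J] {c : M → J} (hc : Function.Surjective c) {q N : ℕ}
    (hN : N = q * Fintype.card J + 1) (v : M → Fin N → ℝ) :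
    ∃ f : Fin N → ℝ, f ≠ 0 ∧ (q + 1) * (unbalancedFibres c v f).card ≤ 50 * Fintype.card J := by
  classical
  have hclone : ∀ (P : M → Prop) [DecidablePred P],
      (Finset.univ.filter fun x : M × Fin (q + 2) => P x.1).card =
      (Finset.univ.filter P).card * (q + 2) := by
    intro P _
    have : (Finset.univ.filter fun x : M × Fin (q + 2) => P x.1) =
        (Finset.univ.filter P) ×ˢ (Finset.univ : Finset (Fin (q + 2))) := by
      ext x; simp
    rw [this, Finset.card_product]; simp
  obtain ⟨f, hf0, hf⟩ := exists_card_unbalancedFibres_le_of_card_fibre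
    (c := fun x : M × Fin (q + 2) => c x.1) hN (fun j => by
      rw [hclone fun x => c x = j]
      obtain ⟨x, hx⟩ := hc j
      exact Nat.le_mul_of_pos_left _ (Finset.card_pos.2 ⟨x, by simpa using hx⟩))
    (fun x => v x.1)
  refine ⟨f, hf0, ?_⟩
  convert hf using 3
  ext j
  simp only [unbalancedFibres, Finset.mem_filter, Finset.mem_univ, true_and]
  rw [hclone fun x => c x = j, hclone fun x => c x = j ∧ 0 < v x ⬝ᵥ f,
    hclone fun x => c x = j ∧ v x ⬝ᵥ f < 0]
  rw [← mul_assoc, ← mul_assoc, ← mul_assoc, Nat.mul_lt_mul_right (by omega),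
    Nat.mul_lt_mul_right (by omega)]

end

lemma exists_quantiles_aux {A : Type*} (φ : A → ℝ) (B : ℕ) (S : Finset A) :
    ∃ Q : Finset A, Q ⊆ S ∧ (B + 1) * Q.card ≤ S.card ∧ ∀ I : Set ℝ, I.OrdConnected →
      (∀ q ∈ Q, φ q ∉ I) → ∀ W ⊆ S, (∀ w ∈ W, φ w ∈ I) → W.card ≤ B := by
  classical
  induction S using Finset.strongInduction with
  | H S ih =>
    by_cases hS : S.card ≤ B
    · exact ⟨∅, by simp, by simp, fun I _ _ W hW _ => (Finset.card_le_card hW).trans hS⟩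
    · have hne : (S.filter fun a => B + 1 ≤ (S.filter fun b => φ b ≤ φ a).card).Nonempty := by
        obtain ⟨a, ha, hmax⟩ := S.exists_max_image φ (Finset.card_pos.1 (by omega))
        refine ⟨a, Finset.mem_filter.2 ⟨ha, ?_⟩⟩
        rw [Finset.filter_true_of_mem hmax]
        omega
      obtain ⟨a, ha, hmin⟩ := Finset.exists_min_image _ φ hne
      rw [Finset.mem_filter] at ha
      have hss : (S.filter fun b => φ a < φ b) ⊂ S :=
        Finset.filter_ssubset.2 ⟨a, ha.1, lt_irrefl _⟩
      obtain ⟨Q, hQS, hQc, hQ⟩ := ih _ hss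
      have hcard : (S.filter fun b => φ b ≤ φ a).card + (S.filter fun b => φ a < φ b).card
          = S.card := by
        simpa only [not_le] using Finset.card_filter_add_card_filter_not (s := S) (φ · ≤ φ a)
      refine ⟨insert a Q, ?_, ?_, ?_⟩
      · exact Finset.insert_subset ha.1 (hQS.trans hss.subset)
      · have := Finset.card_insert_le a Q
        nlinarith
      · intro I hI hd W hW hWI
        have haI := hd a (Finset.mem_insert_self _ _)
        by_cases hlt : ∃ w ∈ W, φ w < φ a
        · obtain ⟨w, hw, hwa⟩ := hlt
          have hall : ∀ z ∈ W, φ z < φ a := by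
            intro z hz
            by_contra! h
            exact haI (hI.out (hWI w hw) (hWI z hz) ⟨hwa.le, h⟩)
          obtain ⟨b, hb, hmax⟩ := W.exists_max_image φ ⟨w, hw⟩
          by_contra! hc
          have : b ∈ S.filter fun a => B + 1 ≤ (S.filter fun b => φ b ≤ φ a).card := by
            refine Finset.mem_filter.2 ⟨hW hb, le_trans hc (Finset.card_le_card ?_)⟩
            intro z hz
            exact Finset.mem_filter.2 ⟨hW hz, hmax z hz⟩
          exact absurd (hmin b this) (not_le.2 (hall b hb))
        · push Not at hlt
          refine hQ I hI (fun q hq => hd q (Finset.mem_insert_of_mem hq)) W ?_ hWI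
          intro w hw
          refine Finset.mem_filter.2 ⟨hW hw, lt_of_le_of_ne (hlt w hw) fun h => ?_⟩
          exact haI (h ▸ hWI w hw)

/-- Quantiles: `r` elements of a finite set of reals such that every interval avoiding them
contains at most a fraction `1 / r` of the set. -/
lemma exists_quantiles {A : Type*} (φ : A → ℝ) {r : ℕ} (hr : 0 < r) (S : Finset A) :
    ∃ Q : Finset A, Q ⊆ S ∧ Q.card ≤ r ∧ ∀ I : Set ℝ, I.OrdConnected →
      (∀ q ∈ Q, φ q ∉ I) → ∀ W ⊆ S, (∀ w ∈ W, φ w ∈ I) → (W.card : ℝ) ≤ S.card / r := by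
  obtain ⟨Q, hQS, hQc, hQ⟩ := exists_quantiles_aux φ (S.card / r) S
  refine ⟨Q, hQS, ?_, fun I hI hd W hW hWI => ?_⟩
  · have h1 : S.card < r * (S.card / r + 1) := Nat.lt_mul_div_succ _ hr
    by_contra! h
    nlinarith
  · have h1 := hQ I hI hd W hW hWI
    have h2 : W.card * r ≤ S.card := (Nat.mul_le_mul_right r h1).trans (Nat.div_mul_le_self _ _)
    rw [le_div_iff₀ (by exact_mod_cast hr)]
    exact_mod_cast h2

/-- Two affine functions whose order changes between `x₀` and `x` agree at a point between. -/
lemma crossing_mem_uIcc {s c s' c' x₀ x : ℝ} (h0 : s * x₀ + c ≤ s' * x₀ + c')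
    (h1 : s' * x + c' < s * x + c) : (c - c') / (s' - s) ∈ Set.uIcc x₀ x := by
  rw [Set.mem_uIcc]
  rcases lt_trichotomy s s' with h | h | h
  · right
    have : 0 < s' - s := by linarith
    rw [le_div_iff₀ this, div_le_iff₀ this]
    constructor <;> nlinarith
  · subst h; linarith
  · left
    have : s' - s < 0 := by linarith
    rw [le_div_iff_of_neg this, div_le_iff_of_neg this]
    constructor <;> nlinarith

open MvPolynomial in
lemma exists_planar_sign_partition (r : ℕ) (hr : 0 < r) :
    ∃ D : ℕ, ∀ (ι : Type) [Fintype ι] (p v : ι → Fin 3 → ℝ),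
      (∀ i, v i 0 ≠ 0 ∨ v i 1 ≠ 0) →
      ∃ L : Finset (MvPolynomial (Fin 3) ℝ), L.card ≤ D ∧
        (∀ f ∈ L, f ≠ 0 ∧ f.totalDegree ≤ 1) ∧
        ∀ σ : MvPolynomial (Fin 3) ℝ → SignType, (∀ f ∈ L, σ f ≠ 0) → ∀ W : Finset ι,
          (∀ i ∈ W, ∃ t : ℝ, ∀ f ∈ L, SignType.sign (eval (p i + t • v i) f) = σ f) →
          (W.card : ℝ) ≤ 4 * Fintype.card ι / r := by
  classical
  refine ⟨(r ^ 3 + r) + 2 ^ (r ^ 3 + r) * r, fun ι _ p v hv => ?_⟩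
  let s : ι → ℝ := fun i => v i 1 / v i 0
  let c : ι → ℝ := fun i => p i 1 - s i * p i 0
  let χ : ι × ι → ℝ := fun k => (c k.2 - c k.1) / (s k.1 - s k.2)
  obtain ⟨Q1, -, hQ1c, hQ1⟩ := exists_quantiles χ (r := r ^ 3) (by positivity) Finset.univ
  obtain ⟨Q2, -, hQ2c, hQ2⟩ := exists_quantiles (fun i => p i 0) hr Finset.univ
  set n := Fintype.card ι with hn
  let T : Finset ℝ := Q1.image χ ∪ Q2.image fun i => p i 0
  have hTc : T.card ≤ r ^ 3 + r := (Finset.card_union_le _ _).trans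
    (add_le_add (Finset.card_image_le.trans hQ1c) (Finset.card_image_le.trans hQ2c))
  let I : Finset ℝ → Set ℝ := fun J => {x | ∀ t ∈ T, x ≠ t ∧ (t < x ↔ t ∈ J)}
  have hI : ∀ J, (I J).OrdConnected := by
    intro J
    refine ⟨fun x hx y hy z hz t ht => ?_⟩
    have h1 := hx t ht
    have h2 := hy t ht
    by_cases hJ : t ∈ J
    · have := h1.2.2 hJ
      have hz' : t < z := this.trans_le hz.1
      exact ⟨hz'.ne', fun _ => hJ, fun _ => hz'⟩
    · have : y < t := lt_of_le_of_ne (not_lt.1 fun h => hJ (h2.2.1 h)) h2.1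
      have hz' : z < t := hz.2.trans_lt this
      exact ⟨hz'.ne, fun h => absurd hz' h.not_gt, fun h => absurd h hJ⟩
  have hIT : ∀ J, ∀ t ∈ T, t ∉ I J := fun J t ht h => (h t ht).1 rfl
  let low : Finset ℝ → Finset ι := fun J => Finset.univ.filter fun i =>
    ((Finset.univ.filter fun k => χ (i, k) ∈ I J).card : ℝ) ≤ n / r ^ 2
  let x₀ : Finset ℝ → ℝ := fun J => if h : (I J).Nonempty then h.some else 0
  choose Q hQs hQc hQ using fun J => exists_quantiles (fun i => s i * x₀ J + c i) hr (low J)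
  let L : Finset (MvPolynomial (Fin 3) ℝ) := (T.image fun t => X 0 - C t) ∪
    T.powerset.biUnion fun J => (Q J).image fun i => X 1 - C (s i) * X 0 - C (c i)
  refine ⟨L, ?_, ?_, ?_⟩
  · refine (Finset.card_union_le _ _).trans (add_le_add (Finset.card_image_le.trans hTc) ?_)
    refine Finset.card_biUnion_le.trans ?_
    refine (Finset.sum_le_card_nsmul _ _ r fun J _ => Finset.card_image_le.trans (hQc J)).trans ?_
    rw [Finset.card_powerset, smul_eq_mul]
    exact Nat.mul_le_mul_right _ (Nat.pow_le_pow_right (by norm_num) hTc)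
  · intro f hf
    simp only [L, Finset.mem_union, Finset.mem_image, Finset.mem_biUnion] at hf
    have hX : ∀ k : Fin 3, (X k : MvPolynomial (Fin 3) ℝ).totalDegree ≤ 1 := fun k => by simp
    have hC : ∀ a : ℝ, (C a : MvPolynomial (Fin 3) ℝ).totalDegree ≤ 1 := fun a => by simp
    rcases hf with ⟨t, -, rfl⟩ | ⟨J, -, i, -, rfl⟩
    · refine ⟨fun h => ?_, (totalDegree_sub _ _).trans (max_le (hX _) (hC _))⟩
      have := congrArg (eval fun _ => t + 1) h
      simp at this
    · refine ⟨fun h => ?_, (totalDegree_sub _ _).trans (max_le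
        ((totalDegree_sub _ _).trans (max_le (hX _) ?_)) (hC _))⟩
      · have := congrArg (eval ![0, c i + 1, 0]) h
        simp at this
      · exact (totalDegree_mul _ _).trans (by simp)
  · intro σ hσ W hW
    choose! t ht using hW
    let J : Finset ℝ := T.filter fun a => σ (X 0 - C a) = 1
    have hxI : ∀ i ∈ W, p i 0 + t i * v i 0 ∈ I J := by
      intro i hi a ha
      have hmem : (X 0 - C a : MvPolynomial (Fin 3) ℝ) ∈ L :=
        Finset.mem_union_left _ (Finset.mem_image_of_mem _ ha)
      have h1 := ht i hi _ hmem
      have h2 := hσ _ hmem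
      simp only [map_sub, eval_X, eval_C, Pi.add_apply, Pi.smul_apply, smul_eq_mul] at h1
      refine ⟨fun h => ?_, ?_⟩
      · rw [h] at h1; simp at h1; exact h2 h1.symm
      · simp only [J, Finset.mem_filter, ha, true_and, ← h1, sign_eq_one_iff, sub_pos]
    -- the four kinds of lines meeting the cell
    have hW1 : ((W.filter fun i => v i 0 = 0).card : ℝ) ≤ n / r := by
      refine hQ2 (I J) (hI J) (fun q hq => hIT J _ (Finset.mem_union_right _
        (Finset.mem_image_of_mem _ hq))) _ (Finset.subset_univ _) fun i hi => ?_
      rw [Finset.mem_filter] at hi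
      simpa [hi.2] using hxI i hi.1
    have hr0 : (0 : ℝ) < r := by exact_mod_cast hr
    have hcross : ((Finset.univ.filter fun k => χ k ∈ I J).card : ℝ) ≤ n * n / r ^ 3 := by
      have := hQ1 (I J) (hI J) (fun q hq => hIT J _ (Finset.mem_union_left _
        (Finset.mem_image_of_mem _ hq))) (Finset.univ.filter fun k => χ k ∈ I J)
        (Finset.subset_univ _) fun i hi => (Finset.mem_filter.1 hi).2
      simpa [Finset.card_univ] using this
    have hW2 : (((low J)ᶜ).card : ℝ) ≤ n / r := by
      have h1 : (((low J)ᶜ).card : ℝ) * (n / r ^ 2) ≤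
          ((Finset.univ.filter fun k => χ k ∈ I J).card : ℝ) := by
        have e : (Finset.univ.filter fun k => χ k ∈ I J).card =
            ∑ i, (Finset.univ.filter fun k => χ (i, k) ∈ I J).card := by
          simp only [Finset.card_filter]
          rw [← Finset.univ_product_univ, Finset.sum_product]
        rw [e, ← nsmul_eq_mul]
        push_cast
        refine (Finset.card_nsmul_le_sum _ _ _ fun i hi => ?_).trans
          (Finset.sum_le_univ_sum_of_nonneg fun i => by positivity)
        simp only [low, Finset.mem_compl, Finset.mem_filter, Finset.mem_univ, true_and,
          not_le] at hi
        exact hi.le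
      rcases Nat.eq_zero_or_pos n with h0 | h0
      · have : ((low J)ᶜ).card ≤ n := by simpa [hn] using Finset.card_le_univ _
        rw [h0] at this ⊢
        have : ((low J)ᶜ).card = 0 := by omega
        simp [this]
      · have hn0 : (0 : ℝ) < n := by exact_mod_cast h0
        have h2 := h1.trans hcross
        rw [show (n : ℝ) * n / r ^ 3 = (n / r) * (n / r ^ 2) by field_simp] at h2
        exact le_of_mul_le_mul_right h2 (by positivity)
    let I' : Set ℝ := {y | ∀ q ∈ Q J,
      (σ (X 1 - C (s q) * X 0 - C (c q)) = 1 → s q * x₀ J + c q < y) ∧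
      (σ (X 1 - C (s q) * X 0 - C (c q)) = -1 → y < s q * x₀ J + c q)}
    have hI' : I'.OrdConnected := ⟨fun x hx y hy z hz q hq =>
      ⟨fun h => ((hx q hq).1 h).trans_le hz.1, fun h => hz.2.trans_lt ((hy q hq).2 h)⟩⟩
    have hJT : J ∈ T.powerset := Finset.mem_powerset.2 (Finset.filter_subset _ _)
    have hmemL : ∀ q ∈ Q J, (X 1 - C (s q) * X 0 - C (c q) : MvPolynomial (Fin 3) ℝ) ∈ L :=
      fun q hq => Finset.mem_union_right _ (Finset.mem_biUnion.2 ⟨J, hJT,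
        Finset.mem_image_of_mem _ hq⟩)
    have hW3 : (((low J).filter fun i => s i * x₀ J + c i ∈ I').card : ℝ) ≤ n / r := by
      refine (hQ J I' hI' (fun q hq h => ?_) _ (Finset.filter_subset _ _) fun i hi =>
        (Finset.mem_filter.1 hi).2).trans ?_
      · have h3 := hσ _ (hmemL q hq)
        rcases hs : σ (X 1 - C (s q) * X 0 - C (c q)) with _ | _ | _
        · exact h3 hs
        · exact lt_irrefl _ ((h q hq).2 hs)
        · exact lt_irrefl _ ((h q hq).1 hs)
      · have : (low J).card ≤ n := Finset.card_le_univ _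
        gcongr
    have hW4 : (((Q J).biUnion fun q => Finset.univ.filter fun k => χ (q, k) ∈ I J).card : ℝ)
        ≤ n / r := by
      have h1 : (((Q J).biUnion fun q => Finset.univ.filter fun k => χ (q, k) ∈ I J).card : ℝ)
        ≤ ∑ q ∈ Q J, ((Finset.univ.filter fun k => χ (q, k) ∈ I J).card : ℝ) := by
        exact_mod_cast Finset.card_biUnion_le
      refine h1.trans ((Finset.sum_le_card_nsmul _ _ (n / r ^ 2 : ℝ) fun q hq =>
        (Finset.mem_filter.1 (hQs J hq)).2).trans ?_)
      rw [nsmul_eq_mul, show (n / r : ℝ) = r * (n / r ^ 2) by field_simp]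
      have := hQc J
      gcongr
    have hcover : W ⊆ (W.filter fun i => v i 0 = 0) ∪ (low J)ᶜ ∪
        ((low J).filter fun i => s i * x₀ J + c i ∈ I') ∪
        ((Q J).biUnion fun q => Finset.univ.filter fun k => χ (q, k) ∈ I J) := by
      intro i hi
      simp only [Finset.mem_union, Finset.mem_filter, Finset.mem_compl, Finset.mem_biUnion,
        Finset.mem_univ, true_and, hi]
      by_cases hv0 : v i 0 = 0
      · simp [hv0]
      by_cases hl : i ∈ low J
      swap
      · simp [hl]
      by_cases hy : s i * x₀ J + c i ∈ I'
      · simp [hl, hy]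
      right
      have hx := hxI i hi
      have hx₀ : x₀ J ∈ I J := by
        have hne : (I J).Nonempty := ⟨_, hx⟩
        simp only [x₀, dif_pos hne]
        exact hne.some_mem
      have hyi : p i 1 + t i * v i 1 = s i * (p i 0 + t i * v i 0) + c i := by
        simp only [c, s]; field_simp; ring
      simp only [I', Set.mem_ofPred_eq, not_forall, not_and_or, not_lt] at hy
      obtain ⟨q, hq, hy⟩ := hy
      refine ⟨q, hq, ?_⟩
      have h1 := ht i hi _ (hmemL q hq)
      simp only [map_sub, map_mul, eval_X, eval_C, Pi.add_apply, Pi.smul_apply, smul_eq_mul] at h1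
      rw [hyi] at h1
      rcases hy with ⟨h2, h3⟩ | ⟨h2, h3⟩
      · rw [h2, sign_eq_one_iff] at h1
        exact (hI J).uIcc_subset hx₀ hx (crossing_mem_uIcc h3 (by linarith))
      · rw [h2, sign_eq_neg_one_iff] at h1
        have := crossing_mem_uIcc (s := s q) (c := c q) (s' := s i) (c' := c i) h3
          (by linarith : s i * (p i 0 + t i * v i 0) + c i < _)
        rw [show (c q - c i) / (s i - s q) = (c i - c q) / (s q - s i) by
          rw [← neg_sub (c i), ← neg_sub (s q), neg_div_neg_eq]] at this
        exact (hI J).uIcc_subset hx₀ hx this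
    have h4 := (Finset.card_le_card hcover).trans ((Finset.card_union_le _ _).trans
      (Nat.add_le_add_right ((Finset.card_union_le _ _).trans
        (Nat.add_le_add_right (Finset.card_union_le _ _) _)) _))
    have h5 := (Nat.cast_le (α := ℝ)).2 h4
    push_cast at h5
    refine h5.trans ?_
    rw [show (4 * n / r : ℝ) = n / r + n / r + n / r + n / r by ring]
    gcongr

open MvPolynomial in
/-- A subdivision of space by successively splitting cells along zero sets of polynomials; the
cells that were never put on a zero set are the `alive` ones. -/
structure PolyCutting where
  κ : Type
  [fintype : Fintype κ]
  cell : κ → Set (Fin 3 → ℝ)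
  alive : κ → Prop
  polys : List (MvPolynomial (Fin 3) ℝ)
  deg : ℕ
  polys_ne_zero : ∀ f ∈ polys, f ≠ 0
  sum_totalDegree_le : (polys.map totalDegree).sum ≤ deg
  isOpen_cell : ∀ k, alive k → IsOpen (cell k)
  separated : ∀ k l, k ≠ l → ∀ x ∈ cell k, ∀ y ∈ cell l,
    ∃ f ∈ polys, SignType.sign (eval x f) ≠ SignType.sign (eval y f)
  exists_cell : ∀ x, (∀ f ∈ polys, eval x f ≠ 0) → ∃ k, alive k ∧ x ∈ cell k

attribute [instance] PolyCutting.fintype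

open MvPolynomial in
/-- The restriction of a polynomial to the line `t ↦ p + t v`. -/
noncomputable def lineRestrict (p v : Fin 3 → ℝ) (f : MvPolynomial (Fin 3) ℝ) : Polynomial ℝ :=
  aeval (fun k => Polynomial.C (p k) + Polynomial.C (v k) * Polynomial.X) f

open MvPolynomial in
lemma eval_lineRestrict (p v : Fin 3 → ℝ) (f : MvPolynomial (Fin 3) ℝ) (t : ℝ) :
    (lineRestrict p v f).eval t = eval (p + t • v) f := by
  have : (Polynomial.evalRingHom t).comp (aeval (fun k => Polynomial.C (p k) +
      Polynomial.C (v k) * Polynomial.X)).toRingHom = (eval (p + t • v)) := by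
    refine MvPolynomial.ringHom_ext (fun a => ?_) fun k => ?_
    · simp
    · simp
      ring
  exact RingHom.congr_fun this f

open MvPolynomial in
lemma natDegree_lineRestrict_le (p v : Fin 3 → ℝ) (f : MvPolynomial (Fin 3) ℝ) :
    (lineRestrict p v f).natDegree ≤ f.totalDegree := by
  have := MvPolynomial.aeval_natDegree_le f le_rfl (fun k => Polynomial.C (p k) +
    Polynomial.C (v k) * Polynomial.X) (n := 1) (fun k => by compute_degree)
  simpa [lineRestrict] using this

namespace PolyCutting

variable {ι : Type} [Fintype ι] (p v : ι → Fin 3 → ℝ)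

/-- The lines with an infinite intersection with a cell. -/
noncomputable def inc (X : PolyCutting) (k : X.κ) : Finset ι :=
  open Classical in Finset.univ.filter fun i => {t : ℝ | p i + t • v i ∈ X.cell k}.Infinite

lemma mem_inc {X : PolyCutting} {k : X.κ} {i : ι} :
    i ∈ X.inc p v k ↔ {t : ℝ | p i + t • v i ∈ X.cell k}.Infinite := by
  simp [inc]

/-- The total number of incidences of lines and cells. -/
noncomputable def incidences (X : PolyCutting) : ℕ := ∑ k, (X.inc p v k).card

lemma disjoint_cell (X : PolyCutting) {k l : X.κ} (h : k ≠ l) :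
    Disjoint (X.cell k) (X.cell l) := by
  rw [Set.disjoint_left]
  intro x hx hy
  obtain ⟨f, -, hf⟩ := X.separated k l h x hx x hy
  exact hf rfl

lemma infinite_of_mem_of_isOpen {O : Set (Fin 3 → ℝ)} (hO : IsOpen O) {a b : Fin 3 → ℝ} {t : ℝ}
    (h : a + t • b ∈ O) : {t : ℝ | a + t • b ∈ O}.Infinite :=
  infinite_of_mem_nhds t ((hO.preimage (by fun_prop : Continuous fun t : ℝ => a + t • b)).mem_nhds h)

lemma card_filter_inc_le (X : PolyCutting) (i : ι) [DecidablePred fun k => i ∈ X.inc p v k] :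
    (Finset.univ.filter fun k => i ∈ X.inc p v k).card ≤ X.deg + 1 := by
  classical
  -- the product of the polynomials not vanishing on the line
  let l := (X.polys.map (lineRestrict (p i) (v i))).filter (· ≠ 0)
  let g : Polynomial ℝ := l.prod
  have hg : g ≠ 0 := List.prod_ne_zero (by simp [l])
  have hgdeg : g.natDegree ≤ X.deg := by
    refine (Polynomial.natDegree_list_prod_le _).trans (le_trans ?_ X.sum_totalDegree_le)
    have h1 : (l.map Polynomial.natDegree).sum ≤
        ((X.polys.map (lineRestrict (p i) (v i))).map Polynomial.natDegree).sum :=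
      (List.Sublist.map _ List.filter_sublist).sum_le_sum (by simp)
    refine h1.trans ?_
    rw [List.map_map]
    exact List.sum_le_sum fun f _ => natDegree_lineRestrict_le _ _ _
  have hex : ∀ k : X.κ, ∃ t : ℝ, i ∈ X.inc p v k → p i + t • v i ∈ X.cell k ∧ g.eval t ≠ 0 := by
    intro k
    by_cases hk : i ∈ X.inc p v k
    · obtain ⟨t, ht, ht'⟩ := (((mem_inc p v).1 hk).sdiff g.roots.toFinset.finite_toSet).nonempty
      refine ⟨t, fun _ => ⟨ht, fun h0 => ht' ?_⟩⟩
      simp [hg, h0]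
    · exact ⟨0, fun h => absurd h hk⟩
  choose t ht using hex
  set K := Finset.univ.filter fun k => i ∈ X.inc p v k with hK
  have htK : ∀ k ∈ K, p i + t k • v i ∈ X.cell k ∧ g.eval (t k) ≠ 0 := fun k hk =>
    ht k (Finset.mem_filter.1 hk).2
  have hinj : Set.InjOn t K := by
    intro k hk l hl h
    by_contra hkl
    have h2 := (htK l hl).1
    rw [← h] at h2
    exact Set.disjoint_left.1 (X.disjoint_cell hkl) (htK k hk).1 h2
  rw [← Finset.card_image_of_injOn hinj]
  have hroots : g.roots.toFinset.card ≤ X.deg :=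
    (Multiset.toFinset_card_le _).trans ((Polynomial.card_roots' _).trans hgdeg)
  refine le_trans (Finset.card_le_of_interleaved (t := g.roots.toFinset) ?_)
    (Nat.add_le_add_right hroots 1)
  intro x hx y hy hxy _
  obtain ⟨k, hk, rfl⟩ := Finset.mem_image.1 hx
  obtain ⟨k', hk', rfl⟩ := Finset.mem_image.1 hy
  have hne : k ≠ k' := by rintro rfl; exact lt_irrefl _ hxy
  obtain ⟨f, hf, hsign⟩ := X.separated k k' hne _ (htK k hk).1 _ (htK k' hk').1
  rw [← eval_lineRestrict, ← eval_lineRestrict] at hsign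
  set F := lineRestrict (p i) (v i) f with hF
  have hF0 : F ≠ 0 := by intro h; simp [h] at hsign
  have hFl : F ∈ l := by simp [l, hF0]; exact ⟨f, hf, rfl⟩
  have hdvd : F ∣ g := List.dvd_prod hFl
  have hroot : ∀ z, F.eval z = 0 → g.eval z = 0 := fun z hz => by
    obtain ⟨w, hw⟩ := hdvd
    rw [hw, Polynomial.eval_mul, hz, zero_mul]
  have h1 : F.eval (t k) ≠ 0 := fun h => (htK k hk).2 (hroot _ h)
  have h2 : F.eval (t k') ≠ 0 := fun h => (htK k' hk').2 (hroot _ h)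
  have hc : ContinuousOn (fun z => F.eval z) (Set.Icc (t k) (t k')) := F.continuous.continuousOn
  obtain ⟨z, hz, hz0⟩ : ∃ z ∈ Set.Ioo (t k) (t k'), F.eval z = 0 := by
    rcases lt_or_gt_of_ne h1 with h1 | h1 <;> rcases lt_or_gt_of_ne h2 with h2 | h2
    · simp [sign_neg h1, sign_neg h2] at hsign
    · exact intermediate_value_Ioo hxy.le hc ⟨h1, h2⟩
    · exact intermediate_value_Ioo' hxy.le hc ⟨h2, h1⟩
    · simp [sign_pos h1, sign_pos h2] at hsign
  exact ⟨z, by simp [hg, hroot z hz0], hz.1, hz.2⟩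

lemma incidences_le (X : PolyCutting) : X.incidences p v ≤ Fintype.card ι * (X.deg + 1) := by
  classical
  have : X.incidences p v = ∑ i, (Finset.univ.filter fun k => i ∈ X.inc p v k).card := by
    simp only [incidences, Finset.card_eq_sum_ones, Finset.sum_filter]
    rw [Finset.sum_comm]
    refine Finset.sum_congr rfl fun k _ => ?_
    rw [← Finset.sum_filter]
    congr 1
    ext; simp
  rw [this]
  refine (Finset.sum_le_card_nsmul _ _ _ fun i _ => X.card_filter_inc_le p v i).trans ?_
  simp

end PolyCutting

open MvPolynomial in
/-- Polynomials of degree at most `3 s` parametrized by vectors. -/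
lemma exists_polynomial_parametrization {N s : ℕ} (h : N ≤ (s + 1) ^ 3) :
    ∃ V : (Fin 3 → ℝ) → Fin N → ℝ, ∀ w : Fin N → ℝ, w ≠ 0 →
      ∃ f : MvPolynomial (Fin 3) ℝ, f ≠ 0 ∧ f.totalDegree ≤ 3 * s ∧
        ∀ x, eval x f = V x ⬝ᵥ w := by
  obtain ⟨e⟩ : Nonempty (Fin N ↪ (Fin 3 → Fin (s + 1))) :=
    Function.Embedding.nonempty_of_card_le (by simpa using h)
  let E : Fin N → (Fin 3 →₀ ℕ) := fun j => Finsupp.equivFunOnFinite.symm fun k => (e j k : ℕ)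
  have hE : Function.Injective E := fun a b hab => e.injective <| by
    ext k
    have := DFunLike.congr_fun hab k
    simpa [E] using this
  refine ⟨fun x j => ∏ k, x k ^ E j k, fun w hw => ⟨∑ j, monomial (E j) (w j), fun h0 => hw ?_,
    ?_, fun x => ?_⟩⟩
  · ext j
    have := congrArg (coeff (E j)) h0
    simpa [coeff_sum, coeff_monomial, hE.eq_iff] using this
  · refine totalDegree_finsetSum_le fun j _ => (totalDegree_monomial_le _ _).trans ?_
    rw [Finsupp.sum_fintype _ _ (by simp)]
    simp only [E, Finsupp.equivFunOnFinite_symm_apply_apply, Fin.sum_univ_three, id_eq]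
    have := fun k => (e j k).is_le
    have h0 := this 0
    have h1 := this 1
    have h2 := this 2
    omega
  · simp only [map_sum, eval_monomial, dotProduct]
    refine Finset.sum_congr rfl fun j _ => ?_
    rw [Finsupp.prod_fintype _ _ (by simp), mul_comm]

namespace PolyCutting

open MvPolynomial in
/-- Split the cells in `S` along the zero set of `f`. -/
noncomputable def split (X : PolyCutting) (S : X.κ → Prop) (hS : ∀ k, S k → X.alive k)
    (f : MvPolynomial (Fin 3) ℝ) (hf : f ≠ 0) (d : ℕ) (hd : f.totalDegree ≤ d) : PolyCutting where
  κ := {k // ¬ S k} ⊕ ({k // S k} × SignType)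
  fintype := open Classical in inferInstance
  cell := Sum.elim (fun k => X.cell k)
    fun k => X.cell k.1 ∩ {x | SignType.sign (eval x f) = k.2}
  alive := Sum.elim (fun k => X.alive k) fun k => k.2 ≠ 0
  polys := f :: X.polys
  deg := X.deg + d
  polys_ne_zero := by
    intro g hg
    rcases List.mem_cons.1 hg with rfl | hg
    · exact hf
    · exact X.polys_ne_zero g hg
  sum_totalDegree_le := by
    have := X.sum_totalDegree_le
    simp only [List.map_cons, List.sum_cons]
    omega
  isOpen_cell := by
    have hcont : Continuous fun x : Fin 3 → ℝ => eval x f := MvPolynomial.continuous_eval f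
    rintro (k | ⟨k, s⟩) hk
    · exact X.isOpen_cell _ hk
    · refine (X.isOpen_cell _ (hS _ k.2)).inter ?_
      rcases s with _ | _ | _
      · exact absurd rfl hk
      · have : {x | SignType.sign (eval x f) = SignType.neg} = {x | eval x f < 0} := by
          ext x; exact sign_eq_neg_one_iff
        simp only [this]
        exact isOpen_lt hcont continuous_const
      · have : {x | SignType.sign (eval x f) = SignType.pos} = {x | 0 < eval x f} := by
          ext x; exact sign_eq_one_iff
        simp only [this]
        exact isOpen_lt continuous_const hcont
  separated := by
    have key : ∀ k l, k ≠ l → ∀ x ∈ X.cell k, ∀ y ∈ X.cell l,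
        ∃ g ∈ f :: X.polys, SignType.sign (eval x g) ≠ SignType.sign (eval y g) := by
      intro k l hkl x hx y hy
      obtain ⟨g, hg, h⟩ := X.separated k l hkl x hx y hy
      exact ⟨g, List.mem_cons_of_mem _ hg, h⟩
    rintro (k | ⟨k, s⟩) (l | ⟨l, s'⟩) hkl x hx y hy
    · exact key k l (fun h => hkl (by rw [Subtype.ext h])) x hx y hy
    · exact key k l (fun h => k.2 (h ▸ l.2)) x hx y hy.1
    · exact key k l (fun h => l.2 (h ▸ k.2)) x hx.1 y hy
    · by_cases h : k = l
      · subst h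
        refine ⟨f, List.mem_cons_self, ?_⟩
        have h1 : SignType.sign (eval x f) = s := hx.2
        have h2 : SignType.sign (eval y f) = s' := hy.2
        rw [h1, h2]
        rintro rfl
        exact hkl rfl
      · exact key k l (fun h' => h (Subtype.ext h')) x hx.1 y hy.1
  exists_cell := by
    intro x hx
    obtain ⟨k, hk, hxk⟩ := X.exists_cell x fun g hg => hx g (List.mem_cons_of_mem _ hg)
    by_cases h : S k
    · refine ⟨Sum.inr (⟨k, h⟩, SignType.sign (eval x f)), ?_, hxk, rfl⟩
      exact sign_ne_zero.2 (hx f List.mem_cons_self)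
    · exact ⟨Sum.inl ⟨k, h⟩, hk, hxk⟩

variable {ι : Type} [Fintype ι] (p v : ι → Fin 3 → ℝ)

/-- The cells whose number of lines is between `A` and `4 A / 3`. -/
noncomputable def heavy (X : PolyCutting) (A : ℝ) : Finset X.κ :=
  open Classical in Finset.univ.filter fun k =>
    X.alive k ∧ A < (X.inc p v k).card ∧ 3 * ((X.inc p v k).card : ℝ) ≤ 4 * A

lemma mem_heavy {X : PolyCutting} {A : ℝ} {k : X.κ} : k ∈ X.heavy p v A ↔
    X.alive k ∧ A < (X.inc p v k).card ∧ 3 * ((X.inc p v k).card : ℝ) ≤ 4 * A := by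
  simp [heavy]

open Classical in
/-- The sum of `α`-th powers of the numbers of lines in cells meeting more than `B` lines. -/
noncomputable def heavySum (X : PolyCutting) (B α : ℝ) : ℝ :=
  ∑ k, if X.alive k ∧ B < (X.inc p v k).card then ((X.inc p v k).card : ℝ) ^ α else 0

section Split

variable (X : PolyCutting) (S : X.κ → Prop) (hS : ∀ k, S k → X.alive k)
    (f : MvPolynomial (Fin 3) ℝ) (hf : f ≠ 0) (d : ℕ) (hd : f.totalDegree ≤ d)

/-- A cell created by the splitting. -/
def child (k : {k // S k}) (s : SignType) : (X.split S hS f hf d hd).κ := Sum.inr (k, s)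

lemma mem_inc_child {k : {k // S k}} {s : SignType} {i : ι} :
    i ∈ (X.split S hS f hf d hd).inc p v (X.child S hS f hf d hd k s) ↔
      {t : ℝ | p i + t • v i ∈ X.cell k ∧
        SignType.sign (MvPolynomial.eval (p i + t • v i) f) = s}.Infinite :=
  mem_inc p v

lemma inc_split_subset (k : {k // S k}) (s : SignType) :
    (X.split S hS f hf d hd).inc p v (X.child S hS f hf d hd k s) ⊆ X.inc p v k := by
  intro i hi
  rw [mem_inc_child] at hi
  rw [mem_inc]
  exact hi.mono fun t ht => ht.1

lemma sum_split {G : Type*} [AddCommMonoid G] (g : (X.split S hS f hf d hd).κ → G)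
    [Fintype {k // S k}] [Fintype {k // ¬ S k}] :
    ∑ k, g k = ∑ k : {k // ¬ S k}, g (Sum.inl k) +
      ∑ k : {k // S k}, ∑ s, g (X.child S hS f hf d hd k s) := by
  classical
  rw [← Fintype.sum_prod_type']
  let g₀ : {k // ¬ S k} ⊕ ({k // S k} × SignType) → G := g
  have h : ∑ k, g k = ∑ k, g₀ k := by
    refine Finset.sum_bijective (t := (Finset.univ : Finset ({k // ¬ S k} ⊕ _)))
      (g := g₀) id Function.bijective_id (fun _ =>
        ⟨fun _ => Finset.mem_univ _, fun _ => Finset.mem_univ _⟩) fun _ _ => rfl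
  exact h.trans (Fintype.sum_sum_type g₀)

lemma heavySum_split {A : ℝ} (h : ∀ k, S k → 3 * ((X.inc p v k).card : ℝ) ≤ 4 * A) (α : ℝ) :
    (X.split S hS f hf d hd).heavySum p v (4 * A / 3) α = X.heavySum p v (4 * A / 3) α := by
  classical
  simp only [heavySum]
  rw [← Fintype.sum_subtype_add_sum_subtype S, Finset.sum_eq_zero (s := (Finset.univ :
    Finset {k // S k})), zero_add, sum_split, Finset.sum_eq_zero (s := (Finset.univ :
    Finset {k // S k})), add_zero]
  · rfl
  · rintro k -
    refine Finset.sum_eq_zero fun s _ => ?_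
    rw [if_neg]
    rintro ⟨-, h1⟩
    have h2 := h k k.2
    have h3 : (((X.split S hS f hf d hd).inc p v (X.child S hS f hf d hd k s)).card : ℝ) ≤
        (X.inc p v k).card := by
      exact_mod_cast Finset.card_le_card (inc_split_subset p v X S hS f hf d hd k s)
    linarith
  · rintro k -
    rw [if_neg]
    rintro ⟨-, h1⟩
    have h2 := h k k.2
    linarith

/-- The lines of a cell passing through both sides of the splitting polynomial. -/
noncomputable def crossed (k : {k // S k}) : Finset ι :=
  open Classical in (X.split S hS f hf d hd).inc p v (X.child S hS f hf d hd k 1) ∩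
    (X.split S hS f hf d hd).inc p v (X.child S hS f hf d hd k (-1))

lemma card_inc_add_card_crossed_le (k : {k // S k}) :
    (X.inc p v k).card + (crossed p v X S hS f hf d hd k).card ≤
      ∑ s, ((X.split S hS f hf d hd).inc p v (X.child S hS f hf d hd k s)).card := by
  classical
  set I := fun s => (X.split S hS f hf d hd).inc p v (X.child S hS f hf d hd k s) with hI
  have hsub : X.inc p v k ⊆ (I 1 ∪ I (-1)) ∪ I 0 := by
    intro i hi
    rw [mem_inc] at hi
    by_contra hc
    simp only [Finset.mem_union, not_or, hI, mem_inc_child, Set.not_infinite] at hc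
    refine hi (((hc.1.1.union hc.1.2).union hc.2).subset fun t ht => ?_)
    rcases h : SignType.sign (MvPolynomial.eval (p i + t • v i) f) with _ | _ | _
    · exact Or.inr ⟨ht, h⟩
    · exact Or.inl (Or.inr ⟨ht, h⟩)
    · exact Or.inl (Or.inl ⟨ht, h⟩)
  have h1 := Finset.card_le_card hsub
  have h2 := Finset.card_union_le (I 1 ∪ I (-1)) (I 0)
  have h3 := Finset.card_union_add_card_inter (I 1) (I (-1))
  have h4 : ∑ s, (I s).card = (I 0).card + (I (-1)).card + (I 1).card := by
    rw [show (Finset.univ : Finset SignType) = {0, -1, 1} from rfl]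
    simp [add_assoc]
  have h5 : (crossed p v X S hS f hf d hd k) = I 1 ∩ I (-1) := by
    simp only [crossed, hI]
  rw [h5]
  change _ ≤ ∑ s, (I s).card
  omega

lemma incidences_add_sum_crossed_le [Fintype {k // S k}] :
    X.incidences p v + ∑ k, (crossed p v X S hS f hf d hd k).card ≤
      (X.split S hS f hf d hd).incidences p v := by
  classical
  have e : (X.split S hS f hf d hd).incidences p v = ∑ k : {k // ¬ S k}, (X.inc p v k).card +
      ∑ k : {k // S k}, ∑ s,
        ((X.split S hS f hf d hd).inc p v (X.child S hS f hf d hd k s)).card :=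
    X.sum_split S hS f hf d hd _
  have e2 : X.incidences p v = ∑ k : {k // S k}, (X.inc p v k).card +
      ∑ k : {k // ¬ S k}, (X.inc p v k).card := by
    rw [incidences, ← Fintype.sum_subtype_add_sum_subtype S]
    congr!
  have e3 : ∑ k : {k // S k}, (X.inc p v k).card +
      ∑ k, (crossed p v X S hS f hf d hd k).card ≤ ∑ k : {k // S k}, ∑ s,
        ((X.split S hS f hf d hd).inc p v (X.child S hS f hf d hd k s)).card := by
    rw [← Finset.sum_add_distrib]
    exact Finset.sum_le_sum fun k _ => card_inc_add_card_crossed_le p v X S hS f hf d hd k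
  rw [e, e2]
  omega

end Split

end PolyCutting

namespace PolyCutting

variable {ι : Type} [Fintype ι] (p v : ι → Fin 3 → ℝ)

section

variable (X : PolyCutting) (S : X.κ → Prop) (hS : ∀ k, S k → X.alive k)
    (f : MvPolynomial (Fin 3) ℝ) (hf : f ≠ 0) (d : ℕ) (hd : f.totalDegree ≤ d)

/-- The lines with marked point on the zero set of `f` but which are not contained in it. -/
noncomputable def touching (τ : X.κ → ι → ℝ) (k : X.κ) : Finset ι :=
  open Classical in (X.inc p v k).filter fun i =>
    MvPolynomial.eval (p i + τ k i • v i) f = 0 ∧ lineRestrict (p i) (v i) f ≠ 0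

lemma sum_card_touching_le {τ : X.κ → ι → ℝ}
    (hτ : ∀ k, ∀ i ∈ X.inc p v k, p i + τ k i • v i ∈ X.cell k) :
    ∑ k, (X.touching p v f τ k).card ≤ Fintype.card ι * f.totalDegree := by
  classical
  have : ∑ k, (X.touching p v f τ k).card =
      ∑ i, (Finset.univ.filter fun k => i ∈ X.touching p v f τ k).card := by
    simp only [Finset.card_eq_sum_ones, Finset.sum_filter]
    rw [Finset.sum_comm]
    refine Finset.sum_congr rfl fun k _ => ?_
    rw [← Finset.sum_filter]
    congr 1
    ext; simp
  rw [this]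
  refine (Finset.sum_le_card_nsmul _ _ f.totalDegree fun i _ => ?_).trans (by simp)
  rcases (Finset.univ.filter fun k => i ∈ X.touching p v f τ k).eq_empty_or_nonempty with h0 | h0
  · simp [h0]
  have hmem : ∀ k ∈ Finset.univ.filter fun k => i ∈ X.touching p v f τ k,
      i ∈ X.inc p v k ∧ (lineRestrict (p i) (v i) f).eval (τ k i) = 0 ∧
        lineRestrict (p i) (v i) f ≠ 0 := by
    intro k hk
    simpa [touching, eval_lineRestrict] using hk
  obtain ⟨k₀, hk₀⟩ := h0
  have hne := (hmem k₀ hk₀).2.2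
  rw [← Finset.card_image_of_injOn (f := fun k => τ k i) (fun k hk l hl h => by
    by_contra hkl
    have h1 := hτ k i (hmem k hk).1
    have h2 := hτ l i (hmem l hl).1
    have h : τ k i = τ l i := h
    rw [← h] at h2
    exact Set.disjoint_left.1 (X.disjoint_cell hkl) h1 h2)]
  calc _ ≤ (lineRestrict (p i) (v i) f).roots.toFinset.card := by
        refine Finset.card_le_card fun t ht => ?_
        obtain ⟨k, hk, rfl⟩ := Finset.mem_image.1 ht
        simpa [hne] using (hmem k hk).2.1
    _ ≤ _ := (Multiset.toFinset_card_le _).trans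
        ((Polynomial.card_roots' _).trans (natDegree_lineRestrict_le _ _ _))

lemma inc_child_subset {τ : X.κ → ι → ℝ}
    (hτ : ∀ k, ∀ i ∈ X.inc p v k, p i + τ k i • v i ∈ X.cell k) (k : {k // S k})
    {s : SignType} (hs : s ≠ 0) [DecidableEq ι] :
    (X.split S hS f hf d hd).inc p v (X.child S hS f hf d hd k s) ⊆
      ((X.inc p v k).filter fun i =>
        SignType.sign (MvPolynomial.eval (p i + τ k i • v i) f) = s) ∪
      (crossed p v X S hS f hf d hd k ∪ X.touching p v f τ k) := by
  classical
  have hcont : Continuous fun x : Fin 3 → ℝ => MvPolynomial.eval x f :=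
    MvPolynomial.continuous_eval f
  intro i hi
  have hik := inc_split_subset p v X S hS f hf d hd k s hi
  have hmark := hτ k i hik
  set x := p i + τ k i • v i with hx
  by_cases h1 : SignType.sign (MvPolynomial.eval x f) = s
  · exact Finset.mem_union_left _ (Finset.mem_filter.2 ⟨hik, h1⟩)
  refine Finset.mem_union_right _ ?_
  have hopen := X.isOpen_cell k (hS _ k.2)
  have hchild : ∀ s' : SignType, s' ≠ 0 → SignType.sign (MvPolynomial.eval x f) = s' →
      i ∈ (X.split S hS f hf d hd).inc p v (X.child S hS f hf d hd k s') := by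
    intro s' hs' h
    have : IsOpen (X.cell k ∩ {y | SignType.sign (MvPolynomial.eval y f) = s'}) :=
      (X.split S hS f hf d hd).isOpen_cell (X.child S hS f hf d hd k s') hs'
    exact (mem_inc p v).2 (infinite_of_mem_of_isOpen this ⟨hmark, h⟩)
  have hinf := (mem_inc_child p v X S hS f hf d hd).1 hi
  by_cases h0 : MvPolynomial.eval x f = 0
  · refine Finset.mem_union_right _ (Finset.mem_filter.2 ⟨hik, h0, fun h => ?_⟩)
    obtain ⟨t, -, ht⟩ := hinf.nonempty
    rw [← eval_lineRestrict, h] at ht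
    simp at ht
    exact hs ht.symm
  · refine Finset.mem_union_left _ ?_
    have h2 := hchild _ (sign_ne_zero.2 h0) rfl
    have h3 : SignType.sign (MvPolynomial.eval x f) ≠ 0 := sign_ne_zero.2 h0
    suffices h : i ∈ (X.split S hS f hf d hd).inc p v (X.child S hS f hf d hd k 1) ∧
        i ∈ (X.split S hS f hf d hd).inc p v (X.child S hS f hf d hd k (-1)) by
      rw [crossed]
      convert Finset.mem_inter.2 h
    generalize SignType.sign (MvPolynomial.eval x f) = s' at h1 h2 h3
    rcases s with _ | _ | _ <;> rcases s' with _ | _ | _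
    all_goals first
      | exact absurd rfl hs
      | exact absurd rfl h1
      | exact absurd rfl h3
      | exact ⟨hi, h2⟩
      | exact ⟨h2, hi⟩

end

/-- A polynomial bisecting most cells with many lines; the cells which do not get bisected can be
charged to the increase of the number of incidences. -/
lemma exists_split (X : PolyCutting) {A : ℝ} (hA : 0 < A) (hm : (X.heavy p v A).Nonempty)
    (α : ℝ) :
    ∃ (X' : PolyCutting) (d : ℕ), 1 ≤ d ∧ X'.deg = X.deg + d ∧
      (d : ℝ) ^ 3 ≤ 54 ^ 3 * ((X.heavy p v A).card : ℝ) ∧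
      X.incidences p v ≤ X'.incidences p v ∧
      ((X'.heavy p v A).card : ℝ) ≤ (X.heavy p v A).card / 25 +
        40 * ((X'.incidences p v : ℝ) - X.incidences p v) / A +
        40 * (Fintype.card ι * d) / A ∧
      X'.heavySum p v (4 * A / 3) α = X.heavySum p v (4 * A / 3) α := by
  classical
  set m := (X.heavy p v A).card with hmdef
  have hm0 : 0 < m := Finset.card_pos.2 hm
  set S : X.κ → Prop := fun k => k ∈ X.heavy p v A with hSdef
  have hS : ∀ k, S k → X.alive k := fun k hk => ((mem_heavy p v).1 hk).1
  have hnk : ∀ k : {k // S k}, A < (X.inc p v k).card := fun k => ((mem_heavy p v).1 k.2).2.1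
  have hnk2 : ∀ k, S k → 3 * ((X.inc p v k).card : ℝ) ≤ 4 * A :=
    fun k hk => ((mem_heavy p v).1 hk).2.2
  have hcardJ : Fintype.card {k // S k} = m := by
    rw [Fintype.card_subtype]; simp [hSdef, hmdef]
  -- the degree
  have hex : ∃ s : ℕ, 4999 * m + 1 ≤ (s + 1) ^ 3 :=
    ⟨4999 * m, (Nat.le_self_pow (by norm_num) _)⟩
  set s := Nat.find hex with hsdef
  have hs1 := Nat.find_spec hex
  have hs0 : 1 ≤ s := by
    by_contra h
    have h0 : s = 0 := by omega
    rw [← hsdef, h0] at hs1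
    omega
  have hs2 : s ^ 3 ≤ 4999 * m := by
    have := Nat.find_min hex (m := s - 1) (by omega)
    rw [Nat.sub_add_cancel hs0] at this
    omega
  -- the marks
  have hτ : ∃ τ : X.κ → ι → ℝ, ∀ k, ∀ i ∈ X.inc p v k, p i + τ k i • v i ∈ X.cell k := by
    have : ∀ k i, ∃ t : ℝ, i ∈ X.inc p v k → p i + t • v i ∈ X.cell k := by
      intro k i
      by_cases h : i ∈ X.inc p v k
      · obtain ⟨t, ht⟩ := ((mem_inc p v).1 h).nonempty
        exact ⟨t, fun _ => ht⟩
      · exact ⟨0, fun h' => absurd h' h⟩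
    choose τ hτ using this
    exact ⟨τ, hτ⟩
  obtain ⟨τ, hτ⟩ := hτ
  obtain ⟨V, hV⟩ := exists_polynomial_parametrization hs1
  let M := {x : {k // S k} × ι // x.2 ∈ X.inc p v x.1}
  let c : M → {k // S k} := fun x => x.1.1
  have hc : Function.Surjective c := by
    intro k
    have : (0 : ℝ) < (X.inc p v k).card := hA.trans (hnk k)
    obtain ⟨i, hi⟩ := Finset.card_pos.1 (by exact_mod_cast this)
    exact ⟨⟨(k, i), hi⟩, rfl⟩
  obtain ⟨w, hw, hbad⟩ := exists_card_unbalancedFibres_le hc (q := 4999) (N := 4999 * m + 1)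
    (by rw [hcardJ]) (fun x => V (p x.1.2 + τ x.1.1 x.1.2 • v x.1.2))
  obtain ⟨f, hf, hfd, hfe⟩ := hV w hw
  set U := unbalancedFibres c (fun x => V (p x.1.2 + τ x.1.1 x.1.2 • v x.1.2)) w with hU
  set X' := X.split S hS f hf (3 * s) hfd with hX'
  have hbal : ∀ k : {k // S k}, k ∉ U → ∀ σ : SignType, σ ≠ 0 →
      5 * ((X.inc p v k).filter fun i =>
        SignType.sign (MvPolynomial.eval (p i + τ k i • v i) f) = σ).card ≤
      3 * (X.inc p v k).card := by
    intro k hk σ hσ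
    simp only [hU, unbalancedFibres, Finset.mem_filter, Finset.mem_univ, true_and, not_or,
      not_lt] at hk
    have hfib : (Finset.univ.filter fun x : M => c x = k).card ≤ (X.inc p v k).card := by
      refine Finset.card_le_card_of_injOn (fun x => x.1.2) ?_ ?_
      · rintro x hx
        have h : x.1.1 = k := (Finset.mem_filter.1 hx).2
        have := x.2
        rw [h] at this
        exact this
      · intro x hx y hy hxy
        have h1 : x.1.1 = k := (Finset.mem_filter.1 hx).2
        have h2 : y.1.1 = k := (Finset.mem_filter.1 hy).2
        exact Subtype.ext (Prod.ext (h1.trans h2.symm) hxy)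
    have hpos : ∀ P : ℝ → Prop, (∀ z, SignType.sign z = σ → P z) →
        ((X.inc p v k).filter fun i =>
          SignType.sign (MvPolynomial.eval (p i + τ k i • v i) f) = σ).card ≤
        (Finset.univ.filter fun x : M => c x = k ∧
          P (V (p x.1.2 + τ x.1.1 x.1.2 • v x.1.2) ⬝ᵥ w)).card := by
      intro P hP
      rw [← Finset.card_attach]
      refine Finset.card_le_card_of_injOn
        (fun i => ⟨(k, i.1), (Finset.mem_filter.1 i.2).1⟩) ?_ ?_
      · rintro i -
        simp only [Finset.coe_filter, Finset.mem_univ, true_and, Set.mem_ofPred_eq, c]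
        refine hP _ ?_
        rw [← hfe]
        exact (Finset.mem_filter.1 i.2).2
      · intro i _ j _ hij
        have := congrArg (fun x : M => x.1.2) hij
        exact Subtype.ext this
    rcases σ with _ | _ | _
    · exact absurd rfl hσ
    · have := hpos (· < 0) fun z hz => sign_eq_neg_one_iff.1 hz
      have := hk.2
      omega
    · have := hpos (0 < ·) fun z hz => sign_eq_one_iff.1 hz
      have := hk.1
      omega
  set B₁ : Finset {k // S k} := Finset.univ.filter fun k =>
    A / 20 < (crossed p v X S hS f hf (3 * s) hfd k).card with hB₁
  set B₂ : Finset {k // S k} := Finset.univ.filter fun k =>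
    A / 20 < (X.touching p v f τ k).card with hB₂
  have hB₁le : (B₁.card : ℝ) * (A / 20) ≤ (X'.incidences p v : ℝ) - X.incidences p v := by
    have h1 := incidences_add_sum_crossed_le p v X S hS f hf (3 * s) hfd
    have h2 : (X.incidences p v : ℝ) + ∑ k, ((crossed p v X S hS f hf (3 * s) hfd k).card : ℝ) ≤
      X'.incidences p v := by exact_mod_cast h1
    have h3 : (B₁.card : ℝ) * (A / 20) ≤
        ∑ k ∈ B₁, ((crossed p v X S hS f hf (3 * s) hfd k).card : ℝ) := by
      rw [← nsmul_eq_mul]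
      exact Finset.card_nsmul_le_sum _ _ _ fun k hk => (Finset.mem_filter.1 hk).2.le
    have h4 : ∑ k ∈ B₁, ((crossed p v X S hS f hf (3 * s) hfd k).card : ℝ) ≤
        ∑ k, ((crossed p v X S hS f hf (3 * s) hfd k).card : ℝ) :=
      Finset.sum_le_sum_of_subset_of_nonneg (Finset.subset_univ _) fun _ _ _ => by positivity
    linarith
  have hB₂le : (B₂.card : ℝ) * (A / 20) ≤ Fintype.card ι * (3 * s : ℕ) := by
    have h1 : (∑ k, ((X.touching p v f τ k).card : ℝ)) ≤ Fintype.card ι * (3 * s : ℕ) := by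
      exact_mod_cast (X.sum_card_touching_le p v f hτ).trans (Nat.mul_le_mul_left _ hfd)
    have h3 : (B₂.card : ℝ) * (A / 20) ≤ ∑ k ∈ B₂, ((X.touching p v f τ k).card : ℝ) := by
      rw [← nsmul_eq_mul]
      exact Finset.card_nsmul_le_sum _ _ _ fun k hk => (Finset.mem_filter.1 hk).2.le
    have h4 : ∑ k ∈ B₂, ((X.touching p v f τ k).card : ℝ) ≤
        ∑ k, ((X.touching p v f τ k).card : ℝ) := by
      refine (Finset.sum_map B₂ (Function.Embedding.subtype _)
        (fun k => ((X.touching p v f τ k).card : ℝ))).symm.trans_le ?_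
      exact Finset.sum_le_sum_of_subset_of_nonneg (Finset.subset_univ _) fun _ _ _ => by positivity
    linarith
  have hUle : (U.card : ℝ) ≤ m / 100 := by
    rw [hcardJ] at hbad
    have : ((4999 + 1 : ℕ) : ℝ) * U.card ≤ 50 * m := by exact_mod_cast hbad
    push_cast at this
    linarith
  have hheavy : (X'.heavy p v A).card ≤ 2 * (U ∪ (B₁ ∪ B₂)).card := by
    have hsub : X'.heavy p v A ⊆ ((U ∪ (B₁ ∪ B₂)) ×ˢ ({1, -1} : Finset SignType)).image
        fun x => X.child S hS f hf (3 * s) hfd x.1 x.2 := by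
      intro k hk
      obtain ⟨hal, h1, h2⟩ := (mem_heavy p v).1 hk
      rcases k with k | ⟨k, σ⟩
      · exact absurd ((mem_heavy p v (X := X)).2 ⟨hal, h1, h2⟩) k.2
      have hσ : σ ≠ 0 := hal
      refine Finset.mem_image.2 ⟨(k, σ), Finset.mem_product.2 ⟨?_, ?_⟩, rfl⟩
      · by_contra hgood
        simp only [Finset.mem_union, not_or] at hgood
        obtain ⟨hg1, hg2, hg3⟩ := hgood
        have hg1 := hbal k hg1 σ hσ
        simp only [hB₁, Finset.mem_filter, Finset.mem_univ, true_and, not_lt] at hg2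
        simp only [hB₂, Finset.mem_filter, Finset.mem_univ, true_and, not_lt] at hg3
        have h4 : (X'.inc p v (X.child S hS f hf (3 * s) hfd k σ)).card ≤ _ :=
          (Finset.card_le_card (inc_child_subset p v X S hS f hf (3 * s) hfd hτ k hσ)).trans
            ((Finset.card_union_le _ _).trans
              (Nat.add_le_add_left (Finset.card_union_le _ _) _))
        have h4' : ((X'.inc p v (X.child S hS f hf (3 * s) hfd k σ)).card : ℝ) ≤ _ :=
          Nat.cast_le.2 h4
        have h5 := hnk2 k k.2
        have h6 : (5 : ℝ) * ((X.inc p v k).filter fun i =>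
            SignType.sign (MvPolynomial.eval (p i + τ k i • v i) f) = σ).card ≤
            3 * (X.inc p v k).card := by exact_mod_cast hg1
        have h7 : A < ((X'.inc p v (X.child S hS f hf (3 * s) hfd k σ)).card : ℝ) := h1
        push_cast at h4'
        linarith
      · rcases σ with _ | _ | _
        · exact absurd rfl hσ
        · exact Finset.mem_insert_of_mem (Finset.mem_singleton_self _)
        · exact Finset.mem_insert_self _ _
    refine (Finset.card_le_card hsub).trans (Finset.card_image_le.trans ?_)
    rw [Finset.card_product, mul_comm]
    exact Nat.mul_le_mul_right _ (by decide)
  refine ⟨X', 3 * s, by omega, rfl, ?_, ?_, ?_, ?_⟩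
  · have : (3 * s) ^ 3 ≤ 54 ^ 3 * m := by
      rw [mul_pow]
      omega
    exact_mod_cast this
  · exact (Nat.le_add_right _ _).trans
      (incidences_add_sum_crossed_le p v X S hS f hf (3 * s) hfd)
  · have h1 : (U ∪ (B₁ ∪ B₂)).card ≤ U.card + (B₁.card + B₂.card) :=
      (Finset.card_union_le _ _).trans (Nat.add_le_add_left (Finset.card_union_le _ _) _)
    have h2 : ((X'.heavy p v A).card : ℝ) ≤ 2 * (U.card + (B₁.card + B₂.card)) := by
      exact_mod_cast hheavy.trans (Nat.mul_le_mul_left 2 h1)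
    have h3 : (B₁.card : ℝ) ≤ 20 * ((X'.incidences p v : ℝ) - X.incidences p v) / A := by
      rw [le_div_iff₀ hA]; linarith
    have h4 : (B₂.card : ℝ) ≤ 20 * (Fintype.card ι * (3 * s : ℕ)) / A := by
      rw [le_div_iff₀ hA]; linarith
    have h5 : (40 : ℝ) * ((X'.incidences p v : ℝ) - X.incidences p v) / A =
      2 * (20 * ((X'.incidences p v : ℝ) - X.incidences p v) / A) := by ring
    have h6 : (40 : ℝ) * (Fintype.card ι * (3 * s : ℕ)) / A =
      2 * (20 * (Fintype.card ι * (3 * s : ℕ)) / A) := by ring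
    have h7 : (0 : ℝ) ≤ m := by positivity
    linarith
  · exact heavySum_split p v X S hS f hf (3 * s) hfd hnk2 α

end PolyCutting

namespace PolyCutting

variable {ι : Type} [Fintype ι] (p v : ι → Fin 3 → ℝ)

/-- A potential which does not increase much during the subdivision process. -/
noncomputable def potential (X : PolyCutting) : ℝ :=
  X.deg - X.incidences p v / (2 * Fintype.card ι)

lemma deg_le_potential [Nonempty ι] (X : PolyCutting) :
    (X.deg : ℝ) ≤ 2 * X.potential p v + 1 := by
  have hn : (0 : ℝ) < Fintype.card ι := by exact_mod_cast Fintype.card_pos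
  have h : (X.incidences p v : ℝ) ≤ Fintype.card ι * (X.deg + 1) := by
    exact_mod_cast X.incidences_le p v
  have h2 : (X.incidences p v : ℝ) / (2 * Fintype.card ι) ≤ (X.deg + 1) / 2 := by
    rw [div_le_div_iff₀ (by positivity) (by norm_num)]
    linarith
  simp only [potential]
  linarith

lemma exists_cube_eq {x : ℝ} (hx : 0 ≤ x) : ∃ a : ℝ, 0 ≤ a ∧ a ^ 3 = x :=
  ⟨x ^ ((3 : ℝ)⁻¹), by positivity, by
    rw [← Real.rpow_natCast, ← Real.rpow_mul hx]; norm_num⟩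

lemma potential_step {a b d z w : ℝ} (hw : 0 < w) (ha : 0 ≤ a)
    (hz : 0 ≤ z) (hd : d ≤ 54 * a) (haw : 1000 * w < a)
    (h : b ^ 3 ≤ a ^ 3 / 25 + 40 * (w ^ 2 * z) + 40 * (w ^ 2 * d)) :
    d + 108 * (b - a) - z / 2 ≤ 0 := by
  have ha0 : 0 < a := by linarith
  have hw2 : w ^ 2 ≤ a ^ 2 / 10 ^ 6 := by nlinarith
  have h1 : w ^ 2 * d ≤ 54 * a ^ 3 / 10 ^ 6 := by
    calc w ^ 2 * d ≤ w ^ 2 * (54 * a) := by gcongr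
      _ ≤ a ^ 2 / 10 ^ 6 * (54 * a) := by gcongr
      _ = _ := by ring
  by_cases hc : 40 * (w ^ 2 * z) ≤ a ^ 3 / 20
  · have h2 : b ^ 3 ≤ (a / 2) ^ 3 := by
      have : 0 < a ^ 3 := by positivity
      ring_nf at *
      linarith
    have h3 : b ≤ a / 2 := le_of_pow_le_pow_left₀ (by norm_num) (by positivity) h2
    linarith
  · push Not at hc
    have h2 : a ^ 3 ≤ 800 * (a ^ 2 / 10 ^ 6 * z) := by
      have : w ^ 2 * z ≤ a ^ 2 / 10 ^ 6 * z := by gcongr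
      linarith
    have h3 : 1250 * a ≤ z := by
      have : a ^ 2 * (1250 * a) ≤ a ^ 2 * z := by ring_nf at *; linarith
      exact le_of_mul_le_mul_left this (by positivity)
    by_cases hba : b ≤ a
    · linarith
    · push Not at hba
      have hb0 : 0 < b := by linarith
      have h4 : b ^ 3 ≤ 80 * (b ^ 2 / 10 ^ 6 * z) := by
        have h5 : w ^ 2 ≤ b ^ 2 / 10 ^ 6 := hw2.trans (by gcongr)
        have : w ^ 2 * z ≤ b ^ 2 / 10 ^ 6 * z := by gcongr
        have : 0 < a ^ 3 := by positivity
        ring_nf at *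
        linarith
      have h6 : 12500 * b ≤ z := by
        have : b ^ 2 * (12500 * b) ≤ b ^ 2 * z := by ring_nf at *; linarith
        exact le_of_mul_le_mul_left this (by positivity)
      linarith

lemma exists_few_heavy_aux [Nonempty ι] {w A : ℝ} (hw : 0 < w)
    (hA : A * w ^ 2 = Fintype.card ι) (α P : ℝ) (N : ℕ) :
    ∀ (X : PolyCutting) (a : ℝ), 0 ≤ a → a ^ 3 = (X.heavy p v A).card →
      X.potential p v + 108 * a ≤ P → 2 * P + 1 < X.deg + N →
      ∃ X' : PolyCutting, ((X'.heavy p v A).card : ℝ) ≤ 10 ^ 9 * w ^ 3 ∧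
        X'.potential p v ≤ P ∧
        X'.heavySum p v (4 * A / 3) α = X.heavySum p v (4 * A / 3) α := by
  have hn : (0 : ℝ) < Fintype.card ι := by exact_mod_cast Fintype.card_pos
  have hA0 : 0 < A := by
    by_contra h
    push Not at h
    nlinarith [sq_nonneg w]
  induction N with
  | zero =>
    intro X a ha _ hP hN
    have := X.deg_le_potential p v
    push_cast at hN
    linarith
  | succ N ih =>
    intro X a ha ha3 hP hN
    by_cases hm : ((X.heavy p v A).card : ℝ) ≤ 10 ^ 9 * w ^ 3
    · exact ⟨X, hm, by linarith, rfl⟩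
    push Not at hm
    have hm0 : (X.heavy p v A).Nonempty := by
      rw [← Finset.card_pos]
      have : (0 : ℝ) < (X.heavy p v A).card := lt_trans (by positivity) hm
      exact_mod_cast this
    obtain ⟨X', d, hd1, hdeg, hd3, hI, hheavy, hsum⟩ := X.exists_split p v hA0 hm0 α
    obtain ⟨b, hb, hb3⟩ := exists_cube_eq (x := (X'.heavy p v A).card) (by positivity)
    have hd : (d : ℝ) ≤ 54 * a := by
      refine le_of_pow_le_pow_left₀ (n := 3) (by norm_num) (by positivity) ?_
      rw [mul_pow, ha3]
      exact hd3
    have haw : 1000 * w < a := by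
      refine lt_of_pow_lt_pow_left₀ 3 ha ?_
      rw [ha3]
      refine lt_of_le_of_lt (le_of_eq ?_) hm
      ring
    have hI' : (X.incidences p v : ℝ) ≤ X'.incidences p v := by exact_mod_cast hI
    set z : ℝ := ((X'.incidences p v : ℝ) - X.incidences p v) / Fintype.card ι with hz
    have hAinv : (1 : ℝ) / A = w ^ 2 / Fintype.card ι := by
      rw [div_eq_div_iff hA0.ne' hn.ne', one_mul, mul_comm, hA]
    have hstep := potential_step (b := b) (z := z) hw ha
      (div_nonneg (by linarith) hn.le) hd haw (by
        rw [hb3, ha3]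
        refine hheavy.trans (le_of_eq ?_)
        have e1 : 40 * ((X'.incidences p v : ℝ) - X.incidences p v) / A =
            40 * (w ^ 2 * z) := by
          rw [div_eq_mul_one_div, hAinv, hz]; ring
        have e2 : 40 * (Fintype.card ι * (d : ℝ)) / A = 40 * (w ^ 2 * d) := by
          rw [div_eq_mul_one_div, hAinv]; field_simp
        rw [e1, e2])
    have hpot : X'.potential p v = X.potential p v + d - z / 2 := by
      simp only [potential, hdeg, hz]
      push_cast
      field_simp
      ring
    obtain ⟨X'', h1, h2, h3⟩ := ih X' b hb hb3 (by linarith) (by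
      rw [hdeg]
      push_cast at hN ⊢
      have : (1 : ℝ) ≤ d := by exact_mod_cast hd1
      linarith)
    exact ⟨X'', h1, h2, h3.trans hsum⟩

lemma exists_few_heavy [Nonempty ι] (X : PolyCutting) {w A a : ℝ} (hw : 0 < w)
    (hA : A * w ^ 2 = Fintype.card ι) (α : ℝ) (ha : 0 ≤ a)
    (ha3 : a ^ 3 = (X.heavy p v A).card) :
    ∃ X' : PolyCutting, ((X'.heavy p v A).card : ℝ) ≤ 10 ^ 9 * w ^ 3 ∧
        X'.potential p v ≤ X.potential p v + 108 * a ∧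
        X'.heavySum p v (4 * A / 3) α = X.heavySum p v (4 * A / 3) α := by
  obtain ⟨N, hN⟩ := exists_nat_gt (2 * (X.potential p v + 108 * a) + 1 - X.deg)
  exact exists_few_heavy_aux p v hw hA α _ N X a ha ha3 le_rfl (by linarith)

lemma card_heavy_le [Nonempty ι] (X : PolyCutting) {w A : ℝ} (hw : 0 < w)
    (hA : A * w ^ 2 = Fintype.card ι) :
    ((X.heavy p v A).card : ℝ) ≤ (X.deg + 1) * w ^ 2 := by
  have hn : (0 : ℝ) < Fintype.card ι := by exact_mod_cast Fintype.card_pos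
  have h : (X.incidences p v : ℝ) ≤ Fintype.card ι * (X.deg + 1) := by
    exact_mod_cast X.incidences_le p v
  have h1 : ((X.heavy p v A).card : ℝ) * A ≤ X.incidences p v := by
    have h2 : ((X.heavy p v A).card : ℝ) * A ≤ ∑ k ∈ X.heavy p v A, ((X.inc p v k).card : ℝ) := by
      rw [← nsmul_eq_mul]
      exact Finset.card_nsmul_le_sum _ _ _ fun k hk => ((mem_heavy p v).1 hk).2.1.le
    refine h2.trans ?_
    rw [incidences, Nat.cast_sum]
    exact Finset.sum_le_sum_of_subset_of_nonneg (Finset.subset_univ _) fun _ _ _ => by positivity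
  have h3 : ((X.heavy p v A).card : ℝ) * A * w ^ 2 ≤
      Fintype.card ι * (X.deg + 1) * w ^ 2 := by
    have := h1.trans h
    gcongr
  have h4 : (Fintype.card ι : ℝ) * (X.heavy p v A).card ≤
      Fintype.card ι * ((X.deg + 1) * w ^ 2) := by
    calc _ = ((X.heavy p v A).card : ℝ) * A * w ^ 2 := by rw [← hA]; ring
      _ ≤ _ := h3
      _ = _ := by ring
  exact le_of_mul_le_mul_left h4 hn

lemma heavySum_le (X : PolyCutting) {A α : ℝ} (hα : 0 ≤ α) (hA : 0 ≤ A) :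
    X.heavySum p v A α ≤ X.heavySum p v (4 * A / 3) α +
      (X.heavy p v A).card * (4 * A / 3) ^ α := by
  classical
  have : ((X.heavy p v A).card : ℝ) * (4 * A / 3) ^ α =
      ∑ k, if k ∈ X.heavy p v A then (4 * A / 3) ^ α else 0 := by
    simp
  rw [this, heavySum, heavySum, ← Finset.sum_add_distrib]
  refine Finset.sum_le_sum fun k _ => ?_
  have h0 : (0 : ℝ) ≤ ((X.inc p v k).card : ℝ) ^ α := by positivity
  have h0' : (0 : ℝ) ≤ (4 * A / 3) ^ α := by positivity
  by_cases h1 : X.alive k ∧ A < (X.inc p v k).card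
  · rw [if_pos h1]
    by_cases h2 : 4 * A / 3 < (X.inc p v k).card
    · rw [if_pos ⟨h1.1, h2⟩]
      split_ifs <;> linarith
    · push Not at h2
      rw [if_neg (by rintro ⟨-, h⟩; linarith), if_pos ((mem_heavy p v).2
        ⟨h1.1, h1.2, by linarith⟩), zero_add]
      gcongr
  · rw [if_neg h1]
    split_ifs <;> linarith

end PolyCutting

namespace PolyCutting

lemma potential_growth {u L U y y' c : ℝ} (hu : u ^ 2 = 4 / 3) (hu1 : 23 / 20 < u)
    (hL : 10 ^ 5 ≤ L) (hU : 1 ≤ U) (hy : y + 1 / 2 ≤ L * U)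
    (hc : c ^ 3 ≤ (2 * y + 2) * (U * u) ^ 2) (hy' : y' ≤ y + 108 * c) :
    y' + 1 / 2 ≤ L * (U * u) := by
  have h1 : c ^ 3 ≤ 4 * L * U ^ 3 := by
    refine hc.trans ?_
    have : 2 * y + 2 ≤ 3 * (L * U) := by nlinarith
    calc (2 * y + 2) * (U * u) ^ 2 ≤ 3 * (L * U) * (U * u) ^ 2 := by gcongr
      _ = 3 * L * U ^ 3 * u ^ 2 := by ring
      _ = _ := by rw [hu]; ring
  have hLU : 0 < L * U := by positivity
  have h2 : c ≤ L * U / 800 := by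
    refine le_of_pow_le_pow_left₀ (n := 3) (by norm_num) (by positivity) (h1.trans ?_)
    have hL2 : (10 : ℝ) ^ 10 ≤ L ^ 2 := by
      calc (10 : ℝ) ^ 10 = (10 ^ 5) ^ 2 := by norm_num
        _ ≤ L ^ 2 := by gcongr
    have : L * U ^ 3 * 10 ^ 10 ≤ L * U ^ 3 * L ^ 2 := by gcongr
    have h0 : 0 < L * U ^ 3 := by positivity
    have e : (L * U / 800) ^ 3 = L * U ^ 3 * L ^ 2 / 512000000 := by ring
    rw [e]
    linarith
  nlinarith

variable {ι : Type} [Fintype ι] (p v : ι → Fin 3 → ℝ)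

lemma exists_iterate [Nonempty ι] (X : PolyCutting) {u L α g : ℝ} (hu : u ^ 2 = 4 / 3)
    (hu1 : 23 / 20 < u) (hu2 : u ≤ 6 / 5) (hα : 0 ≤ α) (hg : g = (3 / 4) ^ α) (hL : 10 ^ 5 ≤ L)
    (k₁ : ℕ) (hX : X.potential p v + 1 / 2 ≤ L * u ^ k₁)
    (hinc : ∀ k, X.alive k → ((X.inc p v k).card : ℝ) ≤ Fintype.card ι * (3 / 4) ^ k₁) (j : ℕ) :
    ∃ X' : PolyCutting, X'.potential p v + 1 / 2 ≤ L * u ^ (k₁ + j) ∧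
      X'.heavySum p v (Fintype.card ι * (3 / 4) ^ (k₁ + j)) α ≤
        (Fintype.card ι : ℝ) ^ α *
          (2 * 10 ^ 9 * ∑ i ∈ Finset.range j, (u ^ 3 * g) ^ (k₁ + i)) := by
  classical
  have hn : (0 : ℝ) < Fintype.card ι := by exact_mod_cast Fintype.card_pos
  induction j with
  | zero =>
    refine ⟨X, hX, ?_⟩
    simp only [heavySum, Finset.range_zero, Finset.sum_empty, mul_zero, add_zero]
    refine le_of_eq (Finset.sum_eq_zero fun k _ => if_neg ?_)
    rintro ⟨h1, h2⟩
    exact absurd (hinc k h1) (not_le.2 h2)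
  | succ j ih =>
    obtain ⟨Y, hY, hsum⟩ := ih
    set k := k₁ + j with hk
    set n : ℝ := (Fintype.card ι : ℝ) with hndef
    have hU : 1 ≤ u ^ k := one_le_pow₀ (by linarith)
    set A : ℝ := n * (3 / 4) ^ (k + 1) with hAdef
    have hw : 0 < u ^ (k + 1) := pow_pos (by linarith) _
    have hA : A * (u ^ (k + 1)) ^ 2 = n := by
      rw [hAdef, ← pow_mul, mul_comm (k + 1) 2, pow_mul, hu, mul_assoc, ← mul_pow]
      norm_num
    have hA0 : 0 ≤ A := by positivity
    have hA43 : 4 * A / 3 = n * (3 / 4) ^ k := by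
      rw [hAdef, pow_succ]; ring
    obtain ⟨a, ha, ha3⟩ := exists_cube_eq (x := (Y.heavy p v A).card) (by positivity)
    obtain ⟨Y', h1, h2, h3⟩ := Y.exists_few_heavy p v hw hA α ha ha3
    refine ⟨Y', ?_, ?_⟩
    · rw [← add_assoc, ← hk, pow_succ]
      refine potential_growth hu hu1 hL hU hY ?_ h2
      rw [ha3, ← pow_succ]
      refine (Y.card_heavy_le p v hw hA).trans ?_
      have := Y.deg_le_potential p v
      refine mul_le_mul_of_nonneg_right ?_ (by positivity)
      linarith
    · rw [← add_assoc, ← hk]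
      refine (Y'.heavySum_le p v hα hA0).trans ?_
      rw [h3, hA43, Finset.sum_range_succ, mul_add, mul_add]
      refine add_le_add hsum ?_
      have e1 : (n * (3 / 4) ^ k) ^ α = n ^ α * g ^ k := by
        rw [Real.mul_rpow (by positivity) (by positivity), hg, ← Real.rpow_natCast,
          ← Real.rpow_mul (by norm_num), mul_comm (k : ℝ), Real.rpow_mul (by norm_num),
          Real.rpow_natCast]
      have hg0 : 0 < g := by rw [hg]; positivity
      rw [e1]
      have hu3 : u ^ 3 ≤ 2 := by nlinarith
      calc ((Y'.heavy p v A).card : ℝ) * (n ^ α * g ^ k)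
          ≤ 10 ^ 9 * (u ^ (k + 1)) ^ 3 * (n ^ α * g ^ k) := by gcongr
        _ = n ^ α * (u ^ 3 * 10 ^ 9 * (u ^ 3 * g) ^ k) := by ring
        _ ≤ _ := by
          have : 0 < u := by linarith
          gcongr

/-- The cells of an arrangement of zero sets. -/
noncomputable def ofFinset (L : Finset (MvPolynomial (Fin 3) ℝ)) (hL : ∀ f ∈ L, f ≠ 0) (d : ℕ)
    (hd : ∑ f ∈ L, f.totalDegree ≤ d) : PolyCutting where
  κ := L → SignType
  cell σ := {x | ∀ f : L, SignType.sign (MvPolynomial.eval x f.1) = σ f}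
  alive σ := ∀ f, σ f ≠ 0
  polys := L.toList
  deg := d
  polys_ne_zero f hf := hL f (Finset.mem_toList.1 hf)
  sum_totalDegree_le := by
    rwa [Finset.sum_map_toList]
  isOpen_cell := by
    intro σ hσ
    have : {x | ∀ f : L, SignType.sign (MvPolynomial.eval x f.1) = σ f} =
        ⋂ f : L, {x | SignType.sign (MvPolynomial.eval x f.1) = σ f} := by
      ext; simp
    rw [this]
    refine isOpen_iInter_of_finite fun f => ?_
    have hcont : Continuous fun x : Fin 3 → ℝ => MvPolynomial.eval x f.1 :=
      MvPolynomial.continuous_eval f.1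
    have h0 := hσ f
    rcases h : σ f with _ | _ | _
    · exact absurd h h0
    · have : {x | SignType.sign (MvPolynomial.eval x f.1) = SignType.neg} =
          {x | MvPolynomial.eval x f.1 < 0} := by
        ext x; exact sign_eq_neg_one_iff
      rw [this]
      exact isOpen_lt hcont continuous_const
    · have : {x | SignType.sign (MvPolynomial.eval x f.1) = SignType.pos} =
          {x | 0 < MvPolynomial.eval x f.1} := by
        ext x; exact sign_eq_one_iff
      rw [this]
      exact isOpen_lt continuous_const hcont
  separated := by
    intro σ σ' h x hx y hy
    obtain ⟨f, hf⟩ := Function.ne_iff.1 h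
    exact ⟨f.1, Finset.mem_toList.2 f.2, by rw [hx f, hy f]; exact hf⟩
  exists_cell := by
    intro x hx
    exact ⟨fun f => SignType.sign (MvPolynomial.eval x f.1),
      fun f => sign_ne_zero.2 (hx f.1 (Finset.mem_toList.2 f.2)), fun f => rfl⟩

lemma sum_alive_rpow_le [Nonempty ι] (X : PolyCutting) {A α : ℝ} (hα : 1 ≤ α) (hA : 0 ≤ A)
    [DecidablePred X.alive] :
    ∑ k, (if X.alive k then ((X.inc p v k).card : ℝ) ^ α else 0) ≤
      X.heavySum p v A α + Fintype.card ι * (X.deg + 1) * A ^ (α - 1) := by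
  classical
  have h : (X.incidences p v : ℝ) ≤ Fintype.card ι * (X.deg + 1) := by
    exact_mod_cast X.incidences_le p v
  have h2 : ∑ k, (if X.alive k then ((X.inc p v k).card : ℝ) ^ α else 0) ≤
      X.heavySum p v A α + X.incidences p v * A ^ (α - 1) := by
    rw [heavySum, incidences, Nat.cast_sum, Finset.sum_mul, ← Finset.sum_add_distrib]
    refine Finset.sum_le_sum fun k _ => ?_
    have h0 : (0 : ℝ) ≤ (X.inc p v k).card := by positivity
    have h1 : (0 : ℝ) ≤ (X.inc p v k).card * A ^ (α - 1) := by positivity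
    have h3 : (0 : ℝ) ≤ ((X.inc p v k).card : ℝ) ^ α := by positivity
    by_cases hal : X.alive k
    · by_cases hk : A < (X.inc p v k).card
      · rw [if_pos hal, if_pos ⟨hal, hk⟩]
        linarith
      · rw [if_pos hal, if_neg (fun h => hk h.2), zero_add]
        push Not at hk
        rcases h0.eq_or_lt with h4 | h4
        · rw [← h4, Real.zero_rpow (by linarith), zero_mul]
        · calc ((X.inc p v k).card : ℝ) ^ α
              = (X.inc p v k).card * ((X.inc p v k).card : ℝ) ^ (α - 1) := by
                rw [← Real.rpow_one_add' h0 (by linarith)]; congr 1; ring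
            _ ≤ _ := by
              gcongr
    · rw [if_neg hal, if_neg (fun h => hal h.1)]
      linarith
  refine h2.trans ?_
  gcongr

end PolyCutting

/-- A cell which a connected set avoiding a zero set cannot leave. -/
lemma PolyCutting.exists_subset_cell (X : PolyCutting) {σ : Set (Fin 3 → ℝ)} (hσ : σ.Nonempty)
    (hc : IsPreconnected σ) (h : ∀ x ∈ σ, MvPolynomial.eval x X.polys.prod ≠ 0) :
    ∃ k, X.alive k ∧ σ ⊆ X.cell k := by
  have hne : ∀ x ∈ σ, ∀ f ∈ X.polys, MvPolynomial.eval x f ≠ 0 := by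
    intro x hx f hf h0
    obtain ⟨g, hg⟩ := List.dvd_prod hf
    apply h x hx
    rw [hg, map_mul, h0, zero_mul]
  obtain ⟨x, hx⟩ := hσ
  obtain ⟨k, hk, hxk⟩ := X.exists_cell x (hne x hx)
  refine ⟨k, hk, fun y hy => ?_⟩
  obtain ⟨l, hl, hyl⟩ := X.exists_cell y (hne y hy)
  by_contra hyk
  have hkl : k ≠ l := by rintro rfl; exact hyk hyl
  obtain ⟨f, hf, hsign⟩ := X.separated k l hkl x hxk y hyl
  have hcont : ContinuousOn (fun z : Fin 3 → ℝ => SignType.sign (MvPolynomial.eval z f)) σ := by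
    intro z hz
    exact (ContinuousAt.comp (g := SignType.sign) (f := fun z => MvPolynomial.eval z f)
      (continuousAt_sign_of_ne_zero (hne z hz f hf))
      (MvPolynomial.continuous_eval f).continuousAt).continuousWithinAt
  exact hsign (hc.constant hcont hx hy)

lemma geom_tail_le {ρ κ : ℝ} (hρ0 : 0 < ρ) (hρ1 : ρ < 1) {k : ℕ}
    (hk : ρ ^ k ≤ κ * (1 - ρ) / (4 * 10 ^ 9)) (j : ℕ) :
    2 * 10 ^ 9 * ∑ i ∈ Finset.range j, ρ ^ (k + i) ≤ κ / 2 := by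
  have e0 : ∑ i ∈ Finset.range j, ρ ^ (k + i) = ρ ^ k * ∑ i ∈ Finset.range j, ρ ^ i := by
    rw [Finset.mul_sum]
    exact Finset.sum_congr rfl fun i _ => pow_add _ _ _
  have e := mul_neg_geom_sum ρ j
  have hρj : 0 < ρ ^ j := by positivity
  have h1ρ : 0 < 1 - ρ := by linarith
  set s := ∑ i ∈ Finset.range j, ρ ^ i with hs
  have h4 : (1 - ρ) * s ≤ 1 := by linarith
  have h5 : 0 ≤ s := Finset.sum_nonneg fun i _ => by positivity
  have hκ : 0 ≤ κ := by
    by_contra h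
    push Not at h
    have : 0 < ρ ^ k := by positivity
    have : κ * (1 - ρ) / (4 * 10 ^ 9) < 0 := div_neg_of_neg_of_pos (by nlinarith) (by norm_num)
    linarith
  rw [e0]
  calc 2 * 10 ^ 9 * (ρ ^ k * s)
      ≤ 2 * 10 ^ 9 * (κ * (1 - ρ) / (4 * 10 ^ 9) * s) := by gcongr
    _ = κ / 2 * ((1 - ρ) * s) := by ring
    _ ≤ κ / 2 * 1 := by gcongr
    _ = κ / 2 := mul_one _

lemma light_cells_le {u g α n L m κ : ℝ} {K : ℕ} (hu : u ^ 2 = 4 / 3) (hu1 : 23 / 20 < u)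
    (hn : 0 < n) (hg : g = (3 / 4) ^ α) (hL : 10 ^ 5 ≤ L) (hm : m ≤ 3 * L * u ^ K)
    (hρ : (u ^ 3 * g) ^ K ≤ κ / (6 * L)) :
    n * m * (n * (3 / 4) ^ K) ^ (α - 1) ≤ n ^ α * (κ / 2) := by
  have hu0 : 0 < u := by linarith
  have hg0 : 0 < g := by rw [hg]; positivity
  have hL0 : 0 < L := by linarith
  have hnα : 0 < n ^ α := by positivity
  have e1 : (n * (3 / 4) ^ K) ^ α = n ^ α * g ^ K := by
    rw [Real.mul_rpow (by positivity) (by positivity), hg, ← Real.rpow_natCast,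
      ← Real.rpow_mul (by norm_num), mul_comm (K : ℝ), Real.rpow_mul (by norm_num),
      Real.rpow_natCast]
  have e2 : n * (n * (3 / 4) ^ K) ^ (α - 1) = n ^ α * (g * u ^ 2) ^ K := by
    have h0 : (0 : ℝ) < (3 / 4) ^ K := by positivity
    have h1 : ((4 : ℝ) / 3) ^ K = ((3 / 4) ^ K)⁻¹ := by rw [← inv_pow]; norm_num
    rw [Real.rpow_sub_one (by positivity), e1, hu, mul_pow, h1]
    field_simp
  calc n * m * (n * (3 / 4) ^ K) ^ (α - 1) = m * (n * (n * (3 / 4) ^ K) ^ (α - 1)) := by ring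
    _ ≤ (3 * L * u ^ K) * (n ^ α * (g * u ^ 2) ^ K) := by
      rw [e2]
      exact mul_le_mul_of_nonneg_right hm (by positivity)
    _ = n ^ α * (3 * L * (u ^ 3 * g) ^ K) := by ring
    _ ≤ n ^ α * (3 * L * (κ / (6 * L))) := by gcongr
    _ = _ := by
      congr 1
      field_simp
      ring

/-- **Polynomial partitioning** for non-vertical lines in space, with an exponent slightly larger
than `3 / 2`. -/
theorem exists_polynomial_partition {α κ : ℝ} (hα : 3 / 2 < α) (hκ : 0 < κ) :
    ∃ D : ℕ, ∀ (ι : Type) [Fintype ι] (p v : ι → Fin 3 → ℝ), (∀ i, v i 0 ≠ 0 ∨ v i 1 ≠ 0) →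
      ∃ (F : MvPolynomial (Fin 3) ℝ) (J : Type) (_ : Fintype J) (O : J → Set (Fin 3 → ℝ)),
        F ≠ 0 ∧ F.totalDegree ≤ D ∧ (∀ i j, i ≠ j → Disjoint (O i) (O j)) ∧
        (∀ σ : Set (Fin 3 → ℝ), σ.Nonempty → IsPreconnected σ →
          (∀ x ∈ σ, MvPolynomial.eval x F ≠ 0) → ∃ j, σ ⊆ O j) ∧
        ∑ j, (Nat.card {i | ∃ t : ℝ, p i + t • v i ∈ O j} : ℝ) ^ α ≤
          κ * (Fintype.card ι : ℝ) ^ α := by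
  classical
  set u : ℝ := √(4 / 3) with hudef
  have hu : u ^ 2 = 4 / 3 := Real.sq_sqrt (by norm_num)
  have hu0 : 0 ≤ u := Real.sqrt_nonneg _
  have hu1 : 23 / 20 < u := by nlinarith
  have hu2 : u ≤ 6 / 5 := by nlinarith
  set g : ℝ := (3 / 4) ^ α with hg
  have hg0 : 0 < g := by positivity
  set ρ : ℝ := u ^ 3 * g with hρ
  have hρ0 : 0 < ρ := by positivity
  have hρ1 : ρ < 1 := by
    have h1 : g < (3 / 4) ^ (3 / 2 : ℝ) :=
      Real.rpow_lt_rpow_of_exponent_gt (by norm_num) (by norm_num) hα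
    have h2 : ((3 / 4 : ℝ) ^ (3 / 2 : ℝ)) ^ 2 = 27 / 64 := by
      rw [← Real.rpow_natCast, ← Real.rpow_mul (by norm_num)]
      norm_num
    have h3 : ρ ^ 2 < 1 := by
      have h4 : g ^ 2 < 27 / 64 := by
        rw [← h2]
        gcongr
      have h5 : ρ ^ 2 = (u ^ 2) ^ 3 * g ^ 2 := by rw [hρ]; ring
      rw [h5, hu]
      linarith
    nlinarith
  have hpos₁ : 0 < κ * (1 - ρ) / (4 * 10 ^ 9) := by
    have : 0 < 1 - ρ := by linarith
    positivity
  obtain ⟨k₁, hk₁⟩ := exists_pow_lt_of_lt_one hpos₁ hρ1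
  obtain ⟨r, hr⟩ := exists_nat_gt (4 * (4 / 3 : ℝ) ^ k₁)
  have hr0 : 0 < r := by
    have : (0 : ℝ) < r := lt_trans (by positivity) hr
    exact_mod_cast this
  obtain ⟨D₀, hD₀⟩ := exists_planar_sign_partition r hr0
  set L : ℝ := 10 ^ 5 + D₀ with hLdef
  have hL : 10 ^ 5 ≤ L := by
    have : (0 : ℝ) ≤ D₀ := by positivity
    linarith
  obtain ⟨j, hj⟩ := exists_pow_lt_of_lt_one (show 0 < κ / (6 * L) by positivity) hρ1
  obtain ⟨D, hD⟩ := exists_nat_gt (2 * (L * u ^ (k₁ + j)))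
  refine ⟨D, fun ι _ p v hv => ?_⟩
  rcases isEmpty_or_nonempty ι with hι | hι
  · refine ⟨1, PUnit, inferInstance, fun _ => Set.univ, one_ne_zero, by simp,
      fun i j h => absurd rfl h, fun σ _ _ _ => ⟨PUnit.unit, Set.subset_univ _⟩, ?_⟩
    simp [Real.zero_rpow (by linarith : α ≠ 0)]
  have hn : (0 : ℝ) < Fintype.card ι := by exact_mod_cast Fintype.card_pos
  obtain ⟨S, hScard, hS, hW⟩ := hD₀ ι p v hv
  set X := PolyCutting.ofFinset S (fun f hf => (hS f hf).1) D₀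
    ((Finset.sum_le_card_nsmul _ _ _ fun f hf => (hS f hf).2).trans (by simpa using hScard)) with hX
  have hXinc : ∀ k, X.alive k →
      ((X.inc p v k).card : ℝ) ≤ Fintype.card ι * (3 / 4) ^ k₁ := by
    intro k hk
    have h1 := hW (fun f => if h : f ∈ S then k ⟨f, h⟩ else 0) (fun f hf => by
      rw [dif_pos hf]; exact hk ⟨f, hf⟩) (X.inc p v k) (fun i hi => by
        obtain ⟨t, ht⟩ := ((PolyCutting.mem_inc p v).1 hi).nonempty
        refine ⟨t, fun f hf => ?_⟩
        rw [dif_pos hf]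
        exact ht ⟨f, hf⟩)
    refine h1.trans ?_
    rw [mul_comm, mul_div_assoc]
    gcongr
    rw [div_le_iff₀ (by positivity)]
    have h2 : ((3 : ℝ) / 4) ^ k₁ * (4 / 3) ^ k₁ = 1 := by rw [← mul_pow]; norm_num
    have h3 : (0 : ℝ) < (3 / 4) ^ k₁ := by positivity
    nlinarith
  have hXpot : X.potential p v + 1 / 2 ≤ L * u ^ k₁ := by
    have h1 : X.potential p v ≤ D₀ := by
      simp only [PolyCutting.potential]
      have : (0 : ℝ) ≤ X.incidences p v / (2 * Fintype.card ι) := by positivity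
      have h2 : X.deg = D₀ := rfl
      rw [h2]
      linarith
    have h2 : 1 ≤ u ^ k₁ := one_le_pow₀ (by linarith)
    nlinarith
  obtain ⟨Y, hY, hsum⟩ := X.exists_iterate p v hu hu1 hu2 (by linarith) hg hL k₁ hXpot hXinc j
  set K := k₁ + j with hK
  have hdeg : (Y.deg : ℝ) + 1 ≤ 2 * (L * u ^ K) + 1 := by
    have := Y.deg_le_potential p v
    linarith
  have hUK : 1 ≤ u ^ K := one_le_pow₀ (by linarith)
  set F := Y.polys.prod with hF
  have hF0 : F ≠ 0 := List.prod_ne_zero fun h => Y.polys_ne_zero 0 h rfl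
  have hFdeg : F.totalDegree ≤ Y.deg :=
    (MvPolynomial.totalDegree_list_prod _).trans Y.sum_totalDegree_le
  refine ⟨F, {k // Y.alive k}, inferInstance,
    fun k => Y.cell k ∩ {x | MvPolynomial.eval x F ≠ 0}, hF0, ?_, ?_, ?_, ?_⟩
  · have : (F.totalDegree : ℝ) ≤ D := by
      have : (F.totalDegree : ℝ) ≤ Y.deg := by exact_mod_cast hFdeg
      linarith
    exact_mod_cast this
  · intro a b hab
    exact (Y.disjoint_cell fun h => hab (Subtype.ext h)).mono Set.inter_subset_left
      Set.inter_subset_left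
  · intro σ hσ hc h
    obtain ⟨k, hk, hsub⟩ := Y.exists_subset_cell hσ hc h
    exact ⟨⟨k, hk⟩, fun x hx => ⟨hsub hx, h x hx⟩⟩
  · have h1 : ∀ k : {k // Y.alive k},
        (Nat.card {i | ∃ t : ℝ, p i + t • v i ∈ Y.cell k ∩ {x | MvPolynomial.eval x F ≠ 0}} : ℝ)
          ^ α ≤ ((Y.inc p v k).card : ℝ) ^ α := by
      intro k
      refine Real.rpow_le_rpow (by positivity) ?_ (by linarith)
      rw [← Nat.card_eq_finsetCard]
      refine Nat.cast_le.2 (Nat.card_mono (Finset.finite_toSet _) ?_)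
      rintro i ⟨t, ht⟩
      exact (PolyCutting.mem_inc p v).2
        (PolyCutting.infinite_of_mem_of_isOpen (Y.isOpen_cell k k.2) ht.1)
    refine (Finset.sum_le_sum fun k _ => h1 k).trans ?_
    have h2 : ∑ k : {k // Y.alive k}, ((Y.inc p v k).card : ℝ) ^ α =
        ∑ k, if Y.alive k then ((Y.inc p v k).card : ℝ) ^ α else 0 := by
      rw [← Finset.sum_filter]
      exact (Finset.sum_subtype (p := Y.alive) (Finset.univ.filter Y.alive)
        (fun k => by rw [Finset.mem_filter]; exact and_iff_right (Finset.mem_univ k))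
        fun k => ((Y.inc p v k).card : ℝ) ^ α).symm
    rw [h2]
    set n : ℝ := (Fintype.card ι : ℝ) with hndef
    set A : ℝ := n * (3 / 4) ^ K with hA
    have hA0 : 0 < A := by positivity
    refine (Y.sum_alive_rpow_le p v (by linarith) hA0.le).trans ?_
    have hnα : 0 < n ^ α := by positivity
    have hfirst := mul_le_mul_of_nonneg_left (geom_tail_le hρ0 hρ1 hk₁.le j) hnα.le
    have hsecond := light_cells_le (m := Y.deg + 1) hu hu1 hn hg hL
      (show (Y.deg : ℝ) + 1 ≤ 3 * L * u ^ K by nlinarith) (κ := κ) (by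
        rw [← hρ, hK, pow_add]
        calc ρ ^ k₁ * ρ ^ j ≤ 1 * (κ / (6 * L)) := by
              gcongr
              exact pow_le_one₀ hρ0.le hρ1.le
          _ = _ := one_mul _)
    linarith

open Polynomial in
/-- The distinct complex roots of a real polynomial. -/
noncomputable def complexRoots (P : ℝ[X]) : Finset ℂ := (P.map Complex.ofRealHom).roots.toFinset

open Polynomial in
lemma mem_complexRoots {P : ℝ[X]} (hP : P ≠ 0) {z : ℂ} :
    z ∈ complexRoots P ↔ (P.map Complex.ofRealHom).eval z = 0 := by
  have : P.map Complex.ofRealHom ≠ 0 := (Polynomial.map_ne_zero_iff Complex.ofReal_injective).2 hP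
  simp [complexRoots, this]

open Polynomial in
lemma ofReal_mem_complexRoots {P : ℝ[X]} (hP : P ≠ 0) {t : ℝ} :
    (t : ℂ) ∈ complexRoots P ↔ P.eval t = 0 := by
  rw [mem_complexRoots hP]
  have : (P.map Complex.ofRealHom).eval (t : ℂ) = ((P.eval t : ℝ) : ℂ) := by
    simpa using Polynomial.eval_map_apply (f := Complex.ofRealHom) (p := P) t
  rw [this, Complex.ofReal_eq_zero]

open Polynomial in
lemma conj_mem_complexRoots {P : ℝ[X]} (hP : P ≠ 0) {z : ℂ} (hz : z ∈ complexRoots P) :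
    (starRingEnd ℂ) z ∈ complexRoots P := by
  rw [mem_complexRoots hP] at hz ⊢
  rw [Polynomial.eval_map] at hz ⊢
  have := congrArg (starRingEnd ℂ) hz
  rw [Polynomial.hom_eval₂, map_zero] at this
  convert this using 2
  ext x
  simp

open Polynomial in
/-- If a polynomial is small at a point then it has a root nearby. -/
lemma exists_root_dist_lt {P : ℝ[X]} (hP : P ≠ 0) {z : ℂ} {ε : ℝ} (hε : 0 < ε)
    (h : ‖(P.map Complex.ofRealHom).eval z‖ < |P.leadingCoeff| * ε ^ P.natDegree) :
    ∃ w ∈ complexRoots P, dist w z < ε := by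
  by_contra! hc
  set Q := P.map Complex.ofRealHom with hQ
  have hQ0 : Q ≠ 0 := (Polynomial.map_ne_zero_iff Complex.ofReal_injective).2 hP
  have hsplit : Q.Splits := IsAlgClosed.splits Q
  have hcard : Q.roots.card = P.natDegree := by
    rw [← hsplit.natDegree_eq_card_roots, hQ, Polynomial.natDegree_map]
  have heval : Q.eval z = Q.leadingCoeff * (Q.roots.map fun a => z - a).prod := by
    exact hsplit.eval_eq_prod_roots z
  have hlead : ‖Q.leadingCoeff‖ = |P.leadingCoeff| := by
    rw [hQ, Polynomial.leadingCoeff_map]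
    simp
  have hprod : ε ^ P.natDegree ≤ ‖(Q.roots.map fun a => z - a).prod‖ := by
    rw [← hcard, ← normHom_apply, map_multiset_prod, Multiset.map_map]
    have : ε ^ Q.roots.card = (Q.roots.map fun _ => ε).prod := by simp
    rw [this]
    refine Multiset.prod_map_le_prod_map₀ _ _ (fun a _ => hε.le) fun a ha => ?_
    have := hc a (by simpa [complexRoots, ← hQ] using ha)
    rw [dist_comm, dist_eq_norm] at this
    exact this
  rw [heval, norm_mul, hlead] at h
  exact absurd h (not_lt.2 (by gcongr))

/-- A positive separation for a finite set. -/
lemma Finset.exists_pos_separation {E : Type*} [MetricSpace E] (Z : Finset E) :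
    ∃ ε > 0, ∀ z ∈ Z, ∀ w ∈ Z, dist z w < 2 * ε → z = w := by
  classical
  have : ∀ x ∈ Z ×ˢ Z, ∃ ε > 0, dist x.1 x.2 < 2 * ε → x.1 = x.2 := by
    rintro ⟨z, w⟩ -
    by_cases h : z = w
    · exact ⟨1, one_pos, fun _ => h⟩
    · refine ⟨dist z w / 2, half_pos (dist_pos.2 h), fun h' => ?_⟩
      simp only at h'
      linarith
  choose! e he he' using this
  obtain ⟨ε, hε, hle⟩ : ∃ ε > 0, ∀ x ∈ Z ×ˢ Z, ε ≤ e x := by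
    rcases (Z ×ˢ Z).eq_empty_or_nonempty with h | h
    · exact ⟨1, one_pos, by simp [h]⟩
    · obtain ⟨x, hx, hmin⟩ := Finset.exists_min_image (Z ×ˢ Z) e h
      exact ⟨e x, he x hx, hmin⟩
  refine ⟨ε, hε, fun z hz w hw h => ?_⟩
  have hm : (z, w) ∈ Z ×ˢ Z := Finset.mk_mem_product hz hw
  exact he' _ hm (lt_of_lt_of_le h (by linarith [hle _ hm]))

open Polynomial in
/-- Matching of nearby real roots when the numbers of distinct complex roots agree. -/
lemma exists_realRoots_matching {P Q : ℝ[X]} (hP : P ≠ 0) (hQ : Q ≠ 0)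
    (hcard : (complexRoots Q).card = (complexRoots P).card) {ε : ℝ}
    (hsep : ∀ z ∈ complexRoots P, ∀ w ∈ complexRoots P, dist z w < 2 * ε → z = w)
    (hnear : ∀ z ∈ complexRoots P, ∃ w ∈ complexRoots Q, dist w z < ε) :
    ∃ f : ℝ → ℝ, (∀ t, P.eval t = 0 → Q.eval (f t) = 0 ∧ |f t - t| < ε) ∧
      ∀ t, Q.eval t = 0 → ∃ x, P.eval x = 0 ∧ f x = t := by
  classical
  choose! φ hφ hφd using hnear
  have hinj : Set.InjOn φ (complexRoots P) := by
    intro z hz w hw h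
    refine hsep z hz w hw ?_
    have h1 := hφd z hz
    have h2 := hφd w hw
    rw [h] at h1
    calc dist z w ≤ dist z (φ w) + dist (φ w) w := dist_triangle _ _ _
      _ < 2 * ε := by rw [dist_comm z]; linarith
  have hsurj : ∀ w ∈ complexRoots Q, ∃ z ∈ complexRoots P, φ z = w := by
    have := Finset.surj_on_of_inj_on_of_card_le (s := complexRoots P) (t := complexRoots Q)
      (fun z _ => φ z) (fun z hz => hφ z hz) (fun z w hz hw h => hinj hz hw h) hcard.le
    intro w hw
    obtain ⟨z, hz, h⟩ := this w hw
    exact ⟨z, hz, h.symm⟩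
  have huniq : ∀ z ∈ complexRoots P, ∀ w ∈ complexRoots Q, dist w z < ε → w = φ z := by
    intro z hz w hw h
    obtain ⟨z', hz', rfl⟩ := hsurj w hw
    rw [hsep z' hz' z hz]
    calc dist z' z ≤ dist z' (φ z') + dist (φ z') z := dist_triangle _ _ _
      _ < 2 * ε := by rw [dist_comm z']; linarith [hφd z' hz']
  have hreal : ∀ t : ℝ, P.eval t = 0 → φ t = ((φ t).re : ℂ) := by
    intro t ht
    have ht' := (ofReal_mem_complexRoots hP).2 ht
    have := huniq t ht' _ (conj_mem_complexRoots hQ (hφ t ht')) (by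
      have : dist ((starRingEnd ℂ) (φ t)) ((starRingEnd ℂ) (t : ℂ)) = dist (φ t) (t : ℂ) :=
        Complex.dist_conj_conj _ _
      rw [Complex.conj_ofReal] at this
      rw [this]
      exact hφd t ht')
    exact (Complex.conj_eq_iff_re.1 this).symm
  refine ⟨fun t => (φ t).re, fun t ht => ?_, fun t ht => ?_⟩
  · have ht' := (ofReal_mem_complexRoots hP).2 ht
    refine ⟨(ofReal_mem_complexRoots hQ).1 ?_, ?_⟩
    · rw [← hreal t ht]
      exact hφ t ht'
    · have h1 := hφd t ht'
      rw [hreal t ht, Complex.dist_eq, ← Complex.ofReal_sub, Complex.norm_real] at h1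
      exact h1
  · obtain ⟨z, hz, hzt⟩ := hsurj t ((ofReal_mem_complexRoots hQ).2 ht)
    have h1 := hφd z hz
    rw [hzt] at h1
    have h2 : (starRingEnd ℂ) z = z := by
      refine hsep _ (conj_mem_complexRoots hP hz) _ hz ?_
      have h3 : dist ((starRingEnd ℂ) z) ((starRingEnd ℂ) (t : ℂ)) = dist z (t : ℂ) :=
        Complex.dist_conj_conj _ _
      rw [Complex.conj_ofReal] at h3
      have h4 := dist_triangle ((starRingEnd ℂ) z) t z
      rw [h3, dist_comm z] at h4
      linarith
    have h5 : (z.re : ℂ) = z := Complex.conj_eq_iff_re.1 h2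
    refine ⟨z.re, (ofReal_mem_complexRoots hP).1 (by rwa [h5]), ?_⟩
    change (φ (z.re : ℂ)).re = t
    rw [h5, hzt, Complex.ofReal_re]

open Polynomial in
/-- The real roots of a continuous family of polynomials with constant degree and constant number
of distinct complex roots are continuous. -/
theorem exists_continuous_roots {C : Type*} [TopologicalSpace C] [PreconnectedSpace C]
    (P : C → ℝ[X]) (hcont : ∀ k, Continuous fun c => (P c).coeff k) (h0 : ∀ c, P c ≠ 0)
    (hd : ∀ c c', (P c).natDegree = (P c').natDegree)
    (hr : ∀ c c', (complexRoots (P c)).card = (complexRoots (P c')).card) :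
    ∃ (s : ℕ) (ξ : Fin s → C → ℝ), (∀ i, Continuous (ξ i)) ∧ (∀ c, StrictMono fun i => ξ i c) ∧
      ∀ c t, (P c).eval t = 0 ↔ ∃ i, ξ i c = t := by
  classical
  rcases isEmpty_or_nonempty C with hC | ⟨⟨c₁⟩⟩
  · exact ⟨0, fun _ _ => 0, fun i => i.elim0, fun c => isEmptyElim c, fun c => isEmptyElim c⟩
  set R : C → Finset ℝ := fun c => (P c).roots.toFinset with hR
  have hmemR : ∀ c t, t ∈ R c ↔ (P c).eval t = 0 := by
    intro c t
    simp [hR, h0 c]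
  have hevalcont : ∀ z : ℂ, Continuous fun c => ((P c).map Complex.ofRealHom).eval z := by
    intro z
    have : ∀ c, ((P c).map Complex.ofRealHom).eval z =
        ∑ k ∈ Finset.range ((P c₁).natDegree + 1), ((P c).coeff k : ℂ) * z ^ k := by
      intro c
      rw [Polynomial.eval_eq_sum_range' (n := (P c₁).natDegree + 1)
        (by rw [Polynomial.natDegree_map, hd c c₁]; omega)]
      simp
    simp only [this]
    exact continuous_finsetSum _ fun k _ =>
      (Complex.continuous_ofReal.comp (hcont k)).mul continuous_const
  have hlocal : ∀ c₀, ∀ ε > 0, ∀ᶠ c in nhds c₀, ∃ f : ℝ → ℝ, StrictMonoOn f (R c₀) ∧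
      (R c₀).image f = R c ∧ ∀ t ∈ R c₀, |f t - t| < ε := by
    intro c₀ ε hε
    obtain ⟨e, he, hsep⟩ := (complexRoots (P c₀)).exists_pos_separation
    set η := min ε e with hη
    have hη0 : 0 < η := lt_min hε he
    have hnear : ∀ᶠ c in nhds c₀, ∀ z ∈ complexRoots (P c₀),
        ‖((P c).map Complex.ofRealHom).eval z‖ <
          |(P c).leadingCoeff| * η ^ (P c).natDegree := by
      rw [Filter.eventually_all_finset]
      intro z hz
      have h1 : ∀ c, |(P c).leadingCoeff| * η ^ (P c).natDegree =
          |(P c).coeff (P c₀).natDegree| * η ^ (P c₀).natDegree := by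
        intro c
        rw [Polynomial.leadingCoeff, hd c c₀]
      simp only [h1]
      refine ((hevalcont z).norm.continuousAt).eventually_lt
        (((hcont _).abs.mul continuous_const).continuousAt) ?_
      rw [(mem_complexRoots (h0 c₀)).1 hz, norm_zero]
      have : (P c₀).coeff (P c₀).natDegree ≠ 0 := by
        simpa using h0 c₀
      positivity
    filter_upwards [hnear] with c hc
    obtain ⟨f, hf1, hf2⟩ := exists_realRoots_matching (h0 c₀) (h0 c) (hr c c₀) (ε := η)
      (fun z hz w hw h => hsep z hz w hw (h.trans_le (by linarith [min_le_right ε e])))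
      (fun z hz => exists_root_dist_lt (h0 c) hη0 (hc z hz))
    refine ⟨f, ?_, ?_, fun t ht => ((hf1 t ((hmemR _ _).1 ht)).2).trans_le (min_le_left _ _)⟩
    · intro x hx y hy hxy
      have hx := (hmemR _ _).1 hx
      have hy := (hmemR _ _).1 hy
      have h1 := abs_lt.1 (hf1 x hx).2
      have h2 := abs_lt.1 (hf1 y hy).2
      have h3 : ¬ dist (x : ℂ) y < 2 * e := fun h => hxy.ne (Complex.ofReal_injective
        (hsep x ((ofReal_mem_complexRoots (h0 _)).2 hx) y
          ((ofReal_mem_complexRoots (h0 _)).2 hy) h))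
      rw [Complex.dist_eq, ← Complex.ofReal_sub, Complex.norm_real, Real.norm_eq_abs,
        abs_sub_comm, abs_of_pos (by linarith)] at h3
      linarith [min_le_right ε e]
    · ext t
      rw [Finset.mem_image, hmemR]
      constructor
      · rintro ⟨x, hx, rfl⟩
        exact (hf1 x ((hmemR _ _).1 hx)).1
      · intro ht
        obtain ⟨x, hx, hxt⟩ := hf2 t ht
        exact ⟨x, (hmemR _ _).2 hx, hxt⟩
  have hcard : ∀ c, (R c).card = (R c₁).card := by
    have : IsLocallyConstant fun c => (R c).card := by
      rw [IsLocallyConstant.iff_eventually_eq]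
      intro c₀
      filter_upwards [hlocal c₀ 1 one_pos] with c hc
      obtain ⟨f, hf, hi, -⟩ := hc
      rw [← hi, Finset.card_image_of_injOn hf.injOn]
    exact fun c => this.apply_eq_of_preconnectedSpace c c₁
  refine ⟨(R c₁).card, fun i c => (R c).orderEmbOfFin (hcard c) i, fun i => ?_, fun c =>
    ((R c).orderEmbOfFin (hcard c)).strictMono, fun c t => ?_⟩
  · rw [continuous_iff_continuousAt]
    intro c₀
    rw [Metric.continuousAt_iff']
    intro ε hε
    filter_upwards [hlocal c₀ ε hε] with c hc
    obtain ⟨f, hf, hi, hε⟩ := hc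
    have hmem : ∀ j, (R c₀).orderEmbOfFin (hcard c₀) j ∈ R c₀ :=
      fun j => Finset.orderEmbOfFin_mem _ _ _
    have huniq := Finset.orderEmbOfFin_unique (s := R c) (hcard c)
      (f := fun j => f ((R c₀).orderEmbOfFin (hcard c₀) j))
      (fun j => by rw [← hi]; exact Finset.mem_image_of_mem _ (hmem j))
      (fun a b hab => hf (hmem a) (hmem b) (((R c₀).orderEmbOfFin (hcard c₀)).strictMono hab))
    rw [← huniq, Real.dist_eq]
    exact hε _ (hmem i)
  · rw [← hmemR, ← Finset.mem_coe, ← Finset.range_orderEmbOfFin (R c) (hcard c)]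
    rfl

open Polynomial in
lemma natDegree_radical_eq_card_complexRoots {Q : ℝ[X]} (hQ : Q ≠ 0) :
    (UniqueFactorizationMonoid.radical Q).natDegree = (complexRoots Q).card := by
  classical
  set A := UniqueFactorizationMonoid.radical Q with hA
  have hA0 : A ≠ 0 := UniqueFactorizationMonoid.radical_ne_zero
  have hsep : A.Separable :=
    PerfectField.separable_iff_squarefree.2 UniqueFactorizationMonoid.squarefree_radical
  have hnd : (A.map Complex.ofRealHom).roots.Nodup := nodup_roots (hsep.map)
  have h1 : A.natDegree = (A.map Complex.ofRealHom).roots.card := by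
    rw [← (IsAlgClosed.splits _).natDegree_eq_card_roots, natDegree_map]
  have h2 : complexRoots A = complexRoots Q := by
    ext z
    rw [mem_complexRoots hA0, mem_complexRoots hQ]
    constructor
    · intro h
      obtain ⟨c, hc⟩ : A ∣ Q := UniqueFactorizationMonoid.radical_dvd_self
      rw [hc, Polynomial.map_mul, eval_mul, h, zero_mul]
    · intro h
      obtain ⟨n, c, hc⟩ := UniqueFactorizationMonoid.exists_dvd_radical_self_pow hQ
      have := congrArg (fun P : ℝ[X] => (P.map Complex.ofRealHom).eval z) hc
      simp only [Polynomial.map_mul, eval_mul, h, zero_mul, Polynomial.map_pow, eval_pow] at this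
      exact eq_zero_of_pow_eq_zero this
  rw [h1, ← h2, complexRoots, Multiset.toFinset_card_of_nodup hnd]

open Polynomial in
/-- A polynomial has at most `s` distinct complex roots if and only if it and its derivative
satisfy a nontrivial linear relation with coefficients of degree `< s` and `≤ s`. -/
lemma exists_relation_iff_card_complexRoots_le {Q : ℝ[X]} (hQ : Q ≠ 0) (s : ℕ) :
    (∃ u v : ℝ[X], (u ≠ 0 ∨ v ≠ 0) ∧ u.degree < s ∧ v.degree < (s + 1 : ℕ) ∧
      u * Q + v * derivative Q = 0) ↔ (complexRoots Q).card ≤ s := by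
  classical
  constructor
  · rintro ⟨u, v, huv, -, hv, h⟩
    have hv0 : v ≠ 0 := by
      rintro rfl
      simp only [zero_mul, add_zero, mul_eq_zero, hQ, or_false] at h
      simp [h] at huv
    have hsub : complexRoots Q ⊆ complexRoots v := by
      intro z hz
      rw [mem_complexRoots hQ] at hz
      rw [mem_complexRoots hv0]
      set q := Q.map Complex.ofRealHom with hq
      set w := v.map Complex.ofRealHom with hw
      have hq0 : q ≠ 0 := (Polynomial.map_ne_zero_iff Complex.ofReal_injective).2 hQ
      have hw0 : w ≠ 0 := (Polynomial.map_ne_zero_iff Complex.ofReal_injective).2 hv0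
      have hrel : w * derivative q = - (u.map Complex.ofRealHom * q) := by
        have := congrArg (Polynomial.map Complex.ofRealHom) h
        simp only [Polynomial.map_add, Polynomial.map_mul, Polynomial.map_zero,
          ← derivative_map] at this
        linear_combination this
      by_contra hwz
      have hm1 := rootMultiplicity_eq_zero (p := w) (x := z) hwz
      have hm2 := derivative_rootMultiplicity_of_root (p := q) (t := z) hz
      have hpos : 0 < q.rootMultiplicity z := (rootMultiplicity_pos hq0).2 hz
      have hd0 : derivative q ≠ 0 := by
        intro h0
        have hdeg := derivative_eq_zero.1 h0
        rw [eq_C_of_natDegree_eq_zero hdeg] at hz hq0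
        simp only [eval_C] at hz
        exact hq0 (by rw [hz, C_0])
      have hm3 : (w * derivative q).rootMultiplicity z = q.rootMultiplicity z - 1 := by
        rw [rootMultiplicity_mul (mul_ne_zero hw0 hd0), hm1, hm2, zero_add]
      have hne : w * derivative q ≠ 0 := mul_ne_zero hw0 hd0
      have : (X - C z) ^ q.rootMultiplicity z ∣ w * derivative q := by
        rw [hrel]
        exact (dvd_mul_of_dvd_right (pow_rootMultiplicity_dvd q z) _).neg_right
      have := (le_rootMultiplicity_iff hne).2 this
      omega
    have hv' : v.natDegree < s + 1 := (natDegree_lt_iff_degree_lt hv0).2 (by exact_mod_cast hv)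
    have h1 : (complexRoots v).card ≤ v.natDegree := by
      refine (Multiset.toFinset_card_le _).trans ((card_roots' _).trans ?_)
      rw [natDegree_map]
    have := Finset.card_le_card hsub
    omega
  · intro h
    set A := UniqueFactorizationMonoid.radical Q with hA
    have hA0 : A ≠ 0 := UniqueFactorizationMonoid.radical_ne_zero
    have hdeg : A.natDegree = (complexRoots Q).card := natDegree_radical_eq_card_complexRoots hQ
    have hmul : A * EuclideanDomain.divRadical Q = Q := EuclideanDomain.radical_mul_divRadical
    obtain ⟨w, hw⟩ := divRadical_dvd_derivative Q
    set B := EuclideanDomain.divRadical Q with hB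
    have hB0 : B ≠ 0 := EuclideanDomain.divRadical_ne_zero hQ
    refine ⟨-w, A, Or.inr hA0, ?_, ?_, ?_⟩
    · rw [degree_neg]
      by_cases hw0 : w = 0
      · rw [hw0, degree_zero]; exact WithBot.bot_lt_coe s
      · rw [← natDegree_lt_iff_degree_lt hw0]
        have h1 : (derivative Q).natDegree = B.natDegree + w.natDegree := by
          rw [hw, natDegree_mul hB0 hw0]
        have h2 : Q.natDegree = A.natDegree + B.natDegree := by
          conv_lhs => rw [← hmul]
          rw [natDegree_mul hA0 hB0]
        have h3 : Q.natDegree ≠ 0 := by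
          intro h0
          rw [eq_C_of_natDegree_eq_zero h0, derivative_C] at hw
          rcases mul_eq_zero.1 hw.symm with h | h
          · exact hB0 h
          · exact hw0 h
        have h4 := natDegree_derivative_lt h3
        omega
    · rw [← natDegree_lt_iff_degree_lt hA0]
      omega
    · rw [hw]
      conv_lhs => rw [← hmul]
      ring

open Polynomial in
/-- The truncation of `P` to degree at most `e`. -/
noncomputable def truncDegree {R : Type*} [CommRing R] (P : R[X]) (e : ℕ) : R[X] :=
  ∑ k ∈ Finset.range (e + 1), C (P.coeff k) * X ^ k

open Polynomial in
/-- The matrix of `(u, v) ↦ u * P + v * P'`, for the truncation `P` of degree `e`. -/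
noncomputable def relationMatrix {R : Type*} [CommRing R] (P : R[X]) (e s : ℕ) :
    Matrix (Fin (s + e)) (Fin s ⊕ Fin (s + 1)) R :=
  fun k => Sum.elim (fun i => (X ^ (i : ℕ) * truncDegree P e).coeff k)
    (fun j => (X ^ (j : ℕ) * derivative (truncDegree P e)).coeff k)

open Polynomial in
/-- The Gram determinant of `relationMatrix`. -/
noncomputable def relationDet {R : Type*} [CommRing R] (P : R[X]) (e s : ℕ) : R :=
  ((relationMatrix P e s).transpose * relationMatrix P e s).det

open Polynomial Classical in
/-- A finite family of elements of `R` such that the vanishing of their images under a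
homomorphism to `ℝ` determines the degree and the number of complex roots of the image of `P`. -/
noncomputable def rootStrata {R : Type*} [CommRing R] (P : R[X]) : Finset R :=
  (Finset.range (P.natDegree + 1)).image P.coeff ∪
    (Finset.range (P.natDegree + 1) ×ˢ Finset.range (P.natDegree + 1)).image
      fun z => relationDet P z.1 z.2

open Polynomial in
lemma card_rootStrata_le {R : Type*} [CommRing R] (P : R[X]) :
    (rootStrata P).card ≤ (P.natDegree + 2) ^ 2 := by
  classical
  refine (Finset.card_union_le _ _).trans ?_
  have h1 := Finset.card_image_le (s := Finset.range (P.natDegree + 1)) (f := P.coeff)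
  have h2 := Finset.card_image_le (s := Finset.range (P.natDegree + 1) ×ˢ
    Finset.range (P.natDegree + 1)) (f := fun z => relationDet P z.1 z.2)
  rw [Finset.card_range] at h1
  rw [Finset.card_product, Finset.card_range] at h2
  nlinarith

open Polynomial in
lemma map_truncDegree {R S : Type*} [CommRing R] [CommRing S] (φ : R →+* S) (P : R[X]) (e : ℕ) :
    (truncDegree P e).map φ = truncDegree (P.map φ) e := by
  simp [truncDegree, Polynomial.map_sum]

open Polynomial in
lemma truncDegree_natDegree {R : Type*} [CommRing R] (P : R[X]) :
    truncDegree P P.natDegree = P :=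
  (P.as_sum_range_C_mul_X_pow).symm

open Polynomial in
lemma map_relationDet {R S : Type*} [CommRing R] [CommRing S] (φ : R →+* S) (P : R[X])
    (e s : ℕ) : φ (relationDet P e s) = relationDet (P.map φ) e s := by
  have hM : (relationMatrix P e s).map φ = relationMatrix (P.map φ) e s := by
    ext k j
    rcases j with j | j
    · simp only [Matrix.map_apply, relationMatrix, Sum.elim_inl,
        ← map_truncDegree, ← coeff_map, Polynomial.map_mul, Polynomial.map_pow, map_X]
    · simp only [Matrix.map_apply, relationMatrix, Sum.elim_inr,
        ← map_truncDegree, ← coeff_map, Polynomial.map_mul, Polynomial.map_pow, map_X,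
        derivative_map]
  rw [relationDet, relationDet, ← hM, RingHom.map_det]
  congr 1
  ext i j
  simp [Matrix.mul_apply]

lemma det_transpose_mul_self_eq_zero_iff {m n : Type*} [Fintype m] [Fintype n] [DecidableEq n]
    (L : Matrix m n ℝ) : (L.transpose * L).det = 0 ↔ ∃ x ≠ 0, L.mulVec x = 0 := by
  rw [← Matrix.exists_mulVec_eq_zero_iff]
  constructor
  · rintro ⟨x, hx, h⟩
    refine ⟨x, hx, ?_⟩
    rw [← Matrix.mulVec_mulVec] at h
    have h2 : L.mulVec x ⬝ᵥ L.mulVec x = 0 := by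
      rw [Matrix.dotProduct_mulVec, ← Matrix.mulVec_transpose, h, zero_dotProduct]
    exact dotProduct_self_eq_zero.1 h2
  · rintro ⟨x, hx, h⟩
    exact ⟨x, hx, by rw [← Matrix.mulVec_mulVec, h, Matrix.mulVec_zero]⟩

open Polynomial in
lemma mulVec_relationMatrix {Q : ℝ[X]} (s : ℕ) (x : Fin s ⊕ Fin (s + 1) → ℝ)
    (k : Fin (s + Q.natDegree)) :
    (relationMatrix Q Q.natDegree s).mulVec x k =
      ((∑ i : Fin s, C (x (Sum.inl i)) * X ^ (i : ℕ)) * Q +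
        (∑ i : Fin (s + 1), C (x (Sum.inr i)) * X ^ (i : ℕ)) * derivative Q).coeff k := by
  simp only [Matrix.mulVec, dotProduct, Fintype.sum_sum_type, relationMatrix, Sum.elim_inl,
    Sum.elim_inr, truncDegree_natDegree, coeff_add, Finset.sum_mul, finsetSum_coeff, mul_assoc,
    coeff_C_mul]
  congr 1 <;> exact Finset.sum_congr rfl fun i _ => mul_comm _ _

open Polynomial in
lemma sum_fin_C_mul_X_pow_eq {u : ℝ[X]} {s : ℕ} (hu : u.degree < s) :
    ∑ i : Fin s, C (u.coeff i) * X ^ (i : ℕ) = u := by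
  rw [Fin.sum_univ_eq_sum_range (fun i => C (u.coeff i) * X ^ i)]
  ext k
  rw [finsetSum_coeff]
  simp only [coeff_C_mul, coeff_X_pow, mul_ite, mul_one, mul_zero, Finset.sum_ite_eq,
    Finset.mem_range]
  split_ifs with h
  · rfl
  · exact (coeff_eq_zero_of_degree_lt (hu.trans_le (by exact_mod_cast not_lt.1 h))).symm

open Polynomial in
lemma relationDet_eq_zero_iff {Q : ℝ[X]} (hQ : Q ≠ 0) (s : ℕ) :
    relationDet Q Q.natDegree s = 0 ↔ (complexRoots Q).card ≤ s := by
  rw [relationDet, det_transpose_mul_self_eq_zero_iff,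
    ← exists_relation_iff_card_complexRoots_le hQ]
  constructor
  · rintro ⟨x, hx, h⟩
    set u : ℝ[X] := ∑ i : Fin s, C (x (Sum.inl i)) * X ^ (i : ℕ) with hu
    set v : ℝ[X] := ∑ i : Fin (s + 1), C (x (Sum.inr i)) * X ^ (i : ℕ) with hv
    have hud : u.degree < s := degree_sum_fin_lt _
    have hvd : v.degree < (s + 1 : ℕ) := degree_sum_fin_lt _
    refine ⟨u, v, ?_, hud, hvd, ?_⟩
    · by_contra! h0
      apply hx
      funext j
      rcases j with j | j
      · have := congrArg (fun p : ℝ[X] => p.coeff j) h0.1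
        simpa [hu, finsetSum_coeff, coeff_X_pow, Fin.val_inj] using this
      · have := congrArg (fun p : ℝ[X] => p.coeff j) h0.2
        simpa [hv, finsetSum_coeff, coeff_X_pow, Fin.val_inj] using this
    · ext k
      rw [coeff_zero]
      by_cases hk : k < s + Q.natDegree
      · have := mulVec_relationMatrix (Q := Q) s x ⟨k, hk⟩
        rw [h] at this
        exact this.symm
      · push Not at hk
        rw [coeff_add]
        have h1 : (u * Q).coeff k = 0 := by
          by_cases hu0 : u = 0
          · simp [hu0]
          have := (natDegree_lt_iff_degree_lt hu0).2 hud
          apply coeff_eq_zero_of_natDegree_lt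
          have := natDegree_mul_le (p := u) (q := Q)
          omega
        have h2 : (v * derivative Q).coeff k = 0 := by
          by_cases hv0 : v = 0
          · simp [hv0]
          by_cases hd0 : Q.natDegree = 0
          · rw [eq_C_of_natDegree_eq_zero hd0]; simp
          have := (natDegree_lt_iff_degree_lt hv0).2 hvd
          apply coeff_eq_zero_of_natDegree_lt
          have := natDegree_mul_le (p := v) (q := derivative Q)
          have := natDegree_derivative_lt hd0
          omega
        rw [h1, h2, add_zero]
  · rintro ⟨u, v, huv, hud, hvd, h⟩
    refine ⟨Sum.elim (fun i => u.coeff i) (fun i => v.coeff i), ?_, ?_⟩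
    · intro h0
      have h1 : u = 0 := by
        rw [← sum_fin_C_mul_X_pow_eq hud]
        refine Finset.sum_eq_zero fun i _ => ?_
        have := congrFun h0 (Sum.inl i)
        simp only [Sum.elim_inl, Pi.zero_apply] at this
        rw [this, C_0, zero_mul]
      have h2 : v = 0 := by
        rw [← sum_fin_C_mul_X_pow_eq hvd]
        refine Finset.sum_eq_zero fun i _ => ?_
        have := congrFun h0 (Sum.inr i)
        simp only [Sum.elim_inr, Pi.zero_apply] at this
        rw [this, C_0, zero_mul]
      rcases huv with h | h
      · exact h h1
      · exact h h2
    · funext k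
      rw [mulVec_relationMatrix]
      simp only [Sum.elim_inl, Sum.elim_inr]
      rw [sum_fin_C_mul_X_pow_eq hud, sum_fin_C_mul_X_pow_eq hvd, h]
      rfl

open Polynomial in
lemma coeff_map_eq_zero_iff_of_rootStrata {R : Type*} [CommRing R] (P : R[X])
    {φ ψ : R →+* ℝ} (h : ∀ r ∈ rootStrata P, φ r = 0 ↔ ψ r = 0) (k : ℕ) :
    (P.map φ).coeff k = 0 ↔ (P.map ψ).coeff k = 0 := by
  classical
  rw [coeff_map, coeff_map]
  by_cases hk : k < P.natDegree + 1
  · exact h _ (Finset.mem_union_left _ (Finset.mem_image_of_mem _ (Finset.mem_range.2 hk)))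
  · rw [coeff_eq_zero_of_natDegree_lt (by omega), map_zero, map_zero]

open Polynomial in
lemma map_eq_zero_iff_of_rootStrata {R : Type*} [CommRing R] (P : R[X])
    {φ ψ : R →+* ℝ} (h : ∀ r ∈ rootStrata P, φ r = 0 ↔ ψ r = 0) :
    P.map φ = 0 ↔ P.map ψ = 0 := by
  simp only [Polynomial.ext_iff, coeff_zero, coeff_map_eq_zero_iff_of_rootStrata P h]

open Polynomial in
lemma leadingCoeff_mem_rootStrata {R : Type*} [CommRing R] (P : R[X]) :
    P.leadingCoeff ∈ rootStrata P := by
  classical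
  exact Finset.mem_union_left _
    (Finset.mem_image_of_mem _ (Finset.mem_range.2 (Nat.lt_succ_self _)))

open Polynomial in
/-- If the elements of `rootStrata P` vanish simultaneously under `φ` and `ψ`, then the images of
`P` have the same degree. -/
lemma natDegree_map_eq_of_rootStrata {R : Type*} [CommRing R] (P : R[X])
    {φ ψ : R →+* ℝ} (h : ∀ r ∈ rootStrata P, φ r = 0 ↔ ψ r = 0) :
    (P.map φ).natDegree = (P.map ψ).natDegree := by
  have key := coeff_map_eq_zero_iff_of_rootStrata P h
  refine le_antisymm ?_ ?_
  · rw [natDegree_le_iff_coeff_eq_zero]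
    intro N hN
    exact (key N).2 (coeff_eq_zero_of_natDegree_lt hN)
  · rw [natDegree_le_iff_coeff_eq_zero]
    intro N hN
    exact (key N).1 (coeff_eq_zero_of_natDegree_lt hN)

open Polynomial in
lemma card_complexRoots_map_le_of_rootStrata {R : Type*} [CommRing R] (P : R[X])
    {φ ψ : R →+* ℝ} (h : ∀ r ∈ rootStrata P, φ r = 0 ↔ ψ r = 0) (hφ : P.map φ ≠ 0)
    (hψ : P.map ψ ≠ 0) :
    (complexRoots (P.map φ)).card ≤ (complexRoots (P.map ψ)).card := by
  classical
  have hd := natDegree_map_eq_of_rootStrata P h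
  have hs : (complexRoots (P.map ψ)).card ≤ P.natDegree := by
    refine (Multiset.toFinset_card_le _).trans ((card_roots' _).trans ?_)
    rw [natDegree_map]
    exact natDegree_map_le
  have he : (P.map φ).natDegree ≤ P.natDegree := natDegree_map_le
  rw [← relationDet_eq_zero_iff hφ, ← map_relationDet, h, map_relationDet, hd,
    relationDet_eq_zero_iff hψ]
  refine Finset.mem_union_right _ (Finset.mem_image.2
    ⟨((P.map φ).natDegree, (complexRoots (P.map ψ)).card), ?_, rfl⟩)
  simp only [Finset.mem_product, Finset.mem_range]
  omega

open Polynomial in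
/-- If the elements of `rootStrata P` vanish simultaneously under `φ` and `ψ`, then the images of
`P` have the same number of complex roots. -/
lemma card_complexRoots_map_eq_of_rootStrata {R : Type*} [CommRing R] (P : R[X])
    {φ ψ : R →+* ℝ} (h : ∀ r ∈ rootStrata P, φ r = 0 ↔ ψ r = 0) (hφ : P.map φ ≠ 0)
    (hψ : P.map ψ ≠ 0) :
    (complexRoots (P.map φ)).card = (complexRoots (P.map ψ)).card :=
  le_antisymm (card_complexRoots_map_le_of_rootStrata P h hφ hψ)
    (card_complexRoots_map_le_of_rootStrata P (fun r hr => (h r hr).symm) hψ hφ)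

open Polynomial in
/-- A degree bound for the elements of `rootStrata P`, for an abstract degree function. -/
lemma degree_rootStrata_le {R : Type*} [CommRing R] (deg : R → ℕ)
    (hadd : ∀ a b, deg (a + b) ≤ max (deg a) (deg b)) (hmul : ∀ a b, deg (a * b) ≤ deg a + deg b)
    (hdegInt : ∀ n : ℤ, deg n = 0) (P : R[X]) {k : ℕ} (hk : ∀ i, deg (P.coeff i) ≤ k)
    {r : R} (hr : r ∈ rootStrata P) : deg r ≤ (2 * P.natDegree + 2) * (2 * k) := by
  classical
  have hsum : ∀ {ι : Type} (S : Finset ι) (f : ι → R) (m : ℕ), (∀ i ∈ S, deg (f i) ≤ m) →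
      deg (∑ i ∈ S, f i) ≤ m := by
    intro ι S f m hf
    induction S using Finset.induction_on with
    | empty =>
      have := hdegInt 0
      rw [Int.cast_zero] at this
      rw [Finset.sum_empty, this]
      exact Nat.zero_le m
    | insert a S ha ih =>
      rw [Finset.sum_insert ha]
      refine (hadd _ _).trans (max_le (hf _ (Finset.mem_insert_self _ _)) (ih fun i hi => ?_))
      exact hf _ (Finset.mem_insert_of_mem hi)
  have hprod : ∀ {ι : Type} (S : Finset ι) (f : ι → R) (m : ℕ), (∀ i ∈ S, deg (f i) ≤ m) →
      deg (∏ i ∈ S, f i) ≤ S.card * m := by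
    intro ι S f m hf
    induction S using Finset.induction_on with
    | empty => simpa using (hdegInt 1).le
    | insert a S ha ih =>
      rw [Finset.prod_insert ha, Finset.card_insert_of_notMem ha]
      have h1 := hf _ (Finset.mem_insert_self a S)
      have h2 := ih fun i hi => hf _ (Finset.mem_insert_of_mem hi)
      have := hmul (f a) (∏ i ∈ S, f i)
      nlinarith
  have htr : ∀ e i, deg ((truncDegree P e).coeff i) ≤ k := by
    intro e i
    rw [truncDegree, finsetSum_coeff]
    refine hsum _ _ _ fun j _ => ?_
    rw [coeff_C_mul, coeff_X_pow]
    split_ifs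
    · rw [mul_one]; exact hk j
    · rw [mul_zero]; simpa using (hdegInt 0).le.trans (Nat.zero_le k)
  have hX : ∀ (Q : R[X]) (j i : ℕ), (∀ i, deg (Q.coeff i) ≤ k) →
      deg ((X ^ j * Q).coeff i) ≤ k := by
    intro Q j i hQ
    rw [coeff_X_pow_mul']
    split_ifs
    · exact hQ _
    · simpa using (hdegInt 0).le.trans (Nat.zero_le k)
  have hL : ∀ e s i j, deg (relationMatrix P e s i j) ≤ k := by
    intro e s i j
    rcases j with j | j
    · exact hX _ _ _ (htr e)
    · refine hX _ _ _ fun l => ?_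
      change deg ((derivative (truncDegree P e)).coeff l) ≤ k
      rw [coeff_derivative]
      refine (hmul _ _).trans ?_
      have := hdegInt (l + 1)
      push_cast at this
      rw [this, add_zero]
      exact htr e _
  have hdet : ∀ e s, deg (relationDet P e s) ≤ (2 * s + 1) * (2 * k) := by
    intro e s
    rw [relationDet, Matrix.det_apply']
    apply hsum
    intro σ _
    refine (hmul _ _).trans ?_
    rw [hdegInt, zero_add]
    refine (hprod _ _ (2 * k) fun i _ => ?_).trans ?_
    · rw [Matrix.mul_apply]
      refine hsum _ _ _ fun j _ => (hmul _ _).trans ?_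
      rw [Matrix.transpose_apply]
      have := hL e s j (σ i)
      have := hL e s j i
      omega
    · apply le_of_eq
      rw [Finset.card_univ, Fintype.card_sum, Fintype.card_fin, Fintype.card_fin]
      ring
  rcases Finset.mem_union.1 hr with hr | hr
  · obtain ⟨i, -, rfl⟩ := Finset.mem_image.1 hr
    have := hk i
    nlinarith
  · obtain ⟨⟨e, s⟩, hes, rfl⟩ := Finset.mem_image.1 hr
    simp only [Finset.mem_product, Finset.mem_range] at hes
    refine (hdet e s).trans (Nat.mul_le_mul_right _ ?_)
    omega

/-- The position of `t` relative to the finite set `A`: the value is odd on `A`, even off `A`. -/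
noncomputable def rankCode (A : Finset ℝ) (t : ℝ) : ℕ :=
  2 * (A.filter (· < t)).card + if t ∈ A then 1 else 0

lemma rankCode_lt_of_mem_left {A : Finset ℝ} {t u : ℝ} (ht : t ∈ A) (h : t < u) :
    rankCode A t < rankCode A u := by
  have : (A.filter (· < t)).card < (A.filter (· < u)).card := by
    apply Finset.card_lt_card
    refine (Finset.ssubset_iff_of_subset ?_).2 ⟨t, by simp [ht, h], by simp⟩
    intro r hr
    rw [Finset.mem_filter] at hr ⊢
    exact ⟨hr.1, hr.2.trans h⟩
  rw [rankCode, rankCode, if_pos ht]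
  split_ifs <;> omega

lemma rankCode_mono (A : Finset ℝ) : Monotone (rankCode A) := by
  intro t u h
  rcases h.eq_or_lt with rfl | h
  · exact le_rfl
  by_cases ht : t ∈ A
  · exact (rankCode_lt_of_mem_left ht h).le
  · have : (A.filter (· < t)).card ≤ (A.filter (· < u)).card := by
      apply Finset.card_le_card
      intro r hr
      rw [Finset.mem_filter] at hr ⊢
      exact ⟨hr.1, hr.2.trans h⟩
    rw [rankCode, rankCode, if_neg ht]
    omega

lemma rankCode_lt_of_mem_right {A : Finset ℝ} {t u : ℝ} (hu : u ∈ A) (h : t < u) :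
    rankCode A t < rankCode A u := by
  by_cases ht : t ∈ A
  · exact rankCode_lt_of_mem_left ht h
  · have := rankCode_mono A h.le
    have h1 : (A.filter (· < t)).card ≤ (A.filter (· < u)).card := by
      apply Finset.card_le_card
      intro r hr
      rw [Finset.mem_filter] at hr ⊢
      exact ⟨hr.1, hr.2.trans h⟩
    rw [rankCode, rankCode, if_neg ht, if_pos hu]
    omega

lemma odd_rankCode_iff {A : Finset ℝ} {t : ℝ} : Odd (rankCode A t) ↔ t ∈ A := by
  rw [rankCode]
  split_ifs with h
  · exact ⟨fun _ => h, fun _ => ⟨_, rfl⟩⟩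
  · simp [h]

lemma rankCode_lt (A : Finset ℝ) (t : ℝ) : rankCode A t < 2 * A.card + 1 := by
  rw [rankCode]
  have h1 := Finset.card_filter_le A (· < t)
  split_ifs with h
  · have : (A.filter (· < t)).card < A.card := by
      apply Finset.card_lt_card
      exact (Finset.ssubset_iff_of_subset (Finset.filter_subset _ _)).2 ⟨t, h, by simp⟩
    omega
  · omega

lemma notMem_of_rankCode_eq {A : Finset ℝ} {t u r : ℝ} (h : rankCode A t = rankCode A u)
    (htu : t ≠ u) (hr : r ∈ Set.uIcc t u) : r ∉ A := by
  wlog hlt : t < u generalizing t u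
  · exact this h.symm htu.symm (Set.uIcc_comm t u ▸ hr) (lt_of_le_of_ne (not_lt.1 hlt) htu.symm)
  intro hA
  rw [Set.uIcc_of_le hlt.le] at hr
  rcases hr.1.eq_or_lt with rfl | h1
  · exact (rankCode_lt_of_mem_left hA hlt).ne h
  · have := rankCode_lt_of_mem_right hA h1
    have := rankCode_mono A hr.2
    omega

/-- Between two points of different codes, there is an element of `A` next to the first one. -/
lemma exists_mem_of_rankCode_lt {A : Finset ℝ} {t u : ℝ} (h : rankCode A t < rankCode A u) :
    ∃ r ∈ A, t ≤ r ∧ r ≤ u ∧ rankCode A r = 2 * (rankCode A t / 2) + 1 := by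
  have htu : t < u := by
    by_contra hc
    exact absurd (rankCode_mono A (not_lt.1 hc)) (not_le.2 h)
  have hne : (A.filter fun r => t ≤ r ∧ r ≤ u).Nonempty := by
    by_contra hc
    rw [Finset.not_nonempty_iff_eq_empty, Finset.filter_eq_empty_iff] at hc
    have h1 : t ∉ A := fun hA => hc hA ⟨le_rfl, htu.le⟩
    have h2 : u ∉ A := fun hA => hc hA ⟨htu.le, le_rfl⟩
    have h3 : A.filter (· < u) ⊆ A.filter (· < t) := by
      intro r hr
      rw [Finset.mem_filter] at hr ⊢
      refine ⟨hr.1, ?_⟩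
      by_contra hrt
      exact hc hr.1 ⟨not_lt.1 hrt, hr.2.le⟩
    have := Finset.card_le_card h3
    rw [rankCode, rankCode, if_neg h1, if_neg h2] at h
    omega
  set r := (A.filter fun r => t ≤ r ∧ r ≤ u).min' hne with hr
  have hrm := Finset.min'_mem _ hne
  rw [← hr, Finset.mem_filter] at hrm
  refine ⟨r, hrm.1, hrm.2.1, hrm.2.2, ?_⟩
  have h1 : A.filter (· < r) = A.filter (· < t) := by
    ext x
    rw [Finset.mem_filter, Finset.mem_filter]
    refine ⟨fun hx => ⟨hx.1, ?_⟩, fun hx => ⟨hx.1, hx.2.trans_le hrm.2.1⟩⟩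
    by_contra hxt
    have := Finset.min'_le (A.filter fun r => t ≤ r ∧ r ≤ u) x
      (Finset.mem_filter.2 ⟨hx.1, not_lt.1 hxt, hx.2.le.trans hrm.2.2⟩)
    exact absurd hx.2 (not_lt.2 this)
  rw [rankCode, if_pos hrm.1, h1, rankCode]
  split_ifs <;> omega

lemma exists_mem_of_lt_rankCode {A : Finset ℝ} {t u : ℝ} (h : rankCode A u < rankCode A t) :
    ∃ r ∈ A, u ≤ r ∧ r ≤ t ∧ rankCode A r = 2 * ((rankCode A t - 1) / 2) + 1 := by
  have htu : u < t := by
    by_contra hc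
    exact absurd (rankCode_mono A (not_lt.1 hc)) (not_le.2 h)
  by_cases ht : t ∈ A
  · refine ⟨t, ht, htu.le, le_rfl, ?_⟩
    rw [rankCode, if_pos ht]
    omega
  have hne : (A.filter fun r => u ≤ r ∧ r ≤ t).Nonempty := by
    obtain ⟨r, hr, h1, h2, -⟩ := exists_mem_of_rankCode_lt h
    exact ⟨r, Finset.mem_filter.2 ⟨hr, h1, h2⟩⟩
  set r := (A.filter fun r => u ≤ r ∧ r ≤ t).max' hne with hr
  have hrm := Finset.max'_mem _ hne
  rw [← hr, Finset.mem_filter] at hrm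
  refine ⟨r, hrm.1, hrm.2.1, hrm.2.2, ?_⟩
  have hrt : r < t := lt_of_le_of_ne hrm.2.2 fun h => ht (h ▸ hrm.1)
  have h1 : A.filter (· < t) = insert r (A.filter (· < r)) := by
    ext x
    rw [Finset.mem_insert, Finset.mem_filter, Finset.mem_filter]
    constructor
    · rintro ⟨hx, hxt⟩
      by_cases hxr : x < r
      · exact Or.inr ⟨hx, hxr⟩
      · refine Or.inl (le_antisymm ?_ (not_lt.1 hxr))
        exact Finset.le_max' (A.filter fun r => u ≤ r ∧ r ≤ t) x
          (Finset.mem_filter.2 ⟨hx, hrm.2.1.trans (not_lt.1 hxr), hxt.le⟩)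
    · rintro (rfl | ⟨hx, hxr⟩)
      · exact ⟨hrm.1, hrt⟩
      · exact ⟨hx, hxr.trans hrt⟩
  rw [rankCode, if_pos hrm.1, rankCode, if_neg ht, h1,
    Finset.card_insert_of_notMem (by simp)]
  omega

/-- The position of `t` relative to `A` is determined by its position relative to at most two
elements of `A`. -/
lemma exists_rankCode_witness (A : Finset ℝ) (t : ℝ) :
    ∃ S ⊆ A, S.card ≤ 2 ∧ ∀ u, (∀ r ∈ S, SignType.sign (u - r) = SignType.sign (t - r)) →
      rankCode A u = rankCode A t := by
  classical
  have h1 : ∃ S ⊆ A, S.card ≤ 1 ∧ ∀ u, (∀ r ∈ S, SignType.sign (u - r) = SignType.sign (t - r)) →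
      rankCode A t ≤ rankCode A u := by
    by_cases h : ∃ r ∈ A, rankCode A r = 2 * ((rankCode A t - 1) / 2) + 1 ∧ r ≤ t
    · obtain ⟨r, hr, hrc, hrt⟩ := h
      refine ⟨{r}, by simpa using hr, by simp, fun u hu => ?_⟩
      by_contra hc
      obtain ⟨r', hr', h1, h2, h3⟩ := exists_mem_of_lt_rankCode (not_le.1 hc)
      have hrr : r = r' := by
        by_contra hne
        exact notMem_of_rankCode_eq (hrc.trans h3.symm) hne Set.left_mem_uIcc hr
      subst hrr
      have := hu r (Finset.mem_singleton_self r)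
      rcases h1.eq_or_lt with rfl | h1
      · rw [sub_self, sign_zero] at this
        have := sign_eq_zero_iff.1 this.symm
        rw [show t = u by linarith] at hc
        exact hc le_rfl
      · rw [sign_neg (by linarith)] at this
        have := sign_eq_neg_one_iff.1 this.symm
        linarith
    · refine ⟨∅, by simp, by simp, fun u _ => ?_⟩
      by_contra hc
      obtain ⟨r', hr', h1, h2, h3⟩ := exists_mem_of_lt_rankCode (not_le.1 hc)
      exact h ⟨r', hr', h3, h2⟩
  have h2 : ∃ S ⊆ A, S.card ≤ 1 ∧ ∀ u, (∀ r ∈ S, SignType.sign (u - r) = SignType.sign (t - r)) →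
      rankCode A u ≤ rankCode A t := by
    by_cases h : ∃ r ∈ A, rankCode A r = 2 * (rankCode A t / 2) + 1 ∧ t ≤ r
    · obtain ⟨r, hr, hrc, hrt⟩ := h
      refine ⟨{r}, by simpa using hr, by simp, fun u hu => ?_⟩
      by_contra hc
      obtain ⟨r', hr', h1, h2, h3⟩ := exists_mem_of_rankCode_lt (not_le.1 hc)
      have hrr : r = r' := by
        by_contra hne
        exact notMem_of_rankCode_eq (hrc.trans h3.symm) hne Set.left_mem_uIcc hr
      subst hrr
      have := hu r (Finset.mem_singleton_self r)
      rcases h2.eq_or_lt with rfl | h2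
      · rw [sub_self, sign_zero] at this
        have := sign_eq_zero_iff.1 this.symm
        rw [show t = r by linarith] at hc
        exact hc le_rfl
      · rw [sign_pos (by linarith)] at this
        have := sign_eq_one_iff.1 this.symm
        linarith
    · refine ⟨∅, by simp, by simp, fun u _ => ?_⟩
      by_contra hc
      obtain ⟨r', hr', h1, h2, h3⟩ := exists_mem_of_rankCode_lt (not_le.1 hc)
      exact h ⟨r', hr', h3, h1⟩
  obtain ⟨S, hS, hSc, h1⟩ := h1
  obtain ⟨T, hT, hTc, h2⟩ := h2
  refine ⟨S ∪ T, Finset.union_subset hS hT, (Finset.card_union_le _ _).trans (by omega), ?_⟩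
  intro u hu
  exact le_antisymm (h2 u fun r hr => hu r (Finset.mem_union_right _ hr))
    (h1 u fun r hr => hu r (Finset.mem_union_left _ hr))

lemma ordConnected_rankCode (A : Finset ℝ) (i : ℕ) : {t | rankCode A t = i}.OrdConnected := by
  refine ⟨fun t ht u hu v hv => ?_⟩
  have h1 := rankCode_mono A hv.1
  have h2 := rankCode_mono A hv.2
  rw [Set.mem_ofPred_eq] at ht hu ⊢
  omega

lemma rankCode_strictMono {s : ℕ} {ξ : Fin s → ℝ} (hξ : StrictMono ξ) {A : Finset ℝ}
    (hA : ∀ t, t ∈ A ↔ ∃ i, ξ i = t) (k : Fin s) : rankCode A (ξ k) = 2 * k + 1 := by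
  have h1 : A.filter (· < ξ k) = (Finset.univ.filter (· < k)).map ⟨ξ, hξ.injective⟩ := by
    ext t
    simp only [Finset.mem_filter, hA, Finset.mem_map, Finset.mem_univ, true_and,
      Function.Embedding.coeFn_mk]
    constructor
    · rintro ⟨⟨i, rfl⟩, h⟩
      exact ⟨i, hξ.lt_iff_lt.1 h, rfl⟩
    · rintro ⟨i, hi, rfl⟩
      exact ⟨⟨i, rfl⟩, hξ hi⟩
  have h2 : (Finset.univ.filter (· < k)).card = k := by
    have := Fin.card_Iio k
    rwa [← Finset.filter_gt_eq_Iio] at this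
  rw [rankCode, if_pos ((hA _).2 ⟨k, rfl⟩), h1, Finset.card_map, h2]

lemma rankCode_eq_of_strictMono {s : ℕ} {ξ : Fin s → ℝ} (hξ : StrictMono ξ) {A : Finset ℝ}
    (hA : ∀ t, t ∈ A ↔ ∃ i, ξ i = t) {t : ℝ} (ht : t ∉ A) :
    rankCode A t = 2 * (Finset.univ.filter fun k => ξ k < t).card := by
  have h1 : A.filter (· < t) = (Finset.univ.filter fun k => ξ k < t).map ⟨ξ, hξ.injective⟩ := by
    ext u
    simp only [Finset.mem_filter, hA, Finset.mem_map, Finset.mem_univ, true_and,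
      Function.Embedding.coeFn_mk]
    constructor
    · rintro ⟨⟨i, rfl⟩, h⟩
      exact ⟨i, h, rfl⟩
    · rintro ⟨i, hi, rfl⟩
      exact ⟨⟨i, rfl⟩, hi⟩
  rw [rankCode, if_neg ht, h1, Finset.card_map, add_zero]

/-- A continuous family of strictly increasing finite sequences admits continuous selections at
every attained position. -/
lemma exists_continuous_rankCode_eq {C : Type*} [TopologicalSpace C] {s : ℕ} (ξ : Fin s → C → ℝ)
    (hc : ∀ i, Continuous (ξ i)) (hm : ∀ c, StrictMono fun i => ξ i c) (A : C → Finset ℝ)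
    (hA : ∀ c t, t ∈ A c ↔ ∃ i, ξ i c = t) {c₀ : C} {t₀ : ℝ} :
    ∃ f : C → ℝ, Continuous f ∧ ∀ c, rankCode (A c) (f c) = rankCode (A c₀) t₀ := by
  set j := rankCode (A c₀) t₀ with hj
  have hcard : ∀ c, (A c).card = s := by
    intro c
    have : A c = Finset.univ.map ⟨fun i => ξ i c, (hm c).injective⟩ := by
      ext t
      simp [hA]
    rw [this, Finset.card_map, Finset.card_univ, Fintype.card_fin]
  have hjs : j ≤ 2 * s := by
    have := rankCode_lt (A c₀) t₀
    rw [hcard] at this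
    omega
  have hcode := fun c (k : Fin s) => rankCode_strictMono (hm c) (hA c) k
  rcases Nat.even_or_odd' j with ⟨k, hk | hk⟩
  · have hmid : ∀ (c : C) (t : ℝ), (∀ i : Fin s, (i : ℕ) < k → ξ i c < t) →
        (∀ i : Fin s, k ≤ (i : ℕ) → t < ξ i c) → rankCode (A c) t = j := by
      intro c t h1 h2
      have hnot : t ∉ A c := by
        rw [hA]
        rintro ⟨i, hi⟩
        rcases lt_or_ge (i : ℕ) k with h | h
        · exact (h1 i h).ne hi
        · exact (h2 i h).ne' hi
      have hev : ¬ Odd (rankCode (A c) t) := fun h => hnot (odd_rankCode_iff.1 h)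
      rw [Nat.not_odd_iff_even] at hev
      obtain ⟨m, hm'⟩ := hev
      have hle : rankCode (A c) t ≤ j := by
        by_cases hks : k < s
        · have := rankCode_mono (A c) (h2 ⟨k, hks⟩ le_rfl).le
          rw [hcode] at this
          simp only at this
          omega
        · have := rankCode_lt (A c) t
          rw [hcard] at this
          omega
      have hge : j ≤ rankCode (A c) t := by
        rcases Nat.eq_zero_or_pos k with h0 | h0
        · omega
        · have hks : k - 1 < s := by omega
          have := rankCode_mono (A c) (h1 ⟨k - 1, hks⟩ (by simp only; omega)).le
          rw [hcode] at this
          simp only at this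
          omega
      omega
    have hmono : ∀ c (i i' : Fin s), (i : ℕ) ≤ i' → ξ i c ≤ ξ i' c := fun c i i' h =>
      (hm c).monotone h
    by_cases h0 : 0 < k
    · have hk1 : k - 1 < s := by omega
      by_cases hks : k < s
      · refine ⟨fun c => (ξ ⟨k - 1, hk1⟩ c + ξ ⟨k, hks⟩ c) / 2, ?_, fun c => ?_⟩
        · exact ((hc _).add (hc _)).div_const 2
        · have hlt : ξ ⟨k - 1, hk1⟩ c < ξ ⟨k, hks⟩ c := hm c (by
            rw [Fin.mk_lt_mk]; omega)
          refine hmid c _ (fun i hi => ?_) fun i hi => ?_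
          · have := hmono c i ⟨k - 1, hk1⟩ (by simp only; omega)
            linarith
          · have := hmono c ⟨k, hks⟩ i hi
            linarith
      · refine ⟨fun c => ξ ⟨k - 1, hk1⟩ c + 1, (hc _).add continuous_const, fun c => ?_⟩
        refine hmid c _ (fun i hi => ?_) fun i hi => ?_
        · have := hmono c i ⟨k - 1, hk1⟩ (by simp only; omega)
          linarith
        · have := i.2
          omega
    · by_cases hs : 0 < s
      · refine ⟨fun c => ξ ⟨0, hs⟩ c - 1, (hc _).sub continuous_const, fun c => ?_⟩
        refine hmid c _ (fun i hi => ?_) fun i hi => ?_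
        · omega
        · have := hmono c ⟨0, hs⟩ i (Nat.zero_le _)
          linarith
      · refine ⟨fun _ => 0, continuous_const, fun c => ?_⟩
        refine hmid c _ (fun i hi => ?_) fun i hi => ?_
        · omega
        · have := i.2
          omega
  · have hks : k < s := by omega
    exact ⟨ξ ⟨k, hks⟩, hc _, fun c => by rw [hcode, hk]⟩

/-- A continuous function with values in a continuous family of strictly increasing finite
sequences has constant index. -/
lemma exists_index_of_continuous {C : Type*} [TopologicalSpace C] [PreconnectedSpace C] {s : ℕ}
    (ξ : Fin s → C → ℝ) (hc : ∀ i, Continuous (ξ i)) (hm : ∀ c, StrictMono fun i => ξ i c)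
    {f : C → ℝ} (hf : Continuous f) (h : ∀ c, ∃ i, ξ i c = f c) (c c' : C) (i : Fin s)
    (hi : ξ i c = f c) : ξ i c' = f c' := by
  choose k hk using h
  have hcont : Continuous k := by
    rw [continuous_iff_isClosed]
    intro S _
    have : k ⁻¹' S = ⋃ j ∈ S, {c | ξ j c = f c} := by
      ext c
      simp only [Set.mem_preimage, Set.mem_iUnion, Set.mem_ofPred_eq, exists_prop]
      constructor
      · intro h
        exact ⟨k c, h, hk c⟩
      · rintro ⟨j, hj, hjc⟩
        rwa [(hm c).injective ((hk c).trans hjc.symm)]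
    rw [this]
    exact S.toFinite.isClosed_biUnion fun j _ => isClosed_eq (hc j) hf
  have h1 : k c = k c' := PreconnectedSpace.constant ‹_› hcont
  have h2 : k c = i := (hm c).injective ((hk c).trans hi.symm)
  rw [← h2, h1, hk]

open MvPolynomial in
/-- The value of a polynomial in three variables at the point `(p.1, p.2, 0)`. -/
noncomputable def planarEval (P : MvPolynomial (Fin 3) ℝ) (p : ℝ × ℝ) : ℝ :=
  eval ![p.1, p.2, 0] P

/-- `P(x, y, 0)` as a polynomial in `y` over the polynomials in `x`. -/
noncomputable def planarPoly :
    MvPolynomial (Fin 3) ℝ →ₐ[ℝ] Polynomial (Polynomial ℝ) :=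
  MvPolynomial.aeval ![Polynomial.C Polynomial.X, Polynomial.X, 0]

/-- `P(x, y, 0)` as a polynomial in `y`, for fixed `x`. -/
noncomputable def planarSlice (P : MvPolynomial (Fin 3) ℝ) (x : ℝ) : Polynomial ℝ :=
  (planarPoly P).map (Polynomial.evalRingHom x)

lemma planarSlice_mul (P Q : MvPolynomial (Fin 3) ℝ) (x : ℝ) :
    planarSlice (P * Q) x = planarSlice P x * planarSlice Q x := by
  simp [planarSlice]

lemma eval_planarSlice (P : MvPolynomial (Fin 3) ℝ) (p : ℝ × ℝ) :
    (planarSlice P p.1).eval p.2 = planarEval P p := by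
  induction P using MvPolynomial.induction_on with
  | C a =>
    simp only [planarSlice, planarPoly, planarEval, MvPolynomial.eval_C]
    rw [← MvPolynomial.algebraMap_eq, AlgHom.commutes]
    simp [Polynomial.algebraMap_apply]
  | add P Q hP hQ =>
    have : planarSlice (P + Q) p.1 = planarSlice P p.1 + planarSlice Q p.1 := by
      simp [planarSlice]
    rw [this, Polynomial.eval_add, hP, hQ, planarEval, planarEval, planarEval, map_add]
  | mul_X P i hP =>
    rw [planarSlice_mul, Polynomial.eval_mul, hP, planarEval, planarEval, map_mul]
    congr 1
    fin_cases i <;> simp [planarSlice, planarPoly]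

lemma planarEval_mul (P Q : MvPolynomial (Fin 3) ℝ) (p : ℝ × ℝ) :
    planarEval (P * Q) p = planarEval P p * planarEval Q p := by
  simp [planarEval]

lemma continuous_planarEval (P : MvPolynomial (Fin 3) ℝ) : Continuous (planarEval P) := by
  refine (MvPolynomial.continuous_eval P).comp ?_
  refine continuous_pi fun i => ?_
  fin_cases i
  · exact continuous_fst
  · exact continuous_snd
  · exact continuous_const

lemma planarSlice_pderiv (P : MvPolynomial (Fin 3) ℝ) (x : ℝ) :
    planarSlice (MvPolynomial.pderiv 1 P) x = Polynomial.derivative (planarSlice P x) := by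
  induction P using MvPolynomial.induction_on with
  | C a =>
    simp only [planarSlice, MvPolynomial.pderiv_C, map_zero]
    rw [← MvPolynomial.algebraMap_eq, AlgHom.commutes]
    simp [Polynomial.algebraMap_apply]
  | add P Q hP hQ => simp_all [planarSlice]
  | mul_X P i hP =>
    have h : planarSlice (MvPolynomial.pderiv 1 (MvPolynomial.X i)) x =
        Polynomial.derivative (planarSlice (MvPolynomial.X i) x) := by
      fin_cases i <;> simp [planarSlice, planarPoly, MvPolynomial.pderiv_X]
    have hadd : ∀ A B : MvPolynomial (Fin 3) ℝ,
        planarSlice (A + B) x = planarSlice A x + planarSlice B x := by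
      simp [planarSlice]
    rw [Derivation.leibniz, smul_eq_mul, smul_eq_mul, hadd, planarSlice_mul, planarSlice_mul,
      planarSlice_mul, hP, h, Polynomial.derivative_mul]
    ring

lemma totalDegree_pderiv_lt (P : MvPolynomial (Fin 3) ℝ) (i : Fin 3) :
    (MvPolynomial.pderiv i P).totalDegree ≤ P.totalDegree - 1 := by
  conv_lhs => rw [P.as_sum, map_sum]
  refine MvPolynomial.totalDegree_finsetSum_le fun m hm => ?_
  rw [MvPolynomial.pderiv_monomial]
  by_cases h : m i = 0
  · simp [h]
  refine (MvPolynomial.totalDegree_monomial_le _ _).trans ?_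
  have h1 : m.degree ≤ P.totalDegree := MvPolynomial.le_totalDegree hm
  have h2 : (m - Finsupp.single i 1) + Finsupp.single i 1 = m :=
    tsub_add_cancel_of_le (by
      rw [Finsupp.single_le_iff]; omega)
  have h3 := congrArg Finsupp.degree h2
  rw [map_add, Finsupp.degree_single] at h3
  have h4 : (m - Finsupp.single i 1).degree ≤ P.totalDegree - 1 := by omega
  exact h4

lemma planarPoly_monomial (m : Fin 3 →₀ ℕ) (c : ℝ) :
    planarPoly (MvPolynomial.monomial m c) =
      Polynomial.C (Polynomial.C (c * 0 ^ m 2) * Polynomial.X ^ m 0) * Polynomial.X ^ m 1 := by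
  rw [planarPoly, MvPolynomial.aeval_monomial, Finsupp.prod_fintype _ _ (by simp),
    Fin.prod_univ_three]
  simp only [Matrix.cons_val_zero, Matrix.cons_val_one, Matrix.cons_val, Polynomial.C_mul,
    Polynomial.C_0, Polynomial.algebraMap_apply, map_pow]
  simp only [Algebra.algebraMap_self, RingHom.id_apply]
  ring

lemma natDegree_planarPoly_le (P : MvPolynomial (Fin 3) ℝ) :
    (planarPoly P).natDegree ≤ P.totalDegree := by
  conv_lhs => rw [P.as_sum, map_sum]
  refine Polynomial.natDegree_sum_le_of_forall_le _ _ fun m hm => ?_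
  rw [planarPoly_monomial]
  refine (Polynomial.natDegree_C_mul_X_pow_le _ _).trans ?_
  exact (Finsupp.le_degree 1 m).trans (MvPolynomial.le_totalDegree hm)

lemma natDegree_coeff_planarPoly_le (P : MvPolynomial (Fin 3) ℝ) (i : ℕ) :
    ((planarPoly P).coeff i).natDegree ≤ P.totalDegree := by
  conv_lhs => rw [P.as_sum, map_sum, Polynomial.finsetSum_coeff]
  refine Polynomial.natDegree_sum_le_of_forall_le _ _ fun m hm => ?_
  rw [planarPoly_monomial, Polynomial.coeff_C_mul_X_pow]
  split_ifs
  · refine (Polynomial.natDegree_C_mul_X_pow_le _ _).trans ?_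
    exact (Finsupp.le_degree 0 m).trans (MvPolynomial.le_totalDegree hm)
  · simp

lemma degree_rootStrata_planarPoly_le {P : MvPolynomial (Fin 3) ℝ} {K : ℕ}
    (hP : P.totalDegree ≤ K) {r : Polynomial ℝ}
    (hr : r ∈ rootStrata (planarPoly P)) :
    r.natDegree ≤ (2 * K + 2) * (2 * K) := by
  have h1 : ∀ i, ((planarPoly P).coeff i).natDegree ≤ K := fun i =>
    (natDegree_coeff_planarPoly_le P i).trans hP
  have h2 := degree_rootStrata_le (R := Polynomial ℝ) (fun q => q.natDegree)
    (fun a b => Polynomial.natDegree_add_le a b)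
    (fun a b => Polynomial.natDegree_mul_le) (fun n => Polynomial.natDegree_intCast n)
    (planarPoly P) h1 hr
  refine h2.trans ?_
  have := (natDegree_planarPoly_le P).trans hP
  gcongr

lemma card_rootStrata_planarPoly_le {P : MvPolynomial (Fin 3) ℝ} {K : ℕ}
    (hP : P.totalDegree ≤ K) :
    (rootStrata (planarPoly P)).card ≤ (K + 2) ^ 2 := by
  refine (card_rootStrata_le _).trans ?_
  have := (natDegree_planarPoly_le P).trans hP
  gcongr

open Polynomial in
/-- One half of Thom's lemma: if all derivatives of a polynomial have the same signs at two points,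
then the polynomial has constant sign in between. -/
lemma sign_eval_eq_of_sign_iterate_derivative {a b : ℝ} (n : ℕ) :
    ∀ Q : ℝ[X], Q.natDegree ≤ n →
      (∀ k ≤ n, SignType.sign ((derivative^[k] Q).eval a) =
        SignType.sign ((derivative^[k] Q).eval b)) →
      ∀ u ∈ Set.Icc a b, SignType.sign (Q.eval u) = SignType.sign (Q.eval a) := by
  induction n with
  | zero =>
    intro Q hQ _ u _
    rw [eq_C_of_natDegree_eq_zero (Nat.le_zero.1 hQ), eval_C, eval_C]
  | succ n ih =>
    intro Q hQ h u hu
    have hab : a ≤ b := hu.1.trans hu.2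
    have hd := ih (derivative Q) ((natDegree_derivative_le Q).trans (by omega)) fun k hk => by
      have := h (k + 1) (by omega)
      rwa [Function.iterate_succ_apply] at this
    have h0 := h 0 (Nat.zero_le _)
    simp only [Function.iterate_zero, id] at h0
    rcases le_total 0 ((derivative Q).eval a) with hs | hs
    · have hm : MonotoneOn (fun t => Q.eval t) (Set.Icc a b) := by
        refine monotoneOn_of_deriv_nonneg (convex_Icc a b) Q.continuous.continuousOn
          Q.differentiable.differentiableOn fun t ht => ?_
        rw [Polynomial.deriv, ← sign_nonneg_iff, hd t (interior_subset ht), sign_nonneg_iff]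
        exact hs
      have h1 := hm ⟨le_rfl, hab⟩ hu hu.1
      have h2 := hm hu ⟨hab, le_rfl⟩ hu.2
      exact le_antisymm ((SignType.sign.monotone h2).trans h0.ge) (SignType.sign.monotone h1)
    · have hm : AntitoneOn (fun t => Q.eval t) (Set.Icc a b) := by
        refine antitoneOn_of_deriv_nonpos (convex_Icc a b) Q.continuous.continuousOn
          Q.differentiable.differentiableOn fun t ht => ?_
        rw [Polynomial.deriv, ← sign_nonpos_iff, hd t (interior_subset ht), sign_nonpos_iff]
        exact hs
      have h1 := hm ⟨le_rfl, hab⟩ hu hu.1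
      have h2 := hm hu ⟨hab, le_rfl⟩ hu.2
      exact le_antisymm (SignType.sign.monotone h1) (h0.le.trans (SignType.sign.monotone h2))

/-- A continuous function on a preconnected set which vanishes everywhere if it vanishes somewhere
has constant sign. -/
lemma IsPreconnected.sign_eq {T : Type*} [TopologicalSpace T] {E : Set T} (hE : IsPreconnected E)
    {f : T → ℝ} (hf : ContinuousOn f E) (h0 : ∀ p ∈ E, ∀ q ∈ E, f p = 0 → f q = 0) {p q : T}
    (hp : p ∈ E) (hq : q ∈ E) : SignType.sign (f p) = SignType.sign (f q) := by
  wlog hle : f p ≤ f q generalizing p q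
  · exact (this hq hp (not_le.1 hle).le).symm
  by_cases hz : ∃ r ∈ E, f r = 0
  · obtain ⟨r, hr, hr0⟩ := hz
    rw [h0 r hr p hp hr0, h0 r hr q hq hr0]
  · push Not at hz
    rcases lt_or_gt_of_ne (hz p hp) with hp0 | hp0
    · rcases lt_or_gt_of_ne (hz q hq) with hq0 | hq0
      · rw [sign_neg hp0, sign_neg hq0]
      · obtain ⟨r, hr, hr0⟩ := hE.intermediate_value hp hq hf ⟨hp0.le, hq0.le⟩
        exact absurd hr0 (hz r hr)
    · rw [sign_pos hp0, sign_pos (hp0.trans_le hle)]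

/-- A set over a preconnected base, with preconnected fibers in `ℝ` and a continuous section, is
preconnected. -/
lemma isPreconnected_of_section {T : Type*} [TopologicalSpace T] {s : Set T}
    (hs : IsPreconnected s) {E : Set (T × ℝ)} (hEs : ∀ p ∈ E, p.1 ∈ s)
    (hE : ∀ t ∈ s, {y | (t, y) ∈ E}.OrdConnected) {f : T → ℝ} (hf : ContinuousOn f s)
    (hfE : ∀ t ∈ s, (t, f t) ∈ E) : IsPreconnected E := by
  rcases s.eq_empty_or_nonempty with rfl | ⟨t₀, ht₀⟩
  · have : E = ∅ := by
      ext p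
      simp only [Set.mem_empty_iff_false, iff_false]
      exact fun hp => hEs p hp
    rw [this]
    exact isPreconnected_empty
  have hgraph : IsPreconnected ((fun t => (t, f t)) '' s) :=
    hs.image _ (continuousOn_id.prodMk hf)
  refine isPreconnected_of_forall (t₀, f t₀) fun p hp => ?_
  have hfib : IsPreconnected ((fun y : ℝ => (p.1, y)) '' {y | (p.1, y) ∈ E}) :=
    ((hE p.1 (hEs p hp)).isPreconnected).image _ (by fun_prop)
  refine ⟨(fun t => (t, f t)) '' s ∪ (fun y : ℝ => (p.1, y)) '' {y | (p.1, y) ∈ E},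
    Set.union_subset ?_ ?_, Or.inl ⟨t₀, ht₀, rfl⟩, Or.inr ?_,
    IsPreconnected.union (p.1, f p.1) ?_ ?_ hgraph hfib⟩
  · rintro _ ⟨t, ht, rfl⟩
    exact hfE t ht
  · rintro _ ⟨y, hy, rfl⟩
    exact hy
  · exact ⟨p.2, hp, rfl⟩
  · exact ⟨p.1, hEs p hp, rfl⟩
  · exact ⟨f p.1, hfE p.1 (hEs p hp), rfl⟩

open Classical in
/-- The product of the members of `𝒜` which do not vanish identically on the plane `z = 0`. -/
noncomputable def planarProd (𝒜 : Finset (MvPolynomial (Fin 3) ℝ)) : MvPolynomial (Fin 3) ℝ :=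
  ∏ g ∈ 𝒜.filter (planarPoly · ≠ 0), g

open Classical in
/-- The abscissas at which the arrangement of the curves of `𝒜` changes. -/
noncomputable def columnBreaks (𝒜 : Finset (MvPolynomial (Fin 3) ℝ)) : Finset ℝ :=
  (insert (planarProd 𝒜) 𝒜).biUnion fun g =>
    (rootStrata (planarPoly g)).biUnion fun r => r.roots.toFinset

open Classical in
/-- The ordinates of the points of the curves of `𝒜` above `x`. -/
noncomputable def stackRoots (𝒜 : Finset (MvPolynomial (Fin 3) ℝ)) (x : ℝ) : Finset ℝ :=
  𝒜.biUnion fun g => (planarSlice g x).roots.toFinset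

/-- The label of the cell of the cylindrical decomposition adapted to `𝒜` containing `p`. -/
noncomputable def cellCode (𝒜 : Finset (MvPolynomial (Fin 3) ℝ)) (p : ℝ × ℝ) : ℕ × ℕ :=
  (rankCode (columnBreaks 𝒜) p.1, rankCode (stackRoots 𝒜 p.1) p.2)

lemma mem_stackRoots {𝒜 : Finset (MvPolynomial (Fin 3) ℝ)} {x t : ℝ} :
    t ∈ stackRoots 𝒜 x ↔ ∃ g ∈ 𝒜, planarSlice g x ≠ 0 ∧ planarEval g (x, t) = 0 := by
  classical
  simp only [stackRoots, Finset.mem_biUnion, Multiset.mem_toFinset, Polynomial.mem_roots',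
    Polynomial.IsRoot.def, ← eval_planarSlice]

lemma mem_columnBreaks {𝒜 : Finset (MvPolynomial (Fin 3) ℝ)} {P : MvPolynomial (Fin 3) ℝ}
    (hP : P = planarProd 𝒜 ∨ P ∈ 𝒜) {r : Polynomial ℝ} (hr : r ∈ rootStrata (planarPoly P))
    (hr0 : r ≠ 0) {x : ℝ} (hx : r.eval x = 0) : x ∈ columnBreaks 𝒜 := by
  classical
  exact Finset.mem_biUnion.2 ⟨P, Finset.mem_insert.2 hP, Finset.mem_biUnion.2
    ⟨r, hr, Multiset.mem_toFinset.2 ((Polynomial.mem_roots hr0).2 hx)⟩⟩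

lemma eval_rootStrata_iff {𝒜 : Finset (MvPolynomial (Fin 3) ℝ)} {P : MvPolynomial (Fin 3) ℝ}
    (hP : P = planarProd 𝒜 ∨ P ∈ 𝒜) {x x' : ℝ}
    (hx : rankCode (columnBreaks 𝒜) x = rankCode (columnBreaks 𝒜) x') :
    ∀ r ∈ rootStrata (planarPoly P),
      Polynomial.evalRingHom x r = 0 ↔ Polynomial.evalRingHom x' r = 0 := by
  intro r hr
  rcases eq_or_ne x x' with rfl | hne
  · rfl
  rcases eq_or_ne r 0 with rfl | hr0
  · simp
  have h1 : r.eval x ≠ 0 := fun h => notMem_of_rankCode_eq hx hne Set.left_mem_uIcc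
    (mem_columnBreaks hP hr hr0 h)
  have h2 : r.eval x' ≠ 0 := fun h => notMem_of_rankCode_eq hx hne Set.right_mem_uIcc
    (mem_columnBreaks hP hr hr0 h)
  simp [h1, h2]

lemma planarSlice_eq_zero_iff {𝒜 : Finset (MvPolynomial (Fin 3) ℝ)} {P : MvPolynomial (Fin 3) ℝ}
    (hP : P ∈ 𝒜) {x x' : ℝ}
    (hx : rankCode (columnBreaks 𝒜) x = rankCode (columnBreaks 𝒜) x') :
    planarSlice P x = 0 ↔ planarSlice P x' = 0 :=
  map_eq_zero_iff_of_rootStrata _ (eval_rootStrata_iff (Or.inr hP) hx)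

lemma planarSlice_ne_zero {𝒜 : Finset (MvPolynomial (Fin 3) ℝ)} {P : MvPolynomial (Fin 3) ℝ}
    (hP : P = planarProd 𝒜 ∨ P ∈ 𝒜) (hP0 : planarPoly P ≠ 0) {x x' : ℝ} (hne : x ≠ x')
    (hx : rankCode (columnBreaks 𝒜) x = rankCode (columnBreaks 𝒜) x') : planarSlice P x ≠ 0 := by
  intro h
  have h1 : ((planarPoly P).leadingCoeff).eval x = 0 := by
    have := congrArg (fun Q : Polynomial ℝ => Q.coeff (planarPoly P).natDegree) h
    simpa [planarSlice] using this
  exact notMem_of_rankCode_eq hx hne Set.left_mem_uIcc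
    (mem_columnBreaks hP (leadingCoeff_mem_rootStrata _) (Polynomial.leadingCoeff_ne_zero.2 hP0) h1)

instance preconnectedSpace_column (A : Finset ℝ) (i : ℕ) :
    PreconnectedSpace {x // rankCode A x = i} :=
  Subtype.preconnectedSpace (ordConnected_rankCode A i).isPreconnected

lemma exists_continuous_sliceRoots {𝒜 : Finset (MvPolynomial (Fin 3) ℝ)}
    {P : MvPolynomial (Fin 3) ℝ} (hP : P = planarProd 𝒜 ∨ P ∈ 𝒜) (i : ℕ)
    (h0 : ∀ x, rankCode (columnBreaks 𝒜) x = i → planarSlice P x ≠ 0) :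
    ∃ (s : ℕ) (ξ : Fin s → {x // rankCode (columnBreaks 𝒜) x = i} → ℝ),
      (∀ k, Continuous (ξ k)) ∧ (∀ x, StrictMono fun k => ξ k x) ∧
      ∀ x t, planarEval P (x.1, t) = 0 ↔ ∃ k, ξ k x = t := by
  obtain ⟨s, ξ, h1, h2, h3⟩ := exists_continuous_roots
    (fun x : {x // rankCode (columnBreaks 𝒜) x = i} => planarSlice P x.1)
    (fun k => by
      simp only [planarSlice, Polynomial.coeff_map, Polynomial.coe_evalRingHom]
      exact (Polynomial.continuous _).comp continuous_subtype_val)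
    (fun x => h0 x.1 x.2)
    (fun x x' => natDegree_map_eq_of_rootStrata _ (eval_rootStrata_iff hP (x.2.trans x'.2.symm)))
    (fun x x' => card_complexRoots_map_eq_of_rootStrata _
      (eval_rootStrata_iff hP (x.2.trans x'.2.symm)) (h0 x.1 x.2) (h0 x'.1 x'.2))
  refine ⟨s, ξ, h1, h2, fun x t => ?_⟩
  rw [← h3, ← eval_planarSlice]

lemma exists_continuous_stackRoots (𝒜 : Finset (MvPolynomial (Fin 3) ℝ)) (i : ℕ) :
    ∃ (s : ℕ) (ξ : Fin s → {x // rankCode (columnBreaks 𝒜) x = i} → ℝ),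
      (∀ k, Continuous (ξ k)) ∧ (∀ x, StrictMono fun k => ξ k x) ∧
      ∀ x t, t ∈ stackRoots 𝒜 x.1 ↔ ∃ k, ξ k x = t := by
  classical
  rcases subsingleton_or_nontrivial {x // rankCode (columnBreaks 𝒜) x = i} with hC | hC
  · rcases isEmpty_or_nonempty {x // rankCode (columnBreaks 𝒜) x = i} with hC' | ⟨⟨x₀⟩⟩
    · exact ⟨0, fun k => k.elim0, fun k => k.elim0, fun x => isEmptyElim x, fun x => isEmptyElim x⟩
    · refine ⟨_, fun k _ => (stackRoots 𝒜 x₀.1).orderEmbOfFin rfl k, fun k => continuous_const,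
        fun x => ((stackRoots 𝒜 x₀.1).orderEmbOfFin rfl).strictMono, fun x t => ?_⟩
      rw [Subsingleton.elim x x₀]
      have := Finset.range_orderEmbOfFin (stackRoots 𝒜 x₀.1) rfl
      rw [← Finset.mem_coe, ← this, Set.mem_range]
  · have hne : ∀ x : ℝ, rankCode (columnBreaks 𝒜) x = i → ∀ P, (P = planarProd 𝒜 ∨ P ∈ 𝒜) →
        planarPoly P ≠ 0 → planarSlice P x ≠ 0 := by
      intro x hx P hP hP0
      obtain ⟨x', hx'⟩ := exists_ne (⟨x, hx⟩ : {x // rankCode (columnBreaks 𝒜) x = i})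
      refine planarSlice_ne_zero hP hP0 (x' := x'.1) (fun h => hx' (Subtype.ext h.symm)) ?_
      rw [hx, x'.2]
    have hG : planarPoly (planarProd 𝒜) ≠ 0 := by
      rw [planarProd, map_prod, Finset.prod_ne_zero_iff]
      exact fun g hg => (Finset.mem_filter.1 hg).2
    obtain ⟨s, ξ, h1, h2, h3⟩ := exists_continuous_sliceRoots (𝒜 := 𝒜) (Or.inl rfl) i
      fun x hx => hne x hx _ (Or.inl rfl) hG
    refine ⟨s, ξ, h1, h2, fun x t => ?_⟩
    rw [← h3, mem_stackRoots, planarProd, planarEval, map_prod, Finset.prod_eq_zero_iff]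
    constructor
    · rintro ⟨g, hg, hg0, hgt⟩
      refine ⟨g, Finset.mem_filter.2 ⟨hg, fun h => hg0 ?_⟩, hgt⟩
      rw [planarSlice, h, Polynomial.map_zero]
    · rintro ⟨g, hg, hgt⟩
      rw [Finset.mem_filter] at hg
      exact ⟨g, hg.1, hne x.1 x.2 g (Or.inr hg.1) hg.2, hgt⟩

/-- Every cell has a continuous section over its column. -/
lemma exists_section_cellCode (𝒜 : Finset (MvPolynomial (Fin 3) ℝ)) (p : ℝ × ℝ) :
    ∃ f : ℝ → ℝ, ContinuousOn f {x | rankCode (columnBreaks 𝒜) x = (cellCode 𝒜 p).1} ∧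
      ∀ x, rankCode (columnBreaks 𝒜) x = (cellCode 𝒜 p).1 →
        cellCode 𝒜 (x, f x) = cellCode 𝒜 p := by
  classical
  obtain ⟨s, ξ, h1, h2, h3⟩ := exists_continuous_stackRoots 𝒜 (cellCode 𝒜 p).1
  obtain ⟨f, hf, hfc⟩ := exists_continuous_rankCode_eq ξ h1 h2 (fun x => stackRoots 𝒜 x.1) h3
    (c₀ := ⟨p.1, rfl⟩) (t₀ := p.2)
  refine ⟨fun x => if hx : rankCode (columnBreaks 𝒜) x = (cellCode 𝒜 p).1 then f ⟨x, hx⟩ else 0,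
    ?_, fun x hx => ?_⟩
  · rw [continuousOn_iff_continuous_domRestrict]
    refine hf.congr fun x => ?_
    have hx : rankCode (columnBreaks 𝒜) x.1 = (cellCode 𝒜 p).1 := x.2
    simp only [Set.domRestrict_apply, dif_pos hx]
  · simp only [dif_pos hx]
    exact Prod.ext hx (hfc ⟨x, hx⟩)

lemma ordConnected_cellCode (𝒜 : Finset (MvPolynomial (Fin 3) ℝ)) (c : ℕ × ℕ) (x : ℝ) :
    {y | cellCode 𝒜 (x, y) = c}.OrdConnected := by
  refine ⟨fun t ht u hu v hv => ?_⟩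
  rw [Set.mem_ofPred_eq] at ht hu ⊢
  have h1 := (ordConnected_rankCode (stackRoots 𝒜 x) c.2).out
    (congrArg Prod.snd ht) (congrArg Prod.snd hu) hv
  exact Prod.ext (congrArg Prod.fst ht :) h1

lemma isPreconnected_cellCode (𝒜 : Finset (MvPolynomial (Fin 3) ℝ)) (c : ℕ × ℕ) :
    IsPreconnected {p | cellCode 𝒜 p = c} := by
  rcases Set.eq_empty_or_nonempty {p | cellCode 𝒜 p = c} with h | ⟨p, hp⟩
  · rw [h]
    exact isPreconnected_empty
  rw [Set.mem_ofPred_eq] at hp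
  subst hp
  obtain ⟨f, hf, hfc⟩ := exists_section_cellCode 𝒜 p
  exact isPreconnected_of_section (ordConnected_rankCode _ _).isPreconnected
    (fun q hq => congrArg Prod.fst hq) (fun x _ => ordConnected_cellCode 𝒜 _ x) hf hfc

lemma planarEval_eq_zero_of_cellCode_eq {𝒜 : Finset (MvPolynomial (Fin 3) ℝ)}
    {g : MvPolynomial (Fin 3) ℝ} (hg : g ∈ 𝒜) {p q : ℝ × ℝ} (h : cellCode 𝒜 p = cellCode 𝒜 q)
    (hp : planarEval g p = 0) : planarEval g q = 0 := by
  have hx : rankCode (columnBreaks 𝒜) p.1 = rankCode (columnBreaks 𝒜) q.1 := congrArg Prod.fst h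
  have hy : rankCode (stackRoots 𝒜 p.1) p.2 = rankCode (stackRoots 𝒜 q.1) q.2 :=
    congrArg Prod.snd h
  by_cases h0 : planarSlice g p.1 = 0
  · rw [← eval_planarSlice, (planarSlice_eq_zero_iff hg hx).1 h0, Polynomial.eval_zero]
  have h0' : ∀ x, rankCode (columnBreaks 𝒜) x = rankCode (columnBreaks 𝒜) p.1 →
      planarSlice g x ≠ 0 := fun x hx' hz => h0 ((planarSlice_eq_zero_iff hg hx').1 hz)
  obtain ⟨s, ξ, hξ1, hξ2, hξ3⟩ := exists_continuous_stackRoots 𝒜 (rankCode (columnBreaks 𝒜) p.1)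
  obtain ⟨t, ζ, hζ1, hζ2, hζ3⟩ := exists_continuous_sliceRoots (Or.inr hg)
    (rankCode (columnBreaks 𝒜) p.1) h0'
  obtain ⟨l, hl⟩ := (hζ3 ⟨p.1, rfl⟩ p.2).1 hp
  have hζR : ∀ c, ∃ k, ξ k c = ζ l c := fun c => by
    rw [← hξ3, mem_stackRoots]
    exact ⟨g, hg, h0' _ c.2, (hζ3 c _).2 ⟨l, rfl⟩⟩
  obtain ⟨k, hk⟩ := hζR ⟨p.1, rfl⟩
  have hk' := exists_index_of_continuous ξ hξ1 hξ2 (hζ1 l) hζR ⟨p.1, rfl⟩ ⟨q.1, hx.symm⟩ k hk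
  have hcp := rankCode_strictMono (hξ2 ⟨p.1, rfl⟩) (hξ3 ⟨p.1, rfl⟩) k
  have hcq := rankCode_strictMono (hξ2 ⟨q.1, hx.symm⟩) (hξ3 ⟨q.1, hx.symm⟩) k
  rw [hk, hl] at hcp
  have hq2 : q.2 = ξ k ⟨q.1, hx.symm⟩ := by
    by_contra hne
    exact notMem_of_rankCode_eq (hy.symm.trans (hcp.trans hcq.symm)) hne Set.right_mem_uIcc
      ((hξ3 ⟨q.1, hx.symm⟩ _).2 ⟨k, rfl⟩)
  have := (hζ3 ⟨q.1, hx.symm⟩ q.2).2 ⟨l, by rw [hq2, hk']⟩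
  exact this

/-- The members of `𝒜` have constant sign on each cell. -/
lemma sign_planarEval_eq_of_cellCode_eq {𝒜 : Finset (MvPolynomial (Fin 3) ℝ)}
    {g : MvPolynomial (Fin 3) ℝ} (hg : g ∈ 𝒜) {p q : ℝ × ℝ} (h : cellCode 𝒜 p = cellCode 𝒜 q) :
    SignType.sign (planarEval g p) = SignType.sign (planarEval g q) :=
  (isPreconnected_cellCode 𝒜 (cellCode 𝒜 p)).sign_eq (continuous_planarEval g).continuousOn
    (fun _ hp' _ hq' h0 => planarEval_eq_zero_of_cellCode_eq hg (hp'.trans hq'.symm) h0) rfl h.symm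

/-- A preconnected set on which the members of `𝒜` and the abscissas relative to the breaks have
constant signs lies in a single cell. -/
lemma cellCode_eq_of_isPreconnected {𝒜 : Finset (MvPolynomial (Fin 3) ℝ)} {E : Set (ℝ × ℝ)}
    (hE : IsPreconnected E)
    (h𝒜 : ∀ g ∈ 𝒜, ∀ p ∈ E, ∀ q ∈ E, planarEval g p = 0 → planarEval g q = 0)
    (hX : ∀ r ∈ columnBreaks 𝒜, ∀ p ∈ E, ∀ q ∈ E, p.1 = r → q.1 = r) {p q : ℝ × ℝ}
    (hp : p ∈ E) (hq : q ∈ E) : cellCode 𝒜 p = cellCode 𝒜 q := by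
  have hx : ∀ p ∈ E, ∀ q ∈ E,
      rankCode (columnBreaks 𝒜) p.1 = rankCode (columnBreaks 𝒜) q.1 := by
    intro p hp q hq
    obtain ⟨S, hS, -, h⟩ := exists_rankCode_witness (columnBreaks 𝒜) q.1
    refine h p.1 fun r hr => ?_
    refine hE.sign_eq (f := fun z => z.1 - r) (by fun_prop) (fun z hz w hw h0 => ?_) hp hq
    rw [hX r (hS hr) z hz w hw (sub_eq_zero.1 h0), sub_self]
  refine Prod.ext (hx p hp q hq) ?_
  obtain ⟨s, ξ, hξ1, hξ2, hξ3⟩ := exists_continuous_stackRoots 𝒜 (rankCode (columnBreaks 𝒜) p.1)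
  have hcol : ∀ z : E, rankCode (columnBreaks 𝒜) z.1.1 = rankCode (columnBreaks 𝒜) p.1 :=
    fun z => hx _ z.2 _ hp
  set π : E → {x // rankCode (columnBreaks 𝒜) x = rankCode (columnBreaks 𝒜) p.1} :=
    fun z => ⟨z.1.1, hcol z⟩ with hπ
  have hπc : Continuous π := by fun_prop
  have hEc : PreconnectedSpace E := Subtype.preconnectedSpace hE
  have hon : ∀ z w : E, z.1.2 ∈ stackRoots 𝒜 z.1.1 → w.1.2 ∈ stackRoots 𝒜 w.1.1 := by
    intro z w hz
    rw [mem_stackRoots] at hz ⊢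
    obtain ⟨g, hg, hg0, hgz⟩ := hz
    exact ⟨g, hg, fun h => hg0 ((planarSlice_eq_zero_iff hg (hx _ z.2 _ w.2)).2 h),
      h𝒜 g hg _ z.2 _ w.2 hgz⟩
  by_cases h : p.2 ∈ stackRoots 𝒜 p.1
  · have hidx : ∀ z : E, ∃ k, ξ k (π z) = z.1.2 := fun z =>
      (hξ3 (π z) _).1 (hon ⟨p, hp⟩ z h)
    obtain ⟨k, hk⟩ := hidx ⟨p, hp⟩
    have hk' := exists_index_of_continuous (fun k z => ξ k (π z)) (fun k => (hξ1 k).comp hπc)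
      (fun z => hξ2 (π z)) (f := fun z : E => z.1.2) (by fun_prop) hidx ⟨p, hp⟩ ⟨q, hq⟩ k hk
    have h1 := rankCode_strictMono (hξ2 (π ⟨p, hp⟩)) (hξ3 (π ⟨p, hp⟩)) k
    have h2 := rankCode_strictMono (hξ2 (π ⟨q, hq⟩)) (hξ3 (π ⟨q, hq⟩)) k
    rw [hk] at h1
    rw [hk'] at h2
    exact h1.trans h2.symm
  · have h' : ∀ z : E, z.1.2 ∉ stackRoots 𝒜 z.1.1 := fun z hz => h (hon z ⟨p, hp⟩ hz)
    have h1 := rankCode_eq_of_strictMono (hξ2 (π ⟨p, hp⟩)) (hξ3 (π ⟨p, hp⟩)) (h' ⟨p, hp⟩)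
    have h2 := rankCode_eq_of_strictMono (hξ2 (π ⟨q, hq⟩)) (hξ3 (π ⟨q, hq⟩)) (h' ⟨q, hq⟩)
    refine h1.trans (Eq.trans ?_ h2.symm)
    congr 2
    ext k
    simp only [Finset.mem_filter, Finset.mem_univ, true_and]
    have := isPreconnected_univ.sign_eq (E := (Set.univ : Set E))
      (f := fun z => z.1.2 - ξ k (π z))
      ((by fun_prop : Continuous fun z : E => z.1.2).sub ((hξ1 k).comp hπc)).continuousOn
      (fun z _ w _ h0 => absurd ((hξ3 (π z) _).2 ⟨k, (sub_eq_zero.1 h0).symm⟩) (h' z))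
      (Set.mem_univ ⟨p, hp⟩) (Set.mem_univ ⟨q, hq⟩)
    have h3 : 0 < p.2 - ξ k (π ⟨p, hp⟩) ↔ 0 < q.2 - ξ k (π ⟨q, hq⟩) := by
      rw [← sign_eq_one_iff, ← sign_eq_one_iff]
      exact ⟨fun h => this.symm.trans h, fun h => this.trans h⟩
    rw [sub_pos, sub_pos] at h3
    exact h3

/-- Members of `𝒜` separating a cell from the curve of code `a` in the same column. -/
lemma exists_separating_derivatives {𝒜 : Finset (MvPolynomial (Fin 3) ℝ)} {K : ℕ}
    (hK : ∀ g ∈ 𝒜, g.totalDegree ≤ K) (hd : ∀ g ∈ 𝒜, MvPolynomial.pderiv 1 g ∈ 𝒜) (i a : ℕ) :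
    ∃ S ⊆ 𝒜, S.card ≤ K + 1 ∧ ∀ x r y y', cellCode 𝒜 (x, r) = (i, a) → r ∈ stackRoots 𝒜 x →
      y < y' → r ∈ Set.Icc y y' → ¬ ∀ g ∈ S, SignType.sign (planarEval g (x, y)) =
        SignType.sign (planarEval g (x, y')) := by
  classical
  by_cases h : ∃ x r, cellCode 𝒜 (x, r) = (i, a) ∧ r ∈ stackRoots 𝒜 x
  · obtain ⟨x₁, r₁, hc, hr₁⟩ := h
    obtain ⟨g, hg, hg0, hgr⟩ := mem_stackRoots.1 hr₁
    have hit : ∀ k, ((MvPolynomial.pderiv 1)^[k] g) ∈ 𝒜 := by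
      intro k
      induction k with
      | zero => exact hg
      | succ k ih => rw [Function.iterate_succ_apply']; exact hd _ ih
    have hsl : ∀ x k, planarSlice ((MvPolynomial.pderiv 1)^[k] g) x =
        Polynomial.derivative^[k] (planarSlice g x) := by
      intro x k
      induction k with
      | zero => rfl
      | succ k ih =>
        rw [Function.iterate_succ_apply', Function.iterate_succ_apply', planarSlice_pderiv, ih]
    refine ⟨(Finset.range (K + 1)).image fun k => (MvPolynomial.pderiv 1)^[k] g, ?_, ?_, ?_⟩
    · intro f hf
      obtain ⟨k, -, rfl⟩ := Finset.mem_image.1 hf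
      exact hit k
    · exact Finset.card_image_le.trans (by simp)
    · intro x r y y' hxr _ hy hr hs
      have hxx : rankCode (columnBreaks 𝒜) x = rankCode (columnBreaks 𝒜) x₁ :=
        congrArg Prod.fst (hxr.trans hc.symm)
      have hsx : planarSlice g x ≠ 0 := fun h => hg0 ((planarSlice_eq_zero_iff hg hxx).1 h)
      have hgx : planarEval g (x, r) = 0 :=
        planarEval_eq_zero_of_cellCode_eq hg (hc.trans hxr.symm) hgr
      have hdeg : (planarSlice g x).natDegree ≤ K :=
        Polynomial.natDegree_map_le.trans ((natDegree_planarPoly_le g).trans (hK g hg))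
      have hthom := sign_eval_eq_of_sign_iterate_derivative K (planarSlice g x) hdeg
        (a := y) (b := y') fun k hk => by
          rw [← hsl]
          have := hs _ (Finset.mem_image_of_mem _ (Finset.mem_range.2 (Nat.lt_succ_of_le hk)))
          rwa [← eval_planarSlice, ← eval_planarSlice] at this
      have hz : ∀ u ∈ Set.Icc y y', (planarSlice g x).eval u = 0 := by
        intro u hu
        rw [← sign_eq_zero_iff, hthom u hu, ← hthom r hr, sign_eq_zero_iff]
        exact (eval_planarSlice g (x, r)).trans hgx
      exact hsx (Polynomial.eq_zero_of_infinite_isRoot _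
        ((Set.Icc_infinite hy).mono fun u hu => hz u hu))
  · refine ⟨∅, by simp, by simp, fun x r y y' hxr hr _ _ => ?_⟩
    exact absurd ⟨x, r, hxr, hr⟩ h

/-- Each cell is described by the signs of boundedly many polynomials. -/
lemma exists_sign_description_cellCode {𝒜 : Finset (MvPolynomial (Fin 3) ℝ)} {K : ℕ}
    (hK : ∀ g ∈ 𝒜, g.totalDegree ≤ K) (hd : ∀ g ∈ 𝒜, MvPolynomial.pderiv 1 g ∈ 𝒜) (p : ℝ × ℝ) :
    ∃ S : Finset (MvPolynomial (Fin 3) ℝ), S.card ≤ 2 * K + 4 ∧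
      (∀ g ∈ S, g.totalDegree ≤ K + 1) ∧ ∀ q, cellCode 𝒜 q = cellCode 𝒜 p ↔
        ∀ g ∈ S, SignType.sign (planarEval g q) = SignType.sign (planarEval g p) := by
  classical
  obtain ⟨X, hX, hXc, hXw⟩ := exists_rankCode_witness (columnBreaks 𝒜) p.1
  set j := (cellCode 𝒜 p).2 with hj
  obtain ⟨S, hS, hSc, hSs⟩ := exists_separating_derivatives hK hd (cellCode 𝒜 p).1
    (2 * (j / 2) + 1)
  obtain ⟨T, hT, hTc, hTs⟩ := exists_separating_derivatives hK hd (cellCode 𝒜 p).1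
    (2 * ((j - 1) / 2) + 1)
  have hlin : ∀ (r : ℝ) (z : ℝ × ℝ),
      planarEval (MvPolynomial.X 0 - MvPolynomial.C r) z = z.1 - r := by
    intro r z
    simp [planarEval]
  refine ⟨X.image (fun r => MvPolynomial.X 0 - MvPolynomial.C r) ∪ (S ∪ T), ?_, ?_, ?_⟩
  · have h1 := Finset.card_union_le
      (X.image (fun r => (MvPolynomial.X 0 - MvPolynomial.C r : MvPolynomial (Fin 3) ℝ))) (S ∪ T)
    have h2 := Finset.card_union_le S T
    have h3 := Finset.card_image_le (s := X)
      (f := fun r => (MvPolynomial.X 0 - MvPolynomial.C r : MvPolynomial (Fin 3) ℝ))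
    omega
  · intro g hg
    rcases Finset.mem_union.1 hg with hg | hg
    · obtain ⟨r, -, rfl⟩ := Finset.mem_image.1 hg
      refine (MvPolynomial.totalDegree_sub _ _).trans ?_
      simp
    · rcases Finset.mem_union.1 hg with hg | hg
      · exact (hK g (hS hg)).trans (Nat.le_succ K)
      · exact (hK g (hT hg)).trans (Nat.le_succ K)
  · intro q
    constructor
    · intro h g hg
      rcases Finset.mem_union.1 hg with hg | hg
      · obtain ⟨r, hr, rfl⟩ := Finset.mem_image.1 hg
        rw [hlin, hlin]
        have hx : rankCode (columnBreaks 𝒜) q.1 = rankCode (columnBreaks 𝒜) p.1 :=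
          congrArg Prod.fst h
        rcases eq_or_ne q.1 p.1 with he | hne
        · rw [he]
        have hno : ∀ u ∈ Set.uIcc q.1 p.1, u - r ≠ 0 := fun u hu h0 =>
          notMem_of_rankCode_eq hx hne hu (sub_eq_zero.1 h0 ▸ hX hr)
        exact isPreconnected_uIcc.sign_eq (f := fun u => u - r) (by fun_prop)
          (fun u hu _ _ h0 => absurd h0 (hno u hu)) Set.left_mem_uIcc Set.right_mem_uIcc
      · have hg' : g ∈ 𝒜 := by
          rcases Finset.mem_union.1 hg with hg | hg
          · exact hS hg
          · exact hT hg
        exact sign_planarEval_eq_of_cellCode_eq hg' h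
    · intro h
      have hx : rankCode (columnBreaks 𝒜) q.1 = (cellCode 𝒜 p).1 := by
        refine hXw q.1 fun r hr => ?_
        have := h _ (Finset.mem_union_left _ (Finset.mem_image_of_mem _ hr))
        rwa [hlin, hlin] at this
      obtain ⟨f, -, hf⟩ := exists_section_cellCode 𝒜 p
      have hfq := hf q.1 hx
      have hf2 : rankCode (stackRoots 𝒜 q.1) (f q.1) = j := congrArg Prod.snd hfq
      have hsig : ∀ g ∈ S ∪ T, SignType.sign (planarEval g (q.1, q.2)) =
          SignType.sign (planarEval g (q.1, f q.1)) := by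
        intro g hg
        have hg' : g ∈ 𝒜 := by
          rcases Finset.mem_union.1 hg with hg | hg
          · exact hS hg
          · exact hT hg
        rw [sign_planarEval_eq_of_cellCode_eq hg' hfq]
        exact h g (Finset.mem_union_right _ hg)
      refine Prod.ext hx ?_
      by_contra hne
      rcases lt_or_gt_of_ne hne with hlt | hgt
      · have hlt' : rankCode (stackRoots 𝒜 q.1) q.2 < rankCode (stackRoots 𝒜 q.1) (f q.1) := by
          rw [hf2]; exact hlt
        obtain ⟨r, hr, h1, h2, h3⟩ := exists_mem_of_lt_rankCode hlt'
        rw [hf2] at h3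
        refine hTs q.1 r q.2 (f q.1) (Prod.ext hx h3) hr ?_ ⟨h1, h2⟩ fun g hg =>
          hsig g (Finset.mem_union_right _ hg)
        by_contra hc
        exact absurd (rankCode_mono _ (not_lt.1 hc)) (not_le.2 hlt')
      · have hgt' : rankCode (stackRoots 𝒜 q.1) (f q.1) < rankCode (stackRoots 𝒜 q.1) q.2 := by
          rw [hf2]; exact hgt
        obtain ⟨r, hr, h1, h2, h3⟩ := exists_mem_of_rankCode_lt hgt'
        rw [hf2] at h3
        refine hSs q.1 r (f q.1) q.2 (Prod.ext hx h3) hr ?_ ⟨h1, h2⟩ fun g hg =>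
          (hsig g (Finset.mem_union_left _ hg)).symm
        by_contra hc
        exact absurd (rankCode_mono _ (not_lt.1 hc)) (not_le.2 hgt')

lemma card_columnBreaks_le {𝒜 : Finset (MvPolynomial (Fin 3) ℝ)} {K : ℕ}
    (hK : ∀ g ∈ 𝒜, g.totalDegree ≤ K) :
    (columnBreaks 𝒜).card ≤ 4 * (K + 2) ^ 4 * (𝒜.card + 1) ^ 5 := by
  classical
  set N := 𝒜.card with hN
  set L := K * (N + 1) with hL
  have hdeg : ∀ g ∈ insert (planarProd 𝒜) 𝒜, g.totalDegree ≤ L := by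
    intro g hg
    rcases Finset.mem_insert.1 hg with rfl | hg
    · refine (MvPolynomial.totalDegree_finsetProd _ _).trans ?_
      refine (Finset.sum_le_card_nsmul _ _ K fun g hg => hK g (Finset.mem_filter.1 hg).1).trans ?_
      rw [smul_eq_mul, mul_comm, hL]
      exact Nat.mul_le_mul_left K ((Finset.card_filter_le _ _).trans (Nat.le_succ _))
    · exact (hK g hg).trans (Nat.le_mul_of_pos_right K (Nat.succ_pos N))
  have h1 : (columnBreaks 𝒜).card ≤
      (insert (planarProd 𝒜) 𝒜).card * ((L + 2) ^ 2 * ((2 * L + 2) * (2 * L))) := by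
    refine Finset.card_biUnion_le_card_mul _ _ _ fun g hg => ?_
    refine (Finset.card_biUnion_le_card_mul _ _ ((2 * L + 2) * (2 * L)) fun r hr => ?_).trans
      (Nat.mul_le_mul_right _ (card_rootStrata_planarPoly_le (hdeg g hg)))
    exact (Multiset.toFinset_card_le _).trans ((Polynomial.card_roots' r).trans
      (degree_rootStrata_planarPoly_le (hdeg g hg) hr))
  have h2 : (L + 2) ^ 2 * ((2 * L + 2) * (2 * L)) ≤ 4 * (L + 2) ^ 4 := by
    calc (L + 2) ^ 2 * ((2 * L + 2) * (2 * L))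
        ≤ (L + 2) ^ 2 * ((2 * L + 4) * (2 * L + 4)) := by gcongr <;> omega
      _ = 4 * (L + 2) ^ 4 := by ring
  have h3 : L + 2 ≤ (K + 2) * (N + 1) := by rw [hL]; nlinarith
  calc (columnBreaks 𝒜).card
      ≤ (N + 1) * (4 * (L + 2) ^ 4) := h1.trans (Nat.mul_le_mul (Finset.card_insert_le _ _) h2)
    _ ≤ (N + 1) * (4 * ((K + 2) * (N + 1)) ^ 4) := by gcongr
    _ = 4 * (K + 2) ^ 4 * (N + 1) ^ 5 := by ring

lemma card_stackRoots_le {𝒜 : Finset (MvPolynomial (Fin 3) ℝ)} {K : ℕ}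
    (hK : ∀ g ∈ 𝒜, g.totalDegree ≤ K) (x : ℝ) : (stackRoots 𝒜 x).card ≤ 𝒜.card * K := by
  classical
  refine Finset.card_biUnion_le_card_mul _ _ _ fun g hg => ?_
  exact (Multiset.toFinset_card_le _).trans ((Polynomial.card_roots' _).trans
    (Polynomial.natDegree_map_le.trans ((natDegree_planarPoly_le g).trans (hK g hg))))

lemma totalDegree_iterate_pderiv_le (g : MvPolynomial (Fin 3) ℝ) (i : Fin 3) (k : ℕ) :
    ((MvPolynomial.pderiv i)^[k] g).totalDegree ≤ g.totalDegree - k := by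
  induction k with
  | zero => simp
  | succ k ih =>
    rw [Function.iterate_succ_apply']
    exact (totalDegree_pderiv_lt _ i).trans (by omega)

open Classical in
/-- The iterated `y`-derivatives of the members of `𝒜`, together with `0`. -/
noncomputable def derivClosure (K : ℕ) (𝒜 : Finset (MvPolynomial (Fin 3) ℝ)) :
    Finset (MvPolynomial (Fin 3) ℝ) :=
  insert 0 (𝒜.biUnion fun g => (Finset.range (K + 1)).image fun k => (MvPolynomial.pderiv 1)^[k] g)

lemma mem_derivClosure {K : ℕ} {𝒜 : Finset (MvPolynomial (Fin 3) ℝ)}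
    {f : MvPolynomial (Fin 3) ℝ} :
    f ∈ derivClosure K 𝒜 ↔ f = 0 ∨ ∃ g ∈ 𝒜, ∃ k ≤ K, (MvPolynomial.pderiv 1)^[k] g = f := by
  simp [derivClosure]

lemma subset_derivClosure (K : ℕ) (𝒜 : Finset (MvPolynomial (Fin 3) ℝ)) :
    𝒜 ⊆ derivClosure K 𝒜 :=
  fun g hg => mem_derivClosure.2 (Or.inr ⟨g, hg, 0, Nat.zero_le _, rfl⟩)

lemma card_derivClosure_le (K : ℕ) (𝒜 : Finset (MvPolynomial (Fin 3) ℝ)) :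
    (derivClosure K 𝒜).card ≤ 𝒜.card * (K + 1) + 1 := by
  classical
  refine (Finset.card_insert_le _ _).trans (Nat.succ_le_succ ?_)
  exact Finset.card_biUnion_le_card_mul _ _ _ fun g _ => Finset.card_image_le.trans (by simp)

lemma totalDegree_le_of_mem_derivClosure {K : ℕ} {𝒜 : Finset (MvPolynomial (Fin 3) ℝ)}
    (hK : ∀ g ∈ 𝒜, g.totalDegree ≤ K) {f : MvPolynomial (Fin 3) ℝ} (hf : f ∈ derivClosure K 𝒜) :
    f.totalDegree ≤ K := by
  rcases mem_derivClosure.1 hf with rfl | ⟨g, hg, k, -, rfl⟩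
  · simp
  · exact (totalDegree_iterate_pderiv_le g 1 k).trans ((Nat.sub_le _ _).trans (hK g hg))

lemma pderiv_mem_derivClosure {K : ℕ} {𝒜 : Finset (MvPolynomial (Fin 3) ℝ)}
    (hK : ∀ g ∈ 𝒜, g.totalDegree ≤ K) {f : MvPolynomial (Fin 3) ℝ} (hf : f ∈ derivClosure K 𝒜) :
    MvPolynomial.pderiv 1 f ∈ derivClosure K 𝒜 := by
  rcases mem_derivClosure.1 hf with rfl | ⟨g, hg, k, hk, rfl⟩
  · rw [map_zero]
    exact hf
  · rcases hk.lt_or_eq with hk | rfl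
    · exact mem_derivClosure.2 (Or.inr ⟨g, hg, k + 1, hk, Function.iterate_succ_apply' _ _ _⟩)
    · refine mem_derivClosure.2 (Or.inl ?_)
      have h := totalDegree_iterate_pderiv_le g 1 k
      have h0 : ((MvPolynomial.pderiv 1)^[k] g).totalDegree = 0 :=
        Nat.le_zero.1 (h.trans (by have := hK g hg; omega))
      rw [MvPolynomial.totalDegree_eq_zero_iff_eq_C.1 h0, MvPolynomial.pderiv_C]

/-- Cylindrical decomposition of the plane: connected sign-invariant cells of bounded description
complexity. -/
theorem exists_planar_cells (K : ℕ) :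
    ∃ C : ℕ, ∀ 𝒜 : Finset (MvPolynomial (Fin 3) ℝ), (∀ g ∈ 𝒜, g.totalDegree ≤ K) →
      ∃ 𝒞 : Finset (Set (ℝ × ℝ)), 𝒞.card ≤ C * (𝒜.card + 1) ^ 6 ∧
        (∀ E ∈ 𝒞, IsConnected E ∧
          (∀ g ∈ 𝒜, ∀ p ∈ E, ∀ q ∈ E,
            SignType.sign (planarEval g p) = SignType.sign (planarEval g q)) ∧
          ∃ S : Finset (MvPolynomial (Fin 3) ℝ), S.card ≤ 2 * K + 4 ∧
            (∀ g ∈ S, g.totalDegree ≤ K + 1) ∧ ∃ p, E = {q | ∀ g ∈ S,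
              SignType.sign (planarEval g q) = SignType.sign (planarEval g p)}) ∧
        (∀ E ∈ 𝒞, ∀ E' ∈ 𝒞, ∀ p, p ∈ E → p ∈ E' → E = E') ∧ ∀ p, ∃ E ∈ 𝒞, p ∈ E := by
  classical
  refine ⟨9 * (K + 2) ^ 4 * (2 * (K + 1)) * (K + 2) ^ 6, fun 𝒜 hK => ?_⟩
  set ℬ := derivClosure K 𝒜 with hℬ
  have hBK : ∀ g ∈ ℬ, g.totalDegree ≤ K := fun g hg => totalDegree_le_of_mem_derivClosure hK hg
  have hBd : ∀ g ∈ ℬ, MvPolynomial.pderiv 1 g ∈ ℬ := fun g hg => pderiv_mem_derivClosure hK hg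
  set codes := Finset.range (2 * (columnBreaks ℬ).card + 1) ×ˢ
    Finset.range (2 * (ℬ.card * K) + 1) with hcodes
  have hmem : ∀ p, cellCode ℬ p ∈ codes := fun p => by
    refine Finset.mem_product.2 ⟨Finset.mem_range.2 (rankCode_lt _ _),
      Finset.mem_range.2 ((rankCode_lt _ _).trans_le ?_)⟩
    have := card_stackRoots_le hBK p.1
    omega
  refine ⟨(codes.image fun c => {p | cellCode ℬ p = c}).filter Set.Nonempty, ?_, ?_, ?_, ?_⟩
  · have hN : ℬ.card + 1 ≤ (K + 2) * (𝒜.card + 1) := by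
      have := card_derivClosure_le K 𝒜
      rw [← hℬ] at this
      nlinarith
    have hX := card_columnBreaks_le hBK
    have hpos : 1 ≤ (K + 2) ^ 4 * (ℬ.card + 1) ^ 5 := Nat.pos_of_ne_zero (by positivity)
    calc _ ≤ codes.card := (Finset.card_filter_le _ _).trans Finset.card_image_le
      _ = (2 * (columnBreaks ℬ).card + 1) * (2 * (ℬ.card * K) + 1) := by
          rw [hcodes, Finset.card_product, Finset.card_range, Finset.card_range]
      _ ≤ (9 * ((K + 2) ^ 4 * (ℬ.card + 1) ^ 5)) * (2 * (K + 1) * (ℬ.card + 1)) := by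
          refine Nat.mul_le_mul ?_ ?_
          · rw [mul_assoc] at hX
            omega
          · nlinarith
      _ = 9 * (K + 2) ^ 4 * (2 * (K + 1)) * (ℬ.card + 1) ^ 6 := by ring
      _ ≤ 9 * (K + 2) ^ 4 * (2 * (K + 1)) * ((K + 2) * (𝒜.card + 1)) ^ 6 := by gcongr
      _ = _ := by ring
  · intro E hE
    obtain ⟨hE, hne⟩ := Finset.mem_filter.1 hE
    obtain ⟨c, -, rfl⟩ := Finset.mem_image.1 hE
    refine ⟨⟨hne, isPreconnected_cellCode ℬ c⟩, fun g hg p hp q hq => ?_, ?_⟩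
    · rw [Set.mem_ofPred_eq] at hp hq
      exact sign_planarEval_eq_of_cellCode_eq (subset_derivClosure K 𝒜 hg) (hp.trans hq.symm)
    · obtain ⟨p, hp⟩ := hne
      rw [Set.mem_ofPred_eq] at hp
      subst hp
      obtain ⟨S, h1, h2, h3⟩ := exists_sign_description_cellCode hBK hBd p
      exact ⟨S, h1, h2, p, Set.ext h3⟩
  · intro E hE E' hE' p hp hp'
    obtain ⟨c, -, rfl⟩ := Finset.mem_image.1 (Finset.mem_filter.1 hE).1
    obtain ⟨c', -, rfl⟩ := Finset.mem_image.1 (Finset.mem_filter.1 hE').1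
    rw [Set.mem_ofPred_eq] at hp hp'
    rw [← hp, ← hp']
  · intro p
    exact ⟨{q | cellCode ℬ q = cellCode ℬ p}, Finset.mem_filter.2
      ⟨Finset.mem_image_of_mem _ (hmem p), p, rfl⟩, rfl⟩

/-- Every continuous nonvanishing complex function on `s` has a continuous logarithm. -/
def HasContinuousLog {T : Type*} [TopologicalSpace T] (s : Set T) : Prop :=
  ∀ f : T → ℂ, ContinuousOn f s → (∀ x ∈ s, f x ≠ 0) →
    ∃ g : T → ℂ, ContinuousOn g s ∧ ∀ x ∈ s, Complex.exp (g x) = f x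

/-- A set with order-connected fibers in `ℝ` and a continuous section inherits continuous
logarithms from its base. -/
lemma HasContinuousLog.of_section {T : Type*} [TopologicalSpace T] {s : Set T}
    (hs : HasContinuousLog s) {E : Set (T × ℝ)} (hEs : ∀ p ∈ E, p.1 ∈ s)
    (hE : ∀ t ∈ s, {y | (t, y) ∈ E}.OrdConnected) {f : T → ℝ} (hf : ContinuousOn f s)
    (hfE : ∀ t ∈ s, (t, f t) ∈ E) : HasContinuousLog E := by
  classical
  intro F hF hF0
  obtain ⟨g, hg, hgF⟩ := hs (fun t => F (t, f t)) (hF.comp (continuousOn_id.prodMk hf) hfE)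
    fun t ht => hF0 _ (hfE t ht)
  have hHE : ∀ z : unitInterval × E,
      (z.2.1.1, (1 - (z.1 : ℝ)) * f z.2.1.1 + z.1 * z.2.1.2) ∈ E := by
    rintro ⟨τ, ⟨⟨t, y⟩, hp⟩⟩
    have ht := hEs _ hp
    have hconv := (hE t ht).convex (𝕜 := ℝ)
    exact hconv (hfE t ht) hp (sub_nonneg.2 τ.2.2) τ.2.1 (by ring)
  have hfs : Continuous fun z : E => f z.1.1 :=
    hf.comp_continuous (by fun_prop) fun z => hEs _ z.2
  set H : C(unitInterval × E, {z : ℂ // z ≠ 0}) :=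
    ⟨fun z => ⟨F (z.2.1.1, (1 - (z.1 : ℝ)) * f z.2.1.1 + z.1 * z.2.1.2), hF0 _ (hHE z)⟩, by
      refine Continuous.subtype_mk (hF.comp_continuous ?_ hHE) _
      have := hfs.comp (continuous_snd (X := unitInterval) (Y := E))
      exact (by fun_prop : Continuous fun z : unitInterval × E => z.2.1.1).prodMk
        (((by fun_prop : Continuous fun z : unitInterval × E => 1 - (z.1 : ℝ)).mul this).add
          (by fun_prop))⟩ with hH
  set G : C(E, ℂ) := ⟨fun z => g z.1.1, hg.comp_continuous (by fun_prop) fun z => hEs _ z.2⟩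
  have h0 : ∀ a, H (0, a) = (fun z : ℂ => (⟨_, z.exp_ne_zero⟩ : {z : ℂ // z ≠ 0})) (G a) := by
    intro a
    refine Subtype.ext ?_
    have := hgF a.1.1 (hEs _ a.2)
    simp [hH, G, this]
  have hl := Complex.isCoveringMap_exp.liftHomotopy_lifts H G h0
  set L := Complex.isCoveringMap_exp.liftHomotopy H G h0
  refine ⟨fun p => if hp : p ∈ E then L (1, ⟨p, hp⟩) else 0, ?_, fun p hp => ?_⟩
  · rw [continuousOn_iff_continuous_domRestrict]
    have : Continuous fun z : E => L (1, z) := by fun_prop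
    refine this.congr fun x => ?_
    simp only [Set.domRestrict_apply, dif_pos x.2]
  · simp only [dif_pos hp]
    have := congrArg Subtype.val (congrFun hl (1, ⟨p, hp⟩))
    simpa [hH] using this

lemma Set.OrdConnected.hasContinuousLog {I : Set ℝ} (hI : I.OrdConnected) :
    HasContinuousLog I := by
  rcases I.eq_empty_or_nonempty with rfl | ⟨a, ha⟩
  · exact fun f _ _ => ⟨0, continuousOn_const, fun x hx => hx.elim⟩
  have hpt : HasContinuousLog (Set.univ : Set Unit) := fun f _ hf =>
    ⟨fun x => Complex.log (f x), (continuous_of_discreteTopology).continuousOn,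
      fun x hx => Complex.exp_log (hf x hx)⟩
  have hE := hpt.of_section (E := {p : Unit × ℝ | p.2 ∈ I}) (f := fun _ => a)
    (fun _ _ => Set.mem_univ _) (fun _ _ => hI) continuousOn_const (fun _ _ => ha)
  intro f hf hf0
  obtain ⟨g, hg, hgf⟩ := hE (fun p => f p.2) (hf.comp (by fun_prop) fun p hp => hp)
    fun p hp => hf0 p.2 hp
  exact ⟨fun x => g ((), x), hg.comp (by fun_prop) fun x hx => hx, fun x hx => hgf ((), x) hx⟩

/-- Cells of the cylindrical decomposition of the plane admit continuous logarithms. -/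
lemma hasContinuousLog_cellCode (𝒜 : Finset (MvPolynomial (Fin 3) ℝ)) (c : ℕ × ℕ) :
    HasContinuousLog {p | cellCode 𝒜 p = c} := by
  rcases Set.eq_empty_or_nonempty {p | cellCode 𝒜 p = c} with h | ⟨p, hp⟩
  · rw [h]
    exact fun f _ _ => ⟨0, continuousOn_const, fun x hx => hx.elim⟩
  rw [Set.mem_ofPred_eq] at hp
  subst hp
  obtain ⟨f, hf, hfc⟩ := exists_section_cellCode 𝒜 p
  exact (ordConnected_rankCode _ _).hasContinuousLog.of_section
    (fun q hq => congrArg Prod.fst hq) (fun x _ => ordConnected_cellCode 𝒜 _ x) hf hfc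

/-- `F(x, y, z)` as a polynomial in `z`. -/
noncomputable def spacePoly :
    MvPolynomial (Fin 3) ℝ →ₐ[ℝ] Polynomial (MvPolynomial (Fin 3) ℝ) :=
  MvPolynomial.aeval ![Polynomial.C (MvPolynomial.X 0), Polynomial.C (MvPolynomial.X 1),
    Polynomial.X]

/-- `F(x, y, z)` as a polynomial in `z`, for fixed `(x, y)`. -/
noncomputable def spaceSlice (F : MvPolynomial (Fin 3) ℝ) (p : ℝ × ℝ) : Polynomial ℝ :=
  (spacePoly F).map (MvPolynomial.eval ![p.1, p.2, 0])

lemma eval_spaceSlice (F : MvPolynomial (Fin 3) ℝ) (p : ℝ × ℝ) (z : ℝ) :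
    (spaceSlice F p).eval z = MvPolynomial.eval ![p.1, p.2, z] F := by
  induction F using MvPolynomial.induction_on with
  | C a =>
    simp only [spaceSlice, spacePoly, MvPolynomial.eval_C]
    rw [← MvPolynomial.algebraMap_eq, AlgHom.commutes]
    simp [Polynomial.algebraMap_apply]
  | add P Q hP hQ =>
    have : spaceSlice (P + Q) p = spaceSlice P p + spaceSlice Q p := by simp [spaceSlice]
    rw [this, Polynomial.eval_add, hP, hQ, map_add]
  | mul_X P i hP =>
    have : spaceSlice (P * MvPolynomial.X i) p =
        spaceSlice P p * spaceSlice (MvPolynomial.X i) p := by simp [spaceSlice]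
    rw [this, Polynomial.eval_mul, hP, map_mul]
    congr 1
    fin_cases i <;> simp [spaceSlice, spacePoly]

lemma spacePoly_monomial (m : Fin 3 →₀ ℕ) (c : ℝ) :
    spacePoly (MvPolynomial.monomial m c) =
      Polynomial.C (MvPolynomial.C c * MvPolynomial.X 0 ^ m 0 * MvPolynomial.X 1 ^ m 1) *
        Polynomial.X ^ m 2 := by
  rw [spacePoly, MvPolynomial.aeval_monomial, Finsupp.prod_fintype _ _ (by simp),
    Fin.prod_univ_three]
  simp only [Matrix.cons_val_zero, Matrix.cons_val_one, Matrix.cons_val, Polynomial.C_mul,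
    Polynomial.algebraMap_apply, map_pow, MvPolynomial.algebraMap_eq]
  ring

lemma natDegree_spacePoly_le (F : MvPolynomial (Fin 3) ℝ) :
    (spacePoly F).natDegree ≤ F.totalDegree := by
  conv_lhs => rw [F.as_sum, map_sum]
  refine Polynomial.natDegree_sum_le_of_forall_le _ _ fun m hm => ?_
  rw [spacePoly_monomial]
  refine (Polynomial.natDegree_C_mul_X_pow_le _ _).trans ?_
  exact (Finsupp.le_degree 2 m).trans (MvPolynomial.le_totalDegree hm)

lemma totalDegree_coeff_spacePoly_le (F : MvPolynomial (Fin 3) ℝ) (i : ℕ) :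
    ((spacePoly F).coeff i).totalDegree ≤ 2 * F.totalDegree := by
  conv_lhs => rw [F.as_sum, map_sum, Polynomial.finsetSum_coeff]
  refine MvPolynomial.totalDegree_finsetSum_le fun m hm => ?_
  rw [spacePoly_monomial, Polynomial.coeff_C_mul_X_pow]
  split_ifs
  · have h0 := (Finsupp.le_degree 0 m).trans (MvPolynomial.le_totalDegree hm)
    have h1 := (Finsupp.le_degree 1 m).trans (MvPolynomial.le_totalDegree hm)
    refine (MvPolynomial.totalDegree_mul _ _).trans ?_
    have h2 := MvPolynomial.totalDegree_mul (MvPolynomial.C (F.coeff m) : MvPolynomial (Fin 3) ℝ)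
      (MvPolynomial.X 0 ^ m 0)
    rw [MvPolynomial.totalDegree_C, MvPolynomial.totalDegree_X_pow] at h2
    rw [MvPolynomial.totalDegree_X_pow]
    omega
  · simp

lemma totalDegree_rootStrata_spacePoly_le {F : MvPolynomial (Fin 3) ℝ} {D : ℕ}
    (hF : F.totalDegree ≤ D) {r : MvPolynomial (Fin 3) ℝ} (hr : r ∈ rootStrata (spacePoly F)) :
    r.totalDegree ≤ (2 * D + 2) * (2 * (2 * D)) := by
  have h1 : ∀ i, ((spacePoly F).coeff i).totalDegree ≤ 2 * D := fun i =>
    (totalDegree_coeff_spacePoly_le F i).trans (Nat.mul_le_mul_left 2 hF)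
  have h2 := degree_rootStrata_le (R := MvPolynomial (Fin 3) ℝ) (fun q => q.totalDegree)
    (fun a b => MvPolynomial.totalDegree_add a b) (fun a b => MvPolynomial.totalDegree_mul a b)
    (fun n => by
      rw [← map_intCast (MvPolynomial.C : ℝ →+* MvPolynomial (Fin 3) ℝ)]
      exact MvPolynomial.totalDegree_C _)
    (spacePoly F) h1 hr
  refine h2.trans ?_
  have := (natDegree_spacePoly_le F).trans hF
  gcongr

lemma card_rootStrata_spacePoly_le {F : MvPolynomial (Fin 3) ℝ} {D : ℕ}
    (hF : F.totalDegree ≤ D) : (rootStrata (spacePoly F)).card ≤ (D + 2) ^ 2 := by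
  refine (card_rootStrata_le _).trans ?_
  have := (natDegree_spacePoly_le F).trans hF
  gcongr

open Classical in
/-- The polynomials in `x, y` guarding the base cells over which the zero set of `F` is delineated. -/
noncomputable def guardFamily (F : MvPolynomial (Fin 3) ℝ) : Finset (MvPolynomial (Fin 3) ℝ) :=
  rootStrata (spacePoly F) ∪
    (columnBreaks (rootStrata (spacePoly F))).image fun r => MvPolynomial.X 0 - MvPolynomial.C r

/-- The label of the base cell of `F` containing `p`. -/
noncomputable def baseCode (F : MvPolynomial (Fin 3) ℝ) (p : ℝ × ℝ) : ℕ × ℕ :=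
  cellCode (rootStrata (spacePoly F)) p

open Classical in
/-- The heights of the zeros of `F` above `p`. -/
noncomputable def heightRoots (F : MvPolynomial (Fin 3) ℝ) (p : ℝ × ℝ) : Finset ℝ :=
  (spaceSlice F p).roots.toFinset

lemma mem_heightRoots {F : MvPolynomial (Fin 3) ℝ} {p : ℝ × ℝ} (hp : spaceSlice F p ≠ 0) {t : ℝ} :
    t ∈ heightRoots F p ↔ MvPolynomial.eval ![p.1, p.2, t] F = 0 := by
  classical
  rw [heightRoots, Multiset.mem_toFinset, Polynomial.mem_roots hp, Polynomial.IsRoot.def,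
    eval_spaceSlice]

lemma exists_guardFamily_bound (D : ℕ) : ∃ K N : ℕ, ∀ F : MvPolynomial (Fin 3) ℝ,
    F.totalDegree ≤ D → (guardFamily F).card ≤ N ∧ ∀ g ∈ guardFamily F, g.totalDegree ≤ K := by
  classical
  set K := (2 * D + 2) * (2 * (2 * D)) with hK
  refine ⟨K + 1, (D + 2) ^ 2 + 4 * (K + 2) ^ 4 * ((D + 2) ^ 2 + 1) ^ 5, fun F hF => ⟨?_, ?_⟩⟩
  · have h1 := card_rootStrata_spacePoly_le hF
    have h2 := card_columnBreaks_le (𝒜 := rootStrata (spacePoly F)) (K := K) fun g hg =>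
      totalDegree_rootStrata_spacePoly_le hF hg
    refine (Finset.card_union_le _ _).trans (Nat.add_le_add h1 (Finset.card_image_le.trans
      (h2.trans ?_)))
    gcongr
  · intro g hg
    rcases Finset.mem_union.1 hg with hg | hg
    · exact (totalDegree_rootStrata_spacePoly_le hF hg).trans (Nat.le_succ K)
    · obtain ⟨r, -, rfl⟩ := Finset.mem_image.1 hg
      refine (MvPolynomial.totalDegree_sub _ _).trans ?_
      simp

/-- A preconnected set on which the guards have invariant zeros lies in a single base cell. -/
lemma baseCode_eq_of_isPreconnected {F : MvPolynomial (Fin 3) ℝ} {E : Set (ℝ × ℝ)}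
    (hE : IsPreconnected E)
    (h : ∀ g ∈ guardFamily F, ∀ p ∈ E, ∀ q ∈ E, planarEval g p = 0 → planarEval g q = 0)
    {p q : ℝ × ℝ} (hp : p ∈ E) (hq : q ∈ E) : baseCode F p = baseCode F q := by
  classical
  refine cellCode_eq_of_isPreconnected hE (fun g hg => h g (Finset.mem_union_left _ hg))
    (fun r hr p hp q hq hpr => ?_) hp hq
  have := h _ (Finset.mem_union_right _ (Finset.mem_image_of_mem _ hr)) p hp q hq
  simp only [planarEval, map_sub, MvPolynomial.eval_X, MvPolynomial.eval_C,
    Matrix.cons_val_zero, sub_eq_zero] at this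
  exact this hpr

lemma eval_rootStrata_spacePoly_iff {F : MvPolynomial (Fin 3) ℝ} {p q : ℝ × ℝ}
    (h : baseCode F p = baseCode F q) : ∀ r ∈ rootStrata (spacePoly F),
      MvPolynomial.eval ![p.1, p.2, 0] r = 0 ↔ MvPolynomial.eval ![q.1, q.2, 0] r = 0 :=
  fun _ hr => ⟨planarEval_eq_zero_of_cellCode_eq hr h, planarEval_eq_zero_of_cellCode_eq hr h.symm⟩

lemma spaceSlice_eq_zero_iff {F : MvPolynomial (Fin 3) ℝ} {p q : ℝ × ℝ}
    (h : baseCode F p = baseCode F q) : spaceSlice F p = 0 ↔ spaceSlice F q = 0 :=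
  map_eq_zero_iff_of_rootStrata _ (eval_rootStrata_spacePoly_iff h)

/-- Over a base cell the zeros of `F` are given by finitely many continuous functions. -/
lemma exists_continuous_heightRoots {F : MvPolynomial (Fin 3) ℝ} {p₀ : ℝ × ℝ}
    (h0 : spaceSlice F p₀ ≠ 0) :
    ∃ (s : ℕ) (ξ : Fin s → {p // baseCode F p = baseCode F p₀} → ℝ),
      (∀ k, Continuous (ξ k)) ∧ (∀ p, StrictMono fun k => ξ k p) ∧
      ∀ p t, t ∈ heightRoots F p.1 ↔ ∃ k, ξ k p = t := by
  have hpre : PreconnectedSpace {p // baseCode F p = baseCode F p₀} :=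
    Subtype.preconnectedSpace (isPreconnected_cellCode _ _)
  have hne : ∀ p : {p // baseCode F p = baseCode F p₀}, spaceSlice F p.1 ≠ 0 := fun p hp =>
    h0 ((spaceSlice_eq_zero_iff p.2).1 hp)
  obtain ⟨s, ξ, h1, h2, h3⟩ := exists_continuous_roots
    (fun p : {p // baseCode F p = baseCode F p₀} => spaceSlice F p.1)
    (fun k => by
      simp only [spaceSlice, Polynomial.coeff_map]
      exact (continuous_planarEval _).comp continuous_subtype_val)
    hne
    (fun p q => natDegree_map_eq_of_rootStrata _
      (eval_rootStrata_spacePoly_iff (p.2.trans q.2.symm)))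
    (fun p q => card_complexRoots_map_eq_of_rootStrata _
      (eval_rootStrata_spacePoly_iff (p.2.trans q.2.symm)) (hne p) (hne q))
  refine ⟨s, ξ, h1, h2, fun p t => ?_⟩
  rw [← h3, mem_heightRoots (hne p), eval_spaceSlice]

lemma infinite_setOf_rankCode_eq {A : Finset ℝ} {t : ℝ} (ht : t ∉ A) :
    {u | rankCode A u = rankCode A t}.Infinite := by
  have hA : IsOpen ((A : Set ℝ)ᶜ) := A.finite_toSet.isClosed.isOpen_compl
  obtain ⟨δ, hδ, hb⟩ := Metric.isOpen_iff.1 hA t ht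
  refine (Set.Icc_infinite (show t < t + δ / 2 by linarith)).mono fun u hu => ?_
  refine le_antisymm ?_ (rankCode_mono A hu.1)
  by_contra hlt
  obtain ⟨r, hr, h1, h2, -⟩ := exists_mem_of_rankCode_lt (not_le.1 hlt)
  refine hb (show r ∈ Metric.ball t δ from ?_) hr
  rw [Metric.mem_ball, Real.dist_eq, abs_lt]
  constructor <;> linarith [hu.2]

lemma eval_aeval_polynomial (v : Fin 3 → Polynomial ℝ) (G : MvPolynomial (Fin 3) ℝ) (t : ℝ) :
    (MvPolynomial.aeval v G).eval t = MvPolynomial.eval (fun i => (v i).eval t) G := by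
  induction G using MvPolynomial.induction_on with
  | C a => simp
  | add P Q hP hQ => rw [map_add, Polynomial.eval_add, hP, hQ, map_add]
  | mul_X P i hP => rw [map_mul, Polynomial.eval_mul, hP, map_mul]; simp

lemma eq_zero_of_eval_eq_zero_of_infinite {F : MvPolynomial (Fin 3) ℝ} {I : Set ℝ}
    (hI : I.Infinite) {Y : ℝ → Set ℝ} (hY : ∀ x ∈ I, (Y x).Infinite)
    (h : ∀ x ∈ I, ∀ y ∈ Y x, ∀ z, MvPolynomial.eval ![x, y, z] F = 0) : F = 0 := by
  have key : ∀ (v : Fin 3 → Polynomial ℝ) (S : Set ℝ), S.Infinite →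
      (∀ t ∈ S, MvPolynomial.eval (fun i => (v i).eval t) F = 0) →
      ∀ t, MvPolynomial.eval (fun i => (v i).eval t) F = 0 := by
    intro v S hS hv t
    have h0 : MvPolynomial.aeval v F = 0 :=
      Polynomial.eq_zero_of_infinite_isRoot _ (hS.mono fun t ht =>
        (eval_aeval_polynomial v F t).trans (hv t ht))
    rw [← eval_aeval_polynomial, h0, Polynomial.eval_zero]
  have e1 : ∀ x z t : ℝ, (fun i => Polynomial.eval t
      ((![Polynomial.C x, Polynomial.X, Polynomial.C z] : Fin 3 → Polynomial ℝ) i)) =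
      ![x, t, z] := by
    intro x z t
    funext i
    fin_cases i <;> simp
  have e2 : ∀ y z t : ℝ, (fun i => Polynomial.eval t
      ((![Polynomial.X, Polynomial.C y, Polynomial.C z] : Fin 3 → Polynomial ℝ) i)) =
      ![t, y, z] := by
    intro y z t
    funext i
    fin_cases i <;> simp
  have h1 : ∀ x ∈ I, ∀ y z, MvPolynomial.eval ![x, y, z] F = 0 := by
    intro x hx y z
    rw [← e1]
    exact key _ (Y x) (hY x hx) (fun t ht => by rw [e1]; exact h x hx t ht z) y
  refine MvPolynomial.funext fun v => ?_
  have hv : v = ![v 0, v 1, v 2] := by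
    funext i
    fin_cases i <;> rfl
  rw [map_zero, hv, ← e2]
  exact key _ I hI (fun t ht => by rw [e2]; exact h1 t ht (v 1) (v 2)) (v 0)

/-- A base cell over which `F` vanishes identically is parametrized by a real coordinate. -/
lemma exists_parametrization_of_spaceSlice_eq_zero {F : MvPolynomial (Fin 3) ℝ} (hF : F ≠ 0)
    {p₀ : ℝ × ℝ} (h0 : spaceSlice F p₀ = 0) :
    ∃ (π : ℝ × ℝ → ℝ) (φ : ℝ → ℝ × ℝ), Continuous π ∧
      ContinuousOn φ (π '' {p | baseCode F p = baseCode F p₀}) ∧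
      ∀ p, baseCode F p = baseCode F p₀ → φ (π p) = p := by
  set 𝒜 := rootStrata (spacePoly F) with h𝒜
  set I := {x | rankCode (columnBreaks 𝒜) x = rankCode (columnBreaks 𝒜) p₀.1} with hI
  have hcol : ∀ p, baseCode F p = baseCode F p₀ → p.1 ∈ I := fun p hp => congrArg Prod.fst hp
  rcases I.subsingleton_or_nontrivial with hs | hs
  · refine ⟨Prod.snd, fun y => (p₀.1, y), continuous_snd, by fun_prop, fun p hp => ?_⟩
    exact Prod.ext (hs rfl (hcol p hp)) rfl
  obtain ⟨f, hf, hfc⟩ := exists_section_cellCode 𝒜 p₀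
  by_cases hodd : p₀.2 ∈ stackRoots 𝒜 p₀.1
  · refine ⟨Prod.fst, fun x => (x, f x), continuous_fst, ?_, fun p hp => ?_⟩
    · refine (continuousOn_id.prodMk hf).mono ?_
      rintro _ ⟨p, hp, rfl⟩
      exact hcol p hp
    · refine Prod.ext rfl ?_
      have h1 : rankCode (stackRoots 𝒜 p.1) (f p.1) = rankCode (stackRoots 𝒜 p₀.1) p₀.2 :=
        congrArg Prod.snd (hfc p.1 (hcol p hp))
      have h2 : rankCode (stackRoots 𝒜 p.1) p.2 = rankCode (stackRoots 𝒜 p₀.1) p₀.2 :=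
        congrArg Prod.snd hp
      by_contra hne
      refine notMem_of_rankCode_eq (h1.trans h2.symm) hne Set.right_mem_uIcc ?_
      rw [← odd_rankCode_iff, h2, odd_rankCode_iff]
      exact hodd
  · exfalso
    have hinf : I.Infinite := by
      obtain ⟨a, ha, b, hb, hab⟩ := hs.exists_lt
      exact (Set.Icc_infinite hab).mono ((ordConnected_rankCode _ _).out ha hb)
    refine hF (eq_zero_of_eval_eq_zero_of_infinite hinf
      (Y := fun x => {y | rankCode (stackRoots 𝒜 x) y = rankCode (stackRoots 𝒜 x) (f x)})
      (fun x hx => infinite_setOf_rankCode_eq ?_) fun x hx y hy z => ?_)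
    · rw [← odd_rankCode_iff]
      have h1 : rankCode (stackRoots 𝒜 x) (f x) = rankCode (stackRoots 𝒜 p₀.1) p₀.2 :=
        congrArg Prod.snd (hfc x hx)
      rw [h1, odd_rankCode_iff]
      exact hodd
    · have hxy : baseCode F (x, y) = baseCode F p₀ := by
        refine Eq.trans ?_ (hfc x hx)
        exact Prod.ext rfl hy
      have := (spaceSlice_eq_zero_iff hxy).2 h0
      rw [← eval_spaceSlice F (x, y) z, this, Polynomial.eval_zero]

open Fin.CommRing in
/-- A reflexive transitive relation that holds along a cycle holds between any two members. -/
lemma rel_of_rel_succ {α : Type*} {r : α → α → Prop} (hr : ∀ a, r a a)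
    (ht : ∀ a b c, r a b → r b c → r a c) {k : ℕ} {f : Fin (k + 1) → α}
    (h : ∀ i, r (f i) (f (i + 1))) (i j : Fin (k + 1)) : r (f i) (f j) := by
  have key : ∀ m : ℕ, r (f i) (f (i + (m : Fin (k + 1)))) := by
    intro m
    induction m with
    | zero => simpa using hr (f i)
    | succ m ih =>
      refine ht _ _ _ ih ?_
      rw [Nat.cast_succ, ← add_assoc]
      exact h _
  have := key (j - i).val
  rwa [Fin.cast_val_eq_self, add_sub_cancel] at this

/-- For functions on intervals whose order on common domains is constant, a chain of
comparisons is transitive. -/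
lemma lt_of_chain {ι : Type*} {J : ι → Set ℝ} (hJ : ∀ i, (J i).OrdConnected) {g : ι → ℝ → ℝ}
    (hs : ∀ i j x y, x ∈ J i → x ∈ J j → y ∈ J i → y ∈ J j → g i x < g j x → g i y < g j y)
    (n : ℕ) : ∀ o : ℕ → ι, 0 < n →
      (∀ i < n, ∃ x ∈ J (o i), x ∈ J (o (i + 1)) ∧ g (o i) x < g (o (i + 1)) x) →
      ∀ x ∈ J (o 0), x ∈ J (o n) → g (o 0) x < g (o n) x := by
  induction n using Nat.strong_induction_on with
  | _ n ih =>
  intro o hn h x hx0 hxn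
  obtain hn1 | hn2 : n = 1 ∨ 2 ≤ n := by omega
  · subst hn1
    obtain ⟨y, hy0, hy1, hy⟩ := h 0 one_pos
    exact hs _ _ y x hy0 hy1 hx0 hxn hy
  by_cases hmid : ∃ j, 0 < j ∧ j < n ∧ x ∈ J (o j)
  · obtain ⟨j, hj0, hjn, hxj⟩ := hmid
    refine (ih j hjn o hj0 (fun i hi => h i (hi.trans hjn)) x hx0 hxj).trans ?_
    have := ih (n - j) (by omega) (fun i => o (j + i)) (by omega)
      (fun i hi => h (j + i) (by omega)) x hxj (by rwa [Nat.add_sub_cancel' hjn.le])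
    simpa only [Nat.add_zero, Nat.add_sub_cancel' hjn.le] using this
  push Not at hmid
  choose! p hp0 hp1 hp using h
  have hne : ∀ i, i < n → p i ≠ x := by
    rintro i hi rfl
    rcases Nat.eq_zero_or_pos i with rfl | h0
    · exact hmid 1 one_pos hn2 (hp1 0 hi)
    · exact hmid i h0 hi (hp0 i hi)
  have hside : ∀ i, i < n → (x < p i ↔ x < p 0) := by
    intro i
    induction i with
    | zero => exact fun _ => Iff.rfl
    | succ i hi =>
      intro hin
      rw [← hi (by omega)]
      have hno : x ∉ Set.uIcc (p i) (p (i + 1)) := fun hx =>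
        hmid (i + 1) (by omega) hin
          ((hJ _).uIcc_subset (hp1 i (by omega)) (hp0 (i + 1) hin) hx)
      have h1 := hne i (by omega)
      have h2 := hne (i + 1) hin
      rw [Set.mem_uIcc] at hno
      push Not at hno
      constructor
      · intro h3
        by_contra h4
        exact absurd (hno.1 (not_lt.1 h4)) (not_lt.2 h3.le)
      · intro h3
        by_contra h4
        exact absurd (hno.2 (not_lt.1 h4)) (not_lt.2 h3.le)
  have hl := hside (n - 1) (by omega)
  have hn1 : n - 1 + 1 = n := by omega
  have hpl : p (n - 1) ∈ J (o n) := by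
    have := hp1 (n - 1) (by omega)
    rwa [hn1] at this
  have hplt : g (o (n - 1)) (p (n - 1)) < g (o n) (p (n - 1)) := by
    have := hp (n - 1) (by omega)
    rwa [hn1] at this
  have hbetween : p 0 ∈ Set.uIcc x (p (n - 1)) ∨ p (n - 1) ∈ Set.uIcc x (p 0) := by
    rw [Set.mem_uIcc, Set.mem_uIcc]
    have h1 := hne 0 (by omega)
    have h2 := hne (n - 1) (by omega)
    rcases lt_or_ge x (p 0) with h3 | h3
    · have h4 := hl.2 h3
      rcases le_total (p 0) (p (n - 1)) with h5 | h5
      · exact Or.inl (Or.inl ⟨h3.le, h5⟩)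
      · exact Or.inr (Or.inl ⟨h4.le, h5⟩)
    · have h4 : p (n - 1) ≤ x := not_lt.1 fun h => absurd (hl.1 h) (not_lt.2 h3)
      rcases le_total (p 0) (p (n - 1)) with h5 | h5
      · exact Or.inr (Or.inr ⟨h5, h4⟩)
      · exact Or.inl (Or.inr ⟨h5, h3⟩)
  rcases hbetween with hb | hb
  · have hpn := (hJ _).uIcc_subset hxn hpl hb
    have := ih (n - 1) (by omega) (fun i => o (i + 1)) (by omega)
      (fun i hi => ⟨p (i + 1), hp0 _ (by omega), hp1 _ (by omega), hp _ (by omega)⟩) (p 0)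
      (hp1 0 (by omega)) (by rwa [hn1])
    simp only [hn1, Nat.zero_add] at this
    exact hs _ _ (p 0) x (hp0 0 (by omega)) hpn hx0 hxn ((hp 0 (by omega)).trans this)
  · have hpn := (hJ _).uIcc_subset hx0 (hp0 0 (by omega)) hb
    have := ih (n - 1) (by omega) o (by omega)
      (fun i hi => ⟨p i, hp0 _ (by omega), hp1 _ (by omega), hp _ (by omega)⟩) (p (n - 1))
      hpn (hp0 (n - 1) (by omega))
    exact hs _ _ (p (n - 1)) x hpn hpl hx0 hxn (this.trans hplt)

open Fin.CommRing in
/-- Functions on intervals whose order on common domains is constant admit no cycle of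
comparisons. -/
lemma not_lt_cycle {k : ℕ} {J : Fin (k + 1) → Set ℝ} (hJ : ∀ i, (J i).OrdConnected)
    {g : Fin (k + 1) → ℝ → ℝ}
    (hs : ∀ i j x y, x ∈ J i → x ∈ J j → y ∈ J i → y ∈ J j → g i x < g j x → g i y < g j y)
    (h : ∀ i, ∃ x ∈ J i, x ∈ J (i + 1) ∧ g i x < g (i + 1) x) : False := by
  obtain ⟨x, hx, -⟩ := h 0
  have := lt_of_chain hJ hs (k + 1) (fun i => (i : Fin (k + 1))) (Nat.succ_pos k)
    (fun i _ => by simpa only [Nat.cast_succ] using h i) x (by simpa using hx) (by simpa using hx)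
  simp at this

lemma floor_add_ceil_eq_of_forall_notMem {T : Type*} [TopologicalSpace T] {E : Set T}
    (hE : IsPreconnected E) {u : T → ℝ} (hu : ContinuousOn u E)
    (h : ∀ p ∈ E, u p ∉ Set.range ((↑) : ℤ → ℝ)) {p q : T} (hp : p ∈ E) (hq : q ∈ E) :
    ⌊u p⌋ + ⌈u p⌉ = ⌊u q⌋ + ⌈u q⌉ := by
  have h1 : ∀ p ∈ E, ∀ q ∈ E, ⌊u p⌋ ≤ ⌊u q⌋ := by
    intro p hp q hq
    by_contra hlt
    push Not at hlt
    obtain ⟨r, hr, hre⟩ := hE.intermediate_value hq hp hu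
      (⟨(Int.floor_lt.1 hlt).le, Int.floor_le _⟩ : (⌊u p⌋ : ℝ) ∈ Set.Icc (u q) (u p))
    exact h r hr ⟨_, hre.symm⟩
  have h2 : ∀ p ∈ E, ⌈u p⌉ = ⌊u p⌋ + 1 := fun p hp => (Int.ceil_eq_floor_add_one_iff_notMem _).2 (h p hp)
  rw [h2 p hp, h2 q hq, le_antisymm (h1 p hp q hq) (h1 q hq p hp)]

lemma eq_of_forall_mem_range_intCast {T : Type*} [TopologicalSpace T] {E : Set T}
    (hE : IsPreconnected E) {u : T → ℝ} (hu : ContinuousOn u E)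
    (h : ∀ p ∈ E, u p ∈ Set.range ((↑) : ℤ → ℝ)) {p q : T} (hp : p ∈ E) (hq : q ∈ E) :
    u p = u q := by
  wlog hlt : u p < u q generalizing p q
  · rcases (not_lt.1 hlt).eq_or_lt with h1 | h1
    · exact h1.symm
    · exact (this hq hp h1).symm
  exfalso
  obtain ⟨a, ha⟩ := h p hp
  obtain ⟨b, hb⟩ := h q hq
  have hab : a + 1 ≤ b := by
    rw [← ha, ← hb] at hlt
    exact_mod_cast hlt
  have hab' : (a : ℝ) + 1 ≤ b := by exact_mod_cast hab
  obtain ⟨r, hr, hre⟩ := hE.intermediate_value hp hq hu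
    (⟨by linarith, by linarith⟩ : (a : ℝ) + 1 / 2 ∈ Set.Icc (u p) (u q))
  obtain ⟨c, hc⟩ := h r hr
  have h1 : (2 * c : ℝ) = 2 * a + 1 := by rw [hc, hre]; ring
  have h2 : 2 * c = 2 * a + 1 := by exact_mod_cast h1
  omega

/-- Winding code around the boundary of the sheet `z = h`, `μ > 0`: it is constant on connected
sets on or off the sheet, and increases upwards through the sheet. -/
lemma exists_winding_code {σ : Set ((ℝ × ℝ) × ℝ)} (hlog : HasContinuousLog σ)
    (hfib : ∀ p, {z | (p, z) ∈ σ}.OrdConnected) {μ h : ℝ × ℝ → ℝ} (hμ : Continuous μ)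
    (hh : Continuous h) (hne : ∀ q ∈ σ, μ q.1 = 0 → q.2 ≠ h q.1) :
    ∃ code : (ℝ × ℝ) × ℝ → ℤ,
      (∀ E ⊆ σ, IsPreconnected E →
        ((∀ q ∈ E, 0 < μ q.1 → q.2 ≠ h q.1) ∨ (∀ q ∈ E, 0 < μ q.1 ∧ q.2 = h q.1)) →
        ∀ q ∈ E, ∀ q' ∈ E, code q = code q') ∧
      (∀ p z₁ z₂, (p, z₁) ∈ σ → (p, z₂) ∈ σ → z₁ ≤ z₂ → code (p, z₁) ≤ code (p, z₂)) ∧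
      (∀ p z₁ z₂, (p, z₁) ∈ σ → (p, z₂) ∈ σ → z₁ < z₂ → 0 < μ p → z₁ = h p →
        code (p, z₁) < code (p, z₂)) := by
  set Φ : (ℝ × ℝ) × ℝ → ℂ := fun q => ⟨μ q.1, q.2 - h q.1⟩ with hΦ
  have hΦc : Continuous Φ := by
    have : Φ = fun q => ((μ q.1 : ℝ) : ℂ) + ((q.2 - h q.1 : ℝ) : ℂ) * Complex.I := by
      funext q
      exact Complex.mk_eq_add_mul_I _ _
    rw [this]
    fun_prop
  obtain ⟨g, hg, hgΦ⟩ := hlog Φ hΦc.continuousOn fun q hq h0 => hne q hq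
    (congrArg Complex.re h0) (sub_eq_zero.1 (congrArg Complex.im h0))
  set u : (ℝ × ℝ) × ℝ → ℝ := fun q => (g q).im / (2 * Real.pi) with hu
  have hπ := Real.pi_pos
  have huc : ContinuousOn u σ := (Complex.continuous_im.comp_continuousOn hg).div_const _
  have hre : ∀ q ∈ σ, μ q.1 = Real.exp (g q).re * Real.cos (g q).im := fun q hq => by
    rw [← Complex.exp_re, hgΦ q hq]
  have him : ∀ q ∈ σ, q.2 - h q.1 = Real.exp (g q).re * Real.sin (g q).im := fun q hq => by
    rw [← Complex.exp_im, hgΦ q hq]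
  have huInt : ∀ q ∈ σ, u q ∈ Set.range ((↑) : ℤ → ℝ) ↔ 0 < μ q.1 ∧ q.2 = h q.1 := by
    intro q hq
    constructor
    · rintro ⟨n, hn⟩
      have h1 : (n : ℝ) * (2 * Real.pi) = (g q).im := by rw [hn, hu]; field_simp
      have h2 : Real.cos (g q).im = 1 := (Real.cos_eq_one_iff _).2 ⟨n, h1⟩
      have h3 : Real.sin (g q).im = 0 := by
        have := Real.sin_sq_add_cos_sq (g q).im
        rw [h2] at this
        nlinarith
      have h4 := him q hq
      rw [h3, mul_zero, sub_eq_zero] at h4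
      rw [hre q hq, h2, mul_one]
      exact ⟨Real.exp_pos _, h4⟩
    · rintro ⟨h1, h2⟩
      have h3 : Real.sin (g q).im = 0 := by
        have := him q hq
        rw [h2, sub_self] at this
        exact (mul_eq_zero.1 this.symm).resolve_left (Real.exp_pos _).ne'
      have h4 : 0 < Real.cos (g q).im := by
        rw [hre q hq] at h1
        exact (pos_iff_pos_of_mul_pos h1).1 (Real.exp_pos _)
      have h5 : Real.cos (g q).im = 1 := by
        have := Real.sin_sq_add_cos_sq (g q).im
        rw [h3] at this
        nlinarith
      obtain ⟨n, hn⟩ := (Real.cos_eq_one_iff _).1 h5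
      refine ⟨n, ?_⟩
      rw [hu]
      simp only
      rw [← hn]
      field_simp
  have hconst : ∀ E ⊆ σ, IsPreconnected E →
      ((∀ q ∈ E, 0 < μ q.1 → q.2 ≠ h q.1) ∨ (∀ q ∈ E, 0 < μ q.1 ∧ q.2 = h q.1)) →
      ∀ q ∈ E, ∀ q' ∈ E, ⌊u q⌋ + ⌈u q⌉ = ⌊u q'⌋ + ⌈u q'⌉ := by
    rintro E hEσ hE (hE1 | hE1) q hq q' hq'
    · exact floor_add_ceil_eq_of_forall_notMem hE (huc.mono hEσ)
        (fun p hp hi => hE1 p hp ((huInt p (hEσ hp)).1 hi).1 ((huInt p (hEσ hp)).1 hi).2) hq hq'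
    · rw [eq_of_forall_mem_range_intCast hE (huc.mono hEσ)
        (fun p hp => (huInt p (hEσ hp)).2 (hE1 p hp)) hq hq']
  have hval : ∀ p z₁ z₂, (p, z₁) ∈ σ → (p, z₂) ∈ σ → 0 < μ p →
      u (p, z₁) - Complex.arg (Φ (p, z₁)) / (2 * Real.pi) =
        u (p, z₂) - Complex.arg (Φ (p, z₂)) / (2 * Real.pi) ∧
      u (p, z₁) - Complex.arg (Φ (p, z₁)) / (2 * Real.pi) ∈ Set.range ((↑) : ℤ → ℝ) := by
    intro p z₁ z₂ h1 h2 hp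
    set E : Set ((ℝ × ℝ) × ℝ) := (fun z => (p, z)) '' {z | (p, z) ∈ σ} with hE
    have hEσ : E ⊆ σ := by
      rintro _ ⟨z, hz, rfl⟩
      exact hz
    have hEp : IsPreconnected E :=
      (hfib p).isPreconnected.image _ (by fun_prop : Continuous fun z : ℝ => (p, z)).continuousOn
    have hEc : ContinuousOn (fun q => u q - Complex.arg (Φ q) / (2 * Real.pi)) E := by
      refine (huc.mono hEσ).sub (ContinuousOn.div_const ?_ _)
      rintro _ ⟨z, hz, rfl⟩
      refine (Complex.continuousAt_arg (Or.inl hp)).comp_continuousWithinAt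
        hΦc.continuousWithinAt
    have hEi : ∀ q ∈ E, u q - Complex.arg (Φ q) / (2 * Real.pi) ∈
        Set.range ((↑) : ℤ → ℝ) := by
      rintro _ ⟨z, hz, rfl⟩
      have h0 : Φ (p, z) ≠ 0 := by
        rw [← hgΦ _ hz]
        exact Complex.exp_ne_zero _
      obtain ⟨n, hn⟩ := Complex.exp_eq_exp_iff_exists_int.1
        ((hgΦ _ hz).trans (Complex.exp_log h0).symm)
      refine ⟨n, ?_⟩
      have := congrArg Complex.im hn
      simp only [Complex.add_im, Complex.log_im, Complex.mul_im, Complex.intCast_re,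
        Complex.intCast_im, Complex.I_re, Complex.I_im, Complex.mul_re, Complex.ofReal_re,
        Complex.ofReal_im, Complex.re_ofNat, Complex.im_ofNat] at this
      rw [hu]
      simp only
      rw [this]
      field_simp
      ring
    exact ⟨eq_of_forall_mem_range_intCast hEp hEc hEi ⟨z₁, h1, rfl⟩ ⟨z₂, h2, rfl⟩,
      hEi _ ⟨z₁, h1, rfl⟩⟩
  have hcode : ∀ p z, 0 < μ p → ∀ k : ℤ,
      u (p, z) - Complex.arg (Φ (p, z)) / (2 * Real.pi) = k →
      ⌊u (p, z)⌋ + ⌈u (p, z)⌉ = 2 * k + SignType.sign (z - h p) := by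
    intro p z hp k hk
    have harg : |Complex.arg (Φ (p, z))| < Real.pi / 2 :=
      Complex.abs_arg_lt_pi_div_two_iff.2 (Or.inl hp)
    have hk' : u (p, z) = k + Complex.arg (Φ (p, z)) / (2 * Real.pi) := by linarith
    rw [abs_lt] at harg
    have hb1 : Complex.arg (Φ (p, z)) / (2 * Real.pi) < 1 := by
      rw [div_lt_one (by positivity)]; linarith
    have hb2 : -1 < Complex.arg (Φ (p, z)) / (2 * Real.pi) := by
      rw [lt_div_iff₀ (by positivity)]; linarith
    rcases lt_trichotomy z (h p) with hz | hz | hz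
    · have h1 : Complex.arg (Φ (p, z)) < 0 :=
        Complex.arg_neg_iff.2 (show z - h p < 0 by linarith)
      have h2 : Complex.arg (Φ (p, z)) / (2 * Real.pi) < 0 := div_neg_of_neg_of_pos h1 (by positivity)
      have h3 : ⌊u (p, z)⌋ = k - 1 := by
        rw [Int.floor_eq_iff]; push_cast; constructor <;> linarith
      have h4 : ⌈u (p, z)⌉ = k := by
        rw [Int.ceil_eq_iff]; constructor <;> linarith
      rw [h3, h4, sign_neg (by linarith)]
      simp only [SignType.coe_neg_one]
      ring
    · have h1 : Complex.arg (Φ (p, z)) = 0 := by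
        rw [Complex.arg_eq_zero_iff]
        exact ⟨hp.le, show z - h p = 0 by linarith⟩
      rw [hk', h1, hz]
      simp
      ring
    · have h1 : 0 < Complex.arg (Φ (p, z)) := by
        refine lt_of_le_of_ne (Complex.arg_nonneg_iff.2 (show 0 ≤ z - h p by linarith)) fun h0 => ?_
        have h2 : z - h p = 0 := (Complex.arg_eq_zero_iff.1 h0.symm).2
        linarith
      have h2 : 0 < Complex.arg (Φ (p, z)) / (2 * Real.pi) := by positivity
      have h3 : ⌊u (p, z)⌋ = k := by
        rw [Int.floor_eq_iff]; constructor <;> linarith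
      have h4 : ⌈u (p, z)⌉ = k + 1 := by
        rw [Int.ceil_eq_iff]; push_cast; constructor <;> linarith
      rw [h3, h4, sign_pos (by linarith)]
      simp only [SignType.coe_one]
      ring
  have hmono : ∀ a b : ℝ, a ≤ b →
      ((SignType.sign a : SignType) : ℤ) ≤ ((SignType.sign b : SignType) : ℤ) := by
    intro a b hab
    rcases lt_trichotomy a 0 with ha | ha | ha <;> rcases lt_trichotomy b 0 with hb | hb | hb <;>
      simp [ha, hb] <;> linarith
  refine ⟨fun q => ⌊u q⌋ + ⌈u q⌉, hconst, fun p z₁ z₂ h1 h2 hle => ?_,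
    fun p z₁ z₂ h1 h2 hlt hp hz => ?_⟩
  · rcases le_or_gt (μ p) 0 with hp | hp
    · refine (hconst ((fun z => (p, z)) '' {z | (p, z) ∈ σ}) ?_ ?_ (Or.inl ?_) _ ⟨z₁, h1, rfl⟩ _
        ⟨z₂, h2, rfl⟩).le
      · rintro _ ⟨z, hz, rfl⟩
        exact hz
      · exact (hfib p).isPreconnected.image _
          (by fun_prop : Continuous fun z : ℝ => (p, z)).continuousOn
      · rintro _ ⟨z, hz, rfl⟩ hpos
        exact absurd hpos (not_lt.2 hp)
    · obtain ⟨he, k, hk⟩ := hval p z₁ z₂ h1 h2 hp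
      simp only
      rw [hcode p z₁ hp k hk.symm, hcode p z₂ hp k (he.symm.trans hk.symm)]
      have := hmono (z₁ - h p) (z₂ - h p) (by linarith)
      linarith
  · obtain ⟨he, k, hk⟩ := hval p z₁ z₂ h1 h2 hp
    simp only
    rw [hcode p z₁ hp k hk.symm, hcode p z₂ hp k (he.symm.trans hk.symm), hz, sub_self,
      sign_zero, sign_pos (by linarith)]
    simp

/-- A non-vertical triangle: the height of its plane, linear forms cutting out its projection to
the `xy`-plane, and the lines supporting its edges. -/
structure Facet where
  height : MvPolynomial (Fin 3) ℝ
  edge : Fin 3 → MvPolynomial (Fin 3) ℝ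
  base : Fin 3 → Fin 3 → ℝ
  dir : Fin 3 → Fin 3 → ℝ
  totalDegree_height : height.totalDegree ≤ 1
  totalDegree_edge : ∀ j, (edge j).totalDegree ≤ 1
  dir_ne : ∀ j, dir j 0 ≠ 0 ∨ dir j 1 ≠ 0
  exists_param : ∀ j p, planarEval (edge j) p = 0 →
    ∃ t : ℝ, base j + t • dir j = ![p.1, p.2, planarEval height p]

namespace Facet

/-- The projection of a facet to the `xy`-plane. -/
def region (Δ : Facet) : Set (ℝ × ℝ) := {p | ∀ j, 0 ≤ planarEval (Δ.edge j) p}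

/-- The point of the plane of a facet above a point of the `xy`-plane. -/
noncomputable def lift (Δ : Facet) (p : ℝ × ℝ) : Fin 3 → ℝ :=
  ![p.1, p.2, planarEval Δ.height p]

/-- The facet has a supporting line of an edge meeting `σ`. -/
def EdgeMeets (Δ : Facet) (σ : Set (Fin 3 → ℝ)) : Prop :=
  ∃ (j : Fin 3) (t : ℝ), Δ.base j + t • Δ.dir j ∈ σ

end Facet

/-- The lifts of the projections of two facets are disjoint. -/
def PairwiseSeparated {ι : Type*} (T : ι → Facet) : Prop :=
  ∀ i j, i ≠ j → ∀ p ∈ (T i).region, p ∈ (T j).region →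
    planarEval (T i).height p ≠ planarEval (T j).height p

lemma PairwiseSeparated.lt_of_lt {ι : Type*} {T : ι → Facet} (hT : PairwiseSeparated T) {i j : ι}
    {E : Set (ℝ × ℝ)} (hE : IsPreconnected E) (hi : E ⊆ (T i).region) (hj : E ⊆ (T j).region)
    {p q : ℝ × ℝ} (hp : p ∈ E) (hq : q ∈ E)
    (h : planarEval (T i).height p < planarEval (T j).height p) :
    planarEval (T i).height q < planarEval (T j).height q := by
  have hij : i ≠ j := by
    rintro rfl
    exact lt_irrefl _ h
  have := hE.sign_eq (f := fun p => planarEval (T j).height p - planarEval (T i).height p)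
    ((continuous_planarEval _).sub (continuous_planarEval _)).continuousOn
    (fun r hr _ _ h0 => absurd (sub_eq_zero.1 h0).symm (hT i j hij r (hi hr) (hj hr))) hp hq
  rw [sign_pos (sub_pos.2 h)] at this
  exact sub_pos.1 (sign_eq_one_iff.1 this.symm)

/-- Over a base cell above which `F` vanishes identically the depth relation has no cycle. -/
lemma not_cycle_of_spaceSlice_eq_zero {ι : Type*} {T : ι → Facet} (hT : PairwiseSeparated T)
    {F : MvPolynomial (Fin 3) ℝ} (hF : F ≠ 0) {p₀ : ℝ × ℝ} (h0 : spaceSlice F p₀ = 0) {k : ℕ}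
    {o : Fin (k + 1) → ι} {C : Fin (k + 1) → Set (ℝ × ℝ)} (hC : ∀ i, IsPreconnected (C i))
    (hr : ∀ i, C i ⊆ (T (o i)).region)
    (hb : ∀ i, ∀ p ∈ C i, baseCode F p = baseCode F p₀)
    (hlt : ∀ i, ∃ p ∈ C i, p ∈ C (i + 1) ∧
      planarEval (T (o i)).height p < planarEval (T (o (i + 1))).height p) : False := by
  obtain ⟨π, φ, hπ, hφ, hφπ⟩ := exists_parametrization_of_spaceSlice_eq_zero hF h0
  have hJ : ∀ i, (π '' C i).OrdConnected := fun i =>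
    ((hC i).image π hπ.continuousOn).ordConnected
  refine not_lt_cycle hJ (g := fun i x => planarEval (T (o i)).height (φ x)) ?_ fun i => ?_
  · intro i j x y hxi hxj hyi hyj h
    have hsub : ∀ i, φ '' (π '' C i ∩ π '' C j) ⊆ C j ∧ φ '' (π '' C i ∩ π '' C j) ⊆ C i := by
      intro i
      constructor
      · rintro _ ⟨x, ⟨-, p, hp, rfl⟩, rfl⟩
        rwa [hφπ p (hb j p hp)]
      · rintro _ ⟨x, ⟨⟨p, hp, rfl⟩, -⟩, rfl⟩
        rwa [hφπ p (hb i p hp)]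
    refine hT.lt_of_lt (E := φ '' (π '' C i ∩ π '' C j)) ?_ ((hsub i).2.trans (hr i))
      ((hsub i).1.trans (hr j)) ⟨x, ⟨hxi, hxj⟩, rfl⟩ ⟨y, ⟨hyi, hyj⟩, rfl⟩ h
    refine ((hJ i).inter (hJ j)).isPreconnected.image _ (hφ.mono ?_)
    exact Set.inter_subset_left.trans (Set.image_mono fun p hp => hb i p hp)
  · obtain ⟨p, hp, hp', h⟩ := hlt i
    refine ⟨π p, ⟨p, hp, rfl⟩, ⟨p, hp', rfl⟩, ?_⟩
    rwa [hφπ p (hb i p hp)]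

/-- The rank of a continuous function in a continuous family of strictly increasing finite
sequences is constant if the function never joins or leaves the sequences. -/
lemma rankCode_eq_of_continuous {E : Type*} [TopologicalSpace E] [PreconnectedSpace E] {s : ℕ}
    (ζ : Fin s → E → ℝ) (hc : ∀ i, Continuous (ζ i)) (hm : ∀ e, StrictMono fun i => ζ i e)
    (A : E → Finset ℝ) (hA : ∀ e t, t ∈ A e ↔ ∃ i, ζ i e = t) {f : E → ℝ} (hf : Continuous f)
    (hz : ∀ e e', f e ∈ A e → f e' ∈ A e') (e e' : E) :
    rankCode (A e) (f e) = rankCode (A e') (f e') := by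
  by_cases hpz : f e ∈ A e
  · have hall : ∀ e, ∃ k, ζ k e = f e := fun e' => (hA e' _).1 (hz e e' hpz)
    obtain ⟨k, hk⟩ := hall e
    have hk' := exists_index_of_continuous ζ hc hm hf hall e e' k hk
    rw [← hk, ← hk', rankCode_strictMono (hm e) (hA e), rankCode_strictMono (hm e') (hA e')]
  · have hno : ∀ e', f e' ∉ A e' := fun e' he => hpz (hz e' e he)
    rw [rankCode_eq_of_strictMono (hm e) (hA e) (hno e),
      rankCode_eq_of_strictMono (hm e') (hA e') (hno e')]
    congr 3
    ext k
    have := isPreconnected_univ.sign_eq (f := fun e : E => f e - ζ k e)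
      (hf.sub (hc k)).continuousOn
      (fun e _ _ _ he => absurd ((hA e _).2 ⟨k, (sub_eq_zero.1 he).symm⟩) (hno e))
      (Set.mem_univ e) (Set.mem_univ e')
    rw [← sub_pos, ← sign_eq_one_iff, this, sign_eq_one_iff, sub_pos]

/-- The rank of a graph among the zeros of `F` is constant over a connected set. -/
lemma rankCode_heightRoots_eq {F : MvPolynomial (Fin 3) ℝ} {p₀ : ℝ × ℝ} (h0 : spaceSlice F p₀ ≠ 0)
    {E : Set (ℝ × ℝ)} (hE : IsPreconnected E) (hb : ∀ p ∈ E, baseCode F p = baseCode F p₀)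
    {f : ℝ × ℝ → ℝ} (hf : Continuous f)
    (hz : ∀ p ∈ E, ∀ q ∈ E, f p ∈ heightRoots F p → f q ∈ heightRoots F q) {p q : ℝ × ℝ}
    (hp : p ∈ E) (hq : q ∈ E) :
    rankCode (heightRoots F p) (f p) = rankCode (heightRoots F q) (f q) := by
  obtain ⟨s, ξ, h1, h2, h3⟩ := exists_continuous_heightRoots h0
  have hpre : PreconnectedSpace E := isPreconnected_iff_preconnectedSpace.1 hE
  let ψ : E → {p // baseCode F p = baseCode F p₀} := fun e => ⟨e.1, hb e.1 e.2⟩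
  have hincl : Continuous ψ := continuous_subtype_val.subtype_mk _
  have h4 : ∀ k, Continuous fun e => ξ k (ψ e) := fun k => (h1 k).comp hincl
  have h5 : ∀ e, StrictMono fun k => ξ k (ψ e) := fun e => h2 (ψ e)
  have h6 : ∀ (e : E) t, t ∈ heightRoots F e.1 ↔ ∃ i, ξ i (ψ e) = t := fun e => h3 (ψ e)
  have h7 : Continuous fun e : E => f e.1 := hf.comp continuous_subtype_val
  have h8 : ∀ e e' : E, f e.1 ∈ heightRoots F e.1 → f e'.1 ∈ heightRoots F e'.1 :=
    fun e e' => hz e.1 e.2 e'.1 e'.2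
  exact rankCode_eq_of_continuous (fun k e => ξ k (ψ e)) h4 h5 (fun e : E => heightRoots F e.1)
    h6 h7 h8 ⟨p, hp⟩ ⟨q, hq⟩

/-- A cycle of pieces inside a cell of the complement of the zero set of `F` only involves facets
having an edge line that meets the cell. -/
lemma edgeMeets_of_cycle {ι : Type*} {T : ι → Facet} (hT : PairwiseSeparated T)
    {σ : Set ((ℝ × ℝ) × ℝ)} (hlog : HasContinuousLog σ)
    (hfib : ∀ p, {z | (p, z) ∈ σ}.OrdConnected) {k : ℕ}
    {o : Fin (k + 1) → ι} {C : Fin (k + 1) → Set (ℝ × ℝ)} (hC : ∀ i, IsPreconnected (C i))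
    (hr : ∀ i, C i ⊆ (T (o i)).region)
    (hσ : ∀ i, ∀ p ∈ C i, (p, planarEval (T (o i)).height p) ∈ σ)
    (hlt : ∀ i, ∃ p ∈ C i, p ∈ C (i + 1) ∧
      planarEval (T (o i)).height p < planarEval (T (o (i + 1))).height p) (a : Fin (k + 1)) :
    (T (o a)).EdgeMeets ((fun q : (ℝ × ℝ) × ℝ => ![q.1.1, q.1.2, q.2]) '' σ) := by
  by_contra hno
  set Δ := T (o a) with hΔ
  set μ : ℝ × ℝ → ℝ := fun p =>
    planarEval (Δ.edge 0) p ⊓ planarEval (Δ.edge 1) p ⊓ planarEval (Δ.edge 2) p with hμdef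
  have hμ : Continuous μ := ((continuous_planarEval _).inf (continuous_planarEval _)).inf
    (continuous_planarEval _)
  have hμz : ∀ p, μ p = 0 → ∃ j, planarEval (Δ.edge j) p = 0 := by
    intro p hp
    rcases min_choice (planarEval (Δ.edge 0) p ⊓ planarEval (Δ.edge 1) p)
      (planarEval (Δ.edge 2) p) with h | h
    · rcases min_choice (planarEval (Δ.edge 0) p) (planarEval (Δ.edge 1) p) with h' | h'
      · exact ⟨0, h'.symm.trans (h.symm.trans hp)⟩
      · exact ⟨1, h'.symm.trans (h.symm.trans hp)⟩
    · exact ⟨2, h.symm.trans hp⟩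
  have hμr : ∀ p, 0 ≤ μ p ↔ p ∈ Δ.region := by
    intro p
    simp only [hμdef, le_inf_iff, Facet.region, Set.mem_ofPred_eq, Fin.forall_fin_succ,
      IsEmpty.forall_iff, and_true, and_assoc]
    rfl
  have hne : ∀ q ∈ σ, μ q.1 = 0 → q.2 ≠ planarEval Δ.height q.1 := by
    intro q hq h0 hz
    obtain ⟨j, hj⟩ := hμz q.1 h0
    obtain ⟨t, ht⟩ := Δ.exists_param j q.1 hj
    refine hno ⟨j, t, q, hq, ?_⟩
    rw [ht, ← hz]
  obtain ⟨code, hc1, hc2, hc3⟩ := exists_winding_code hlog hfib hμ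
    (continuous_planarEval Δ.height) hne
  set L : Fin (k + 1) → ℝ × ℝ → (ℝ × ℝ) × ℝ := fun i p => (p, planarEval (T (o i)).height p)
    with hL
  have hLc : ∀ i, ∀ p ∈ C i, ∀ q ∈ C i, code (L i p) = code (L i q) := by
    intro i p hp q hq
    have hcont : Continuous (L i) := continuous_id.prodMk (continuous_planarEval _)
    refine hc1 (L i '' C i) ?_ ((hC i).image _ hcont.continuousOn) ?_ _ ⟨p, hp, rfl⟩ _ ⟨q, hq, rfl⟩
    · rintro _ ⟨p, hp, rfl⟩
      exact hσ i p hp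
    by_cases hi : o i = o a
    · right
      rintro _ ⟨p, hp, rfl⟩
      have h1 : (0 : ℝ) ≤ μ p := (hμr p).2 (by rw [hΔ, ← hi]; exact hr i hp)
      have h2 : (L i p).2 = planarEval Δ.height p := by simp only [hL, hΔ, hi]
      exact ⟨lt_of_le_of_ne h1 fun h => hne _ (hσ i p hp) h.symm h2, h2⟩
    · left
      rintro _ ⟨p, hp, rfl⟩ hpos hz
      exact hT (o i) (o a) hi p (hr i hp) ((hμr p).1 hpos.le) hz
  choose p hp hp' hplt using hlt
  have hstep : ∀ i, code (L i (p i)) ≤ code (L (i + 1) (p (i + 1))) := by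
    intro i
    rw [hLc (i + 1) _ (hp (i + 1)) _ (hp' i)]
    exact hc2 (p i) _ _ (hσ _ _ (hp i)) (hσ _ _ (hp' i)) (hplt i).le
  have hback := rel_of_rel_succ (r := (· ≤ ·)) (fun _ => le_rfl) (fun _ _ _ => le_trans) hstep
    (a + 1) a
  rw [hLc (a + 1) _ (hp (a + 1)) _ (hp' a)] at hback
  refine absurd hback (not_le.2 (hc3 (p a) _ _ (hσ _ _ (hp a)) (hσ _ _ (hp' a)) (hplt a) ?_ rfl))
  exact lt_of_le_of_ne ((hμr _).2 (hr a (hp a))) fun h => hne _ (hσ a _ (hp a)) h.symm rfl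

/-- A cycle of invariant pieces lives in a connected set off the zero set of `F` that meets an
edge line of every facet involved. -/
theorem exists_isPreconnected_of_cycle {ι : Type*} {T : ι → Facet} (hT : PairwiseSeparated T)
    {F : MvPolynomial (Fin 3) ℝ} (hF : F ≠ 0) {k : ℕ}
    {o : Fin (k + 1) → ι} {C : Fin (k + 1) → Set (ℝ × ℝ)} (hC : ∀ i, IsPreconnected (C i))
    (hr : ∀ i, C i ⊆ (T (o i)).region)
    (hg : ∀ i, ∀ g ∈ guardFamily F, ∀ p ∈ C i, ∀ q ∈ C i, planarEval g p = 0 → planarEval g q = 0)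
    (hz : ∀ i, ∀ p ∈ C i, ∀ q ∈ C i, MvPolynomial.eval ((T (o i)).lift p) F = 0 →
      MvPolynomial.eval ((T (o i)).lift q) F = 0)
    (hlt : ∀ i, ∃ p ∈ C i, p ∈ C (i + 1) ∧
      planarEval (T (o i)).height p < planarEval (T (o (i + 1))).height p) :
    ∃ σ : Set (Fin 3 → ℝ), IsPreconnected σ ∧ (∀ x ∈ σ, MvPolynomial.eval x F ≠ 0) ∧
      ∀ i, (∀ p ∈ C i, (T (o i)).lift p ∈ σ) ∧ (T (o i)).EdgeMeets σ := by
  choose p hp hp' hplt using hlt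
  set p₀ := p 0 with hp₀
  have hb : ∀ i, ∀ q ∈ C i, baseCode F q = baseCode F p₀ := by
    have hstep : ∀ i, baseCode F (p i) = baseCode F (p (i + 1)) := fun i =>
      baseCode_eq_of_isPreconnected (hC (i + 1)) (hg (i + 1)) (hp' i) (hp (i + 1))
    intro i q hq
    exact (baseCode_eq_of_isPreconnected (hC i) (hg i) hq (hp i)).trans
      (rel_of_rel_succ (r := Eq) (fun _ => rfl) (fun _ _ _ => Eq.trans) hstep i 0)
  by_cases h0 : spaceSlice F p₀ = 0
  · exact (not_cycle_of_spaceSlice_eq_zero hT hF h0 hC hr hb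
      fun i => ⟨p i, hp i, hp' i, hplt i⟩).elim
  have hne : ∀ q, baseCode F q = baseCode F p₀ → spaceSlice F q ≠ 0 := fun q hq h =>
    h0 ((spaceSlice_eq_zero_iff hq).1 h)
  have hrank : ∀ i, ∀ q ∈ C i, ∀ q' ∈ C i,
      rankCode (heightRoots F q) (planarEval (T (o i)).height q) =
        rankCode (heightRoots F q') (planarEval (T (o i)).height q') := by
    intro i q hq q' hq'
    refine rankCode_heightRoots_eq h0 (hC i) (hb i) (continuous_planarEval _) ?_ hq hq'
    intro a ha b hb' hab
    rw [mem_heightRoots (hne _ (hb i a ha))] at hab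
    rw [mem_heightRoots (hne _ (hb i b hb'))]
    exact hz i a ha b hb' hab
  have hstep : ∀ i, rankCode (heightRoots F (p i)) (planarEval (T (o i)).height (p i)) ≤
      rankCode (heightRoots F (p (i + 1))) (planarEval (T (o (i + 1))).height (p (i + 1))) := by
    intro i
    rw [hrank (i + 1) _ (hp (i + 1)) _ (hp' i)]
    exact rankCode_mono _ (hplt i).le
  have hall := rel_of_rel_succ (r := (· ≤ ·)) (fun _ => le_rfl) (fun _ _ _ => le_trans) hstep
  set κ := rankCode (heightRoots F p₀) (planarEval (T (o 0)).height p₀) with hκ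
  have hκi : ∀ i, ∀ q ∈ C i, rankCode (heightRoots F q) (planarEval (T (o i)).height q) = κ :=
    fun i q hq => (hrank i q hq _ (hp i)).trans (le_antisymm (hall i 0) (hall 0 i))
  have hκe : ¬ Odd κ := by
    intro hodd
    have h1 := rankCode_lt_of_mem_left (odd_rankCode_iff.1 hodd) (hplt 0)
    have h2 := hκi (0 + 1) _ (hp' 0)
    rw [h2] at h1
    exact lt_irrefl _ h1
  obtain ⟨s, ξ, h1, h2, h3⟩ := exists_continuous_heightRoots h0
  set B := {q | baseCode F q = baseCode F p₀} with hB
  obtain ⟨f, hf, hfκ⟩ := exists_continuous_rankCode_eq ξ h1 h2 (fun q => heightRoots F q.1) h3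
    (c₀ := ⟨p₀, rfl⟩) (t₀ := planarEval (T (o 0)).height p₀)
  classical
  set f' : ℝ × ℝ → ℝ := fun q => if hq : baseCode F q = baseCode F p₀ then f ⟨q, hq⟩ else 0
    with hf'
  have hf'c : ContinuousOn f' B := by
    rw [continuousOn_iff_continuous_domRestrict]
    refine hf.congr fun q => ?_
    simp only [Set.domRestrict_apply, hf', dif_pos (show baseCode F q.1 = baseCode F p₀ from q.2)]
  set σ : Set ((ℝ × ℝ) × ℝ) := {q | q.1 ∈ B ∧ rankCode (heightRoots F q.1) q.2 = κ} with hσ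
  have hσB : ∀ q ∈ σ, q.1 ∈ B := fun q hq => hq.1
  have hσf : ∀ q ∈ B, (q, f' q) ∈ σ := by
    intro q hq
    refine ⟨hq, ?_⟩
    simp only [hf', dif_pos (show baseCode F q = baseCode F p₀ from hq)]
    exact hfκ ⟨q, hq⟩
  have hfib : ∀ q, {z | (q, z) ∈ σ}.OrdConnected := by
    intro q
    by_cases hq : q ∈ B
    · have : {z | (q, z) ∈ σ} = {z | rankCode (heightRoots F q) z = κ} := by
        ext z
        exact ⟨fun h => h.2, fun h => ⟨hq, h⟩⟩
      rw [this]
      exact ordConnected_rankCode _ _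
    · have : {z | (q, z) ∈ σ} = ∅ := by
        ext z
        exact ⟨fun h => hq h.1, fun h => h.elim⟩
      rw [this]
      exact Set.ordConnected_empty
  have hlog : HasContinuousLog σ := (hasContinuousLog_cellCode _ _).of_section
    hσB (fun q _ => hfib q) hf'c hσf
  have hpre : IsPreconnected σ := isPreconnected_of_section (isPreconnected_cellCode _ _)
    hσB (fun q _ => hfib q) hf'c hσf
  have hlift : ∀ i, ∀ q ∈ C i, (q, planarEval (T (o i)).height q) ∈ σ := fun i q hq =>
    ⟨hb i q hq, hκi i q hq⟩
  refine ⟨(fun q : (ℝ × ℝ) × ℝ => ![q.1.1, q.1.2, q.2]) '' σ, hpre.image _ ?_, ?_, fun i =>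
    ⟨fun q hq => ⟨_, hlift i q hq, rfl⟩, edgeMeets_of_cycle hT hlog hfib hC hr hlift
      (fun i => ⟨p i, hp i, hp' i, hplt i⟩) i⟩⟩
  · refine Continuous.continuousOn (continuous_pi fun i => ?_)
    fin_cases i
    · exact continuous_fst.comp continuous_fst
    · exact continuous_snd.comp continuous_fst
    · exact continuous_snd
  · rintro _ ⟨q, hq, rfl⟩ hzero
    refine hκe ?_
    rw [← hq.2, odd_rankCode_iff, mem_heightRoots (hne _ hq.1)]
    exact hzero

lemma totalDegree_aeval_le (F : MvPolynomial (Fin 3) ℝ) (f : Fin 3 → MvPolynomial (Fin 3) ℝ)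
    (hf : ∀ i, (f i).totalDegree ≤ 1) : (MvPolynomial.aeval f F).totalDegree ≤ F.totalDegree := by
  conv_lhs => rw [F.as_sum, map_sum]
  refine MvPolynomial.totalDegree_finsetSum_le fun m hm => ?_
  rw [MvPolynomial.aeval_monomial, MvPolynomial.algebraMap_eq]
  refine (MvPolynomial.totalDegree_mul _ _).trans ?_
  rw [MvPolynomial.totalDegree_C, zero_add]
  refine (MvPolynomial.totalDegree_finsetProd _ _).trans (le_trans ?_
    (MvPolynomial.le_totalDegree hm))
  refine Finset.sum_le_sum fun i _ => ?_
  refine (MvPolynomial.totalDegree_pow _ _).trans ?_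
  simpa using Nat.mul_le_mul_left (m i) (hf i)

namespace Facet

/-- The restriction of a polynomial to the plane of a facet, as a polynomial in `x, y`. -/
noncomputable def pullback (Δ : Facet) (F : MvPolynomial (Fin 3) ℝ) : MvPolynomial (Fin 3) ℝ :=
  MvPolynomial.aeval ![MvPolynomial.X 0, MvPolynomial.X 1, Δ.height] F

lemma planarEval_pullback (Δ : Facet) (F : MvPolynomial (Fin 3) ℝ) (p : ℝ × ℝ) :
    planarEval (Δ.pullback F) p = MvPolynomial.eval (Δ.lift p) F := by
  induction F using MvPolynomial.induction_on with
  | C a => simp [pullback, planarEval]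
  | add P Q hP hQ =>
    rw [map_add, ← hP, ← hQ]
    simp [pullback, planarEval]
  | mul_X P i hP =>
    rw [map_mul, ← hP]
    have : Δ.pullback (P * MvPolynomial.X i) = Δ.pullback P * Δ.pullback (MvPolynomial.X i) := by
      simp [pullback]
    rw [this, planarEval_mul]
    congr 1
    fin_cases i <;> simp [pullback, planarEval, lift]

lemma totalDegree_pullback_le (Δ : Facet) (F : MvPolynomial (Fin 3) ℝ) :
    (Δ.pullback F).totalDegree ≤ F.totalDegree := by
  refine totalDegree_aeval_le F _ fun i => ?_
  fin_cases i
  · exact (MvPolynomial.totalDegree_X (R := ℝ) (0 : Fin 3)).le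
  · exact (MvPolynomial.totalDegree_X (R := ℝ) (1 : Fin 3)).le
  · exact Δ.totalDegree_height

lemma continuous_lift (Δ : Facet) : Continuous Δ.lift := by
  refine continuous_pi fun i => ?_
  fin_cases i
  · exact continuous_fst
  · exact continuous_snd
  · exact continuous_planarEval _

lemma EdgeMeets.mono {Δ : Facet} {σ τ : Set (Fin 3 → ℝ)} (h : Δ.EdgeMeets σ) (hst : σ ⊆ τ) :
    Δ.EdgeMeets τ := by
  obtain ⟨j, t, ht⟩ := h
  exact ⟨j, t, hst ht⟩

end Facet

open Classical in
/-- Polynomial partitioning for the edge lines of a finite set of facets. -/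
lemma exists_facet_partition {α : ℝ} (hα : 3 / 2 < α) : ∃ D : ℕ, ∀ (ι : Type) (T : ι → Facet)
    (S : Finset ι), ∃ (F : MvPolynomial (Fin 3) ℝ) (J : Type) (_ : Fintype J)
      (O : J → Set (Fin 3 → ℝ)), F ≠ 0 ∧ F.totalDegree ≤ D ∧
      (∀ i j, i ≠ j → Disjoint (O i) (O j)) ∧ (∀ j, ∀ x ∈ O j, MvPolynomial.eval x F ≠ 0) ∧
      (∀ σ, σ.Nonempty → IsPreconnected σ → (∀ x ∈ σ, MvPolynomial.eval x F ≠ 0) →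
        ∃ j, σ ⊆ O j) ∧
      ∑ j, ((S.filter fun i => (T i).EdgeMeets (O j)).card : ℝ) ^ α ≤ 1 / 2 * (S.card : ℝ) ^ α := by
  have hκ : (0 : ℝ) < 1 / 2 * ((3 : ℝ) ^ α)⁻¹ := by positivity
  obtain ⟨D, hD⟩ := exists_polynomial_partition hα hκ
  refine ⟨D, fun ι T S => ?_⟩
  obtain ⟨F, J, hJ, O, hF, hFD, hO, hσ, hsum⟩ := hD (S × Fin 3) (fun i => (T i.1).base i.2)
    (fun i => (T i.1).dir i.2) (fun i => (T i.1).dir_ne i.2)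
  refine ⟨F, J, hJ, fun j => {x ∈ O j | MvPolynomial.eval x F ≠ 0}, hF, hFD, ?_, ?_, ?_, ?_⟩
  · exact fun i j hij => (hO i j hij).mono (fun x hx => hx.1) fun x hx => hx.1
  · exact fun j x hx => hx.2
  · intro σ h1 h2 h3
    obtain ⟨j, hj⟩ := hσ σ h1 h2 h3
    exact ⟨j, fun x hx => ⟨hj hx, h3 x hx⟩⟩
  · refine (Finset.sum_le_sum fun j _ => ?_).trans (hsum.trans (le_of_eq ?_))
    · refine Real.rpow_le_rpow (Nat.cast_nonneg _) (Nat.cast_le.2 ?_) (by linarith)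
      set Z := {i : S × Fin 3 | ∃ t : ℝ, (T i.1).base i.2 + t • (T i.1).dir i.2 ∈ O j} with hZ
      rw [Nat.card_coe_set_eq, Set.ncard_eq_toFinset_card']
      have : (S.filter fun i => (T i).EdgeMeets {x ∈ O j | MvPolynomial.eval x F ≠ 0}) ⊆
          Z.toFinset.image fun i => (i.1 : ι) := by
        intro i hi
        obtain ⟨hiS, l, t, ht⟩ := Finset.mem_filter.1 hi
        exact Finset.mem_image.2 ⟨(⟨i, hiS⟩, l), Set.mem_toFinset.2 ⟨t, ht.1⟩, rfl⟩
      exact (Finset.card_le_card this).trans Finset.card_image_le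
    · have hc : (Fintype.card (S × Fin 3) : ℝ) = S.card * 3 := by simp
      rw [hc, Real.mul_rpow (by positivity) (by positivity)]
      field_simp

lemma exists_pow_six_le (c C : ℕ) : ∃ A : ℝ, 0 < A ∧ ∀ j : ℕ,
    (C : ℝ) * ((c * j + c : ℕ) + 1) ^ 6 ≤ A / 3 * (4 / 3) ^ j := by
  obtain ⟨B, hB⟩ := (tendsto_pow_const_mul_const_pow_of_abs_lt_one 6
    (by norm_num [abs_of_pos] : |(3 / 4 : ℝ)| < 1)).bddAbove_range
  have hB0 : 0 ≤ B := by simpa using hB ⟨0, rfl⟩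
  refine ⟨4 * C * (c + 1) ^ 6 * (B + 1) + 1, by positivity, fun j => ?_⟩
  have h1 : ((j : ℝ) + 1) ^ 6 * (3 / 4) ^ (j + 1) ≤ B := by
    simpa using hB ⟨j + 1, rfl⟩
  have h2 : ((j : ℝ) + 1) ^ 6 ≤ B * (4 / 3) ^ (j + 1) := by
    have h3 : (3 / 4 : ℝ) ^ (j + 1) * (4 / 3) ^ (j + 1) = 1 := by
      rw [← mul_pow]; norm_num
    calc ((j : ℝ) + 1) ^ 6 = ((j : ℝ) + 1) ^ 6 * (3 / 4) ^ (j + 1) * (4 / 3) ^ (j + 1) := by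
          rw [mul_assoc, h3, mul_one]
      _ ≤ _ := by gcongr
  have h4 : (((c * j + c : ℕ) : ℝ) + 1) ^ 6 ≤ (c + 1) ^ 6 * (j + 1) ^ 6 := by
    rw [← mul_pow]
    gcongr
    push_cast
    nlinarith [(Nat.cast_nonneg j : (0 : ℝ) ≤ j), (Nat.cast_nonneg c : (0 : ℝ) ≤ c)]
  have hp : (0 : ℝ) < (4 / 3) ^ j := by positivity
  calc (C : ℝ) * ((c * j + c : ℕ) + 1) ^ 6 ≤ C * ((c + 1) ^ 6 * (B * (4 / 3) ^ (j + 1))) := by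
        gcongr
        exact h4.trans (by gcongr)
    _ = (4 * C * (c + 1) ^ 6 * B) / 3 * (4 / 3) ^ j := by ring
    _ ≤ _ := by
        gcongr
        have : (0 : ℝ) ≤ C * (c + 1) ^ 6 := by positivity
        nlinarith

/-- A connected set described by at most `δ` sign conditions of degree at most `δ`. -/
def IsPlanarCell (δ : ℕ) (E : Set (ℝ × ℝ)) : Prop :=
  IsConnected E ∧ ∃ S : Finset (MvPolynomial (Fin 3) ℝ), S.card ≤ δ ∧
    (∀ g ∈ S, g.totalDegree ≤ δ) ∧ ∃ p, E = {q | ∀ g ∈ S,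
      SignType.sign (planarEval g q) = SignType.sign (planarEval g p)}

/-- The members of `𝒜` have constant sign on `E`. -/
def SignInvariant (𝒜 : Finset (MvPolynomial (Fin 3) ℝ)) (E : Set (ℝ × ℝ)) : Prop :=
  ∀ g ∈ 𝒜, ∀ p ∈ E, ∀ q ∈ E,
    SignType.sign (planarEval g p) = SignType.sign (planarEval g q)

lemma SignInvariant.mono {𝒜 ℬ : Finset (MvPolynomial (Fin 3) ℝ)} {E : Set (ℝ × ℝ)}
    (h : SignInvariant ℬ E) (hs : 𝒜 ⊆ ℬ) : SignInvariant 𝒜 E := fun g hg => h g (hs hg)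

lemma SignInvariant.eq_zero {𝒜 : Finset (MvPolynomial (Fin 3) ℝ)} {E : Set (ℝ × ℝ)}
    (h : SignInvariant 𝒜 E) {g : MvPolynomial (Fin 3) ℝ} (hg : g ∈ 𝒜) {p q : ℝ × ℝ} (hp : p ∈ E)
    (hq : q ∈ E) (h0 : planarEval g p = 0) : planarEval g q = 0 := by
  have := h g hg p hp q hq
  rw [h0, sign_zero] at this
  exact sign_eq_zero_iff.1 this.symm

/-- Decompositions `𝒞 i` of the facets `T i`, `i ∈ S`, into cells on which the polynomials of
`𝒜 i` have constant sign, such that the lifted cells have acyclic depth relation. -/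
structure IsAcyclicDecomposition {ι : Type} (T : ι → Facet) (δ : ℕ) (S : Finset ι)
    (𝒜 : ι → Finset (MvPolynomial (Fin 3) ℝ)) (𝒞 : ι → Finset (Set (ℝ × ℝ))) : Prop where
  isPlanarCell : ∀ i ∈ S, ∀ E ∈ 𝒞 i, IsPlanarCell δ E
  signInvariant : ∀ i ∈ S, ∀ E ∈ 𝒞 i, SignInvariant (𝒜 i) E
  subset_region : ∀ i ∈ S, ∀ E ∈ 𝒞 i, E ⊆ (T i).region
  eq_of_mem : ∀ i ∈ S, ∀ E ∈ 𝒞 i, ∀ E' ∈ 𝒞 i, ∀ p, p ∈ E → p ∈ E' → E = E'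
  exists_mem : ∀ i ∈ S, ∀ p ∈ (T i).region, ∃ E ∈ 𝒞 i, p ∈ E
  not_cycle : ∀ (k : ℕ) (o : Fin (k + 1) → ι) (C : Fin (k + 1) → Set (ℝ × ℝ)),
    (∀ a, o a ∈ S) → (∀ a, C a ∈ 𝒞 (o a)) →
    ¬ ∀ a, ∃ p ∈ C a, p ∈ C (a + 1) ∧
      planarEval (T (o a)).height p < planarEval (T (o (a + 1))).height p

open Classical in
/-- Decompositions of the facets whose edge lines meet the cells `O j` of a polynomial partition,
together with cell decompositions of all facets, combine to an acyclic decomposition. -/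
lemma IsAcyclicDecomposition.combine {ι : Type} {T : ι → Facet} (hT : PairwiseSeparated T) {δ : ℕ}
    {S : Finset ι} {𝒜 ℬ : ι → Finset (MvPolynomial (Fin 3) ℝ)} {F : MvPolynomial (Fin 3) ℝ}
    (hF : F ≠ 0) {J : Type} [Fintype J] {O : J → Set (Fin 3 → ℝ)}
    (hO : ∀ i j, i ≠ j → Disjoint (O i) (O j)) (hOF : ∀ j, ∀ x ∈ O j, MvPolynomial.eval x F ≠ 0)
    (hσ : ∀ σ, σ.Nonempty → IsPreconnected σ → (∀ x ∈ σ, MvPolynomial.eval x F ≠ 0) →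
      ∃ j, σ ⊆ O j)
    (hℬ𝒜 : ∀ i, 𝒜 i ⊆ ℬ i) (hℬF : ∀ i, guardFamily F ⊆ ℬ i) (hℬp : ∀ i, (T i).pullback F ∈ ℬ i)
    (hℬe : ∀ i l, (T i).edge l ∈ ℬ i)
    {𝒟 : ι → Finset (Set (ℝ × ℝ))} (h𝒟c : ∀ i, ∀ E ∈ 𝒟 i, IsPlanarCell δ E)
    (h𝒟s : ∀ i, ∀ E ∈ 𝒟 i, SignInvariant (ℬ i) E)
    (h𝒟u : ∀ i, ∀ E ∈ 𝒟 i, ∀ E' ∈ 𝒟 i, ∀ p, p ∈ E → p ∈ E' → E = E')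
    (h𝒟m : ∀ i p, ∃ E ∈ 𝒟 i, p ∈ E)
    {𝒞 : J → ι → Finset (Set (ℝ × ℝ))}
    (h𝒞 : ∀ j, IsAcyclicDecomposition T δ (S.filter fun i => (T i).EdgeMeets (O j)) ℬ (𝒞 j)) :
    ∃ 𝒬 : ι → Finset (Set (ℝ × ℝ)), IsAcyclicDecomposition T δ S 𝒜 𝒬 ∧
      ∑ i ∈ S, (𝒬 i).card ≤ ∑ i ∈ S, (𝒟 i).card +
        ∑ j, ∑ i ∈ S.filter (fun i => (T i).EdgeMeets (O j)), (𝒞 j i).card := by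
  set R : ι → J → Set (ℝ × ℝ) → Prop := fun i j E =>
    (T i).EdgeMeets (O j) ∧ ∀ p ∈ E, (T i).lift p ∈ O j with hR
  set 𝒬₁ : ι → Finset (Set (ℝ × ℝ)) := fun i =>
    (𝒟 i).filter fun E => E ⊆ (T i).region ∧ ¬ ∃ j, R i j E with h𝒬₁
  set 𝒬₂ : ι → Finset (Set (ℝ × ℝ)) := fun i =>
    (Finset.univ.filter fun j => (T i).EdgeMeets (O j)).biUnion fun j =>
      (𝒞 j i).filter fun E => R i j E with h𝒬₂
  have hmem₁ : ∀ i E, E ∈ 𝒬₁ i ↔ E ∈ 𝒟 i ∧ E ⊆ (T i).region ∧ ¬ ∃ j, R i j E := by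
    intro i E
    simp only [h𝒬₁, Finset.mem_filter]
  have hmem₂ : ∀ i E, E ∈ 𝒬₂ i ↔ ∃ j, (T i).EdgeMeets (O j) ∧ E ∈ 𝒞 j i ∧ R i j E := by
    intro i E
    simp only [h𝒬₂, Finset.mem_biUnion, Finset.mem_filter, Finset.mem_univ, true_and]
  have hmemS : ∀ {i j}, i ∈ S → (T i).EdgeMeets (O j) →
      i ∈ S.filter fun i => (T i).EdgeMeets (O j) := fun hi hj => Finset.mem_filter.2 ⟨hi, hj⟩
  have hcell : ∀ i ∈ S, ∀ E ∈ 𝒬₁ i ∪ 𝒬₂ i,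
      IsPlanarCell δ E ∧ SignInvariant (ℬ i) E ∧ E ⊆ (T i).region := by
    intro i hi E hE
    rcases Finset.mem_union.1 hE with h | h
    · obtain ⟨h1, h2, -⟩ := (hmem₁ i E).1 h
      exact ⟨h𝒟c i E h1, h𝒟s i E h1, h2⟩
    · obtain ⟨j, h1, h2, -⟩ := (hmem₂ i E).1 h
      exact ⟨(h𝒞 j).isPlanarCell i (hmemS hi h1) E h2, (h𝒞 j).signInvariant i (hmemS hi h1) E h2,
        (h𝒞 j).subset_region i (hmemS hi h1) E h2⟩
  have hOeq : ∀ {x i j}, x ∈ O i → x ∈ O j → i = j := by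
    intro x i j hi hj
    by_contra hne
    exact Set.disjoint_left.1 (hO i j hne) hi hj
  have hspread : ∀ i j E, IsConnected E → SignInvariant (ℬ i) E → ∀ p ∈ E, (T i).lift p ∈ O j →
      ∀ q ∈ E, (T i).lift q ∈ O j := by
    intro i j E hE hs p hp hpj q hq
    obtain ⟨j', hj'⟩ := hσ ((T i).lift '' E) (hE.nonempty.image _)
      (hE.isPreconnected.image _ (T i).continuous_lift.continuousOn) (by
        rintro _ ⟨r, hr, rfl⟩ h0
        rw [← Facet.planarEval_pullback] at h0
        have := hs.eq_zero (hℬp i) hr hp h0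
        rw [Facet.planarEval_pullback] at this
        exact hOF j _ hpj this)
    have := hOeq (hj' ⟨p, hp, rfl⟩) hpj
    subst this
    exact hj' ⟨q, hq, rfl⟩
  refine ⟨fun i => 𝒬₁ i ∪ 𝒬₂ i, ⟨fun i hi E hE => (hcell i hi E hE).1,
    fun i hi E hE => (hcell i hi E hE).2.1.mono (hℬ𝒜 i), fun i hi E hE => (hcell i hi E hE).2.2,
    ?_, ?_, ?_⟩, ?_⟩
  · have hmixed : ∀ i ∈ S, ∀ E ∈ 𝒬₁ i, ∀ E' ∈ 𝒬₂ i, ∀ p, p ∈ E → p ∉ E' := by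
      intro i hi E hE E' hE' p hp hp'
      obtain ⟨h1, h2, h3⟩ := (hmem₁ i E).1 hE
      obtain ⟨j, h4, h5, h6⟩ := (hmem₂ i E').1 hE'
      exact h3 ⟨j, h4, hspread i j E (h𝒟c i E h1).1 (h𝒟s i E h1) p hp (h6.2 p hp')⟩
    intro i hi E hE E' hE' p hp hp'
    rcases Finset.mem_union.1 hE with hE | hE <;> rcases Finset.mem_union.1 hE' with hE' | hE'
    · exact h𝒟u i E ((hmem₁ i E).1 hE).1 E' ((hmem₁ i E').1 hE').1 p hp hp'
    · exact absurd hp' (hmixed i hi E hE E' hE' p hp)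
    · exact absurd hp (hmixed i hi E' hE' E hE p hp')
    · obtain ⟨j, h1, h2, h3⟩ := (hmem₂ i E).1 hE
      obtain ⟨j', h1', h2', h3'⟩ := (hmem₂ i E').1 hE'
      have := hOeq (h3.2 p hp) (h3'.2 p hp')
      subst this
      exact (h𝒞 j).eq_of_mem i (hmemS hi h1) E h2 E' h2' p hp hp'
  · intro i hi p hp
    obtain ⟨E, hE, hpE⟩ := h𝒟m i p
    have hEr : E ⊆ (T i).region := by
      intro q hq l
      have := h𝒟s i E hE _ (hℬe i l) p hpE q hq
      rw [← sign_nonneg_iff, ← this, sign_nonneg_iff]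
      exact hp l
    by_cases hj : ∃ j, R i j E
    · obtain ⟨j, h1, h2⟩ := hj
      obtain ⟨E', hE', hpE'⟩ := (h𝒞 j).exists_mem i (hmemS hi h1) p hp
      refine ⟨E', Finset.mem_union_right _ ((hmem₂ i E').2 ⟨j, h1, hE', h1, ?_⟩), hpE'⟩
      exact hspread i j E' ((h𝒞 j).isPlanarCell i (hmemS hi h1) E' hE').1
        ((h𝒞 j).signInvariant i (hmemS hi h1) E' hE') p hpE' (h2 p hpE)
    · exact ⟨E, Finset.mem_union_left _ ((hmem₁ i E).2 ⟨hE, hEr, hj⟩), hpE⟩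
  · intro k o C ho hC hlt
    have hcell' := fun a => hcell (o a) (ho a) (C a) (hC a)
    obtain ⟨σ, h1, h2, h3⟩ := exists_isPreconnected_of_cycle hT hF
      (fun a => (hcell' a).1.1.isPreconnected) (fun a => (hcell' a).2.2)
      (fun a g hg p hp q hq h0 => (hcell' a).2.1.eq_zero (hℬF _ hg) hp hq h0)
      (fun a p hp q hq h0 => by
        rw [← Facet.planarEval_pullback] at h0 ⊢
        exact (hcell' a).2.1.eq_zero (hℬp _) hp hq h0) hlt
    have hne : ∀ a, ∃ p, p ∈ C a := fun a => (hcell' a).1.1.nonempty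
    obtain ⟨p₀, hp₀⟩ := hne 0
    obtain ⟨j, hj⟩ := hσ σ ⟨_, (h3 0).1 p₀ hp₀⟩ h1 h2
    refine (h𝒞 j).not_cycle k o C (fun a => hmemS (ho a) ((h3 a).2.mono hj)) (fun a => ?_) hlt
    rcases Finset.mem_union.1 (hC a) with h | h
    · exact absurd ⟨j, (h3 a).2.mono hj, fun p hp => hj ((h3 a).1 p hp)⟩ ((hmem₁ _ _).1 h).2.2
    · obtain ⟨j', h4, h5, h6⟩ := (hmem₂ _ _).1 h
      obtain ⟨p, hp⟩ := hne a
      have := hOeq (h6.2 p hp) (hj ((h3 a).1 p hp))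
      subst this
      exact h5
  · calc ∑ i ∈ S, (𝒬₁ i ∪ 𝒬₂ i).card ≤ ∑ i ∈ S, ((𝒟 i).card +
          ∑ j, if (T i).EdgeMeets (O j) then (𝒞 j i).card else 0) := by
          refine Finset.sum_le_sum fun i _ => (Finset.card_union_le _ _).trans ?_
          refine Nat.add_le_add (Finset.card_filter_le _ _) (Finset.card_biUnion_le.trans ?_)
          rw [Finset.sum_filter]
          refine Finset.sum_le_sum fun j _ => ?_
          split_ifs
          · exact Finset.card_filter_le _ _
          · exact le_rfl
      _ = _ := by
          rw [Finset.sum_add_distrib, Finset.sum_comm]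
          simp only [Finset.sum_filter]

open Classical in
/-- Finitely many separated facets admit acyclic decompositions with few cells. -/
theorem exists_isAcyclicDecomposition {α : ℝ} (hα : 3 / 2 < α) : ∃ (A : ℝ) (δ : ℕ), 0 < A ∧
    ∀ (ι : Type) (T : ι → Facet), PairwiseSeparated T → ∀ S : Finset ι,
      ∃ 𝒞 : ι → Finset (Set (ℝ × ℝ)), IsAcyclicDecomposition T δ S (fun _ => ∅) 𝒞 ∧
        ∑ i ∈ S, ((𝒞 i).card : ℝ) ≤ A * (S.card : ℝ) ^ α := by
  obtain ⟨D, hD⟩ := exists_facet_partition hα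
  obtain ⟨K₀, N, hN⟩ := exists_guardFamily_bound D
  set K := max K₀ (max D 1) with hK
  obtain ⟨C, hC⟩ := exists_planar_cells K
  set c := N + 4 with hc
  obtain ⟨A, hA, hAj⟩ := exists_pow_six_le c C
  refine ⟨A, 2 * K + 4, hA, fun ι T hT => ?_⟩
  suffices h : ∀ (n : ℕ) (S : Finset ι), S.card = n → ∀ (j : ℕ)
      (𝒜 : ι → Finset (MvPolynomial (Fin 3) ℝ)), (∀ i, (𝒜 i).card ≤ c * j) →
      (∀ i, ∀ g ∈ 𝒜 i, g.totalDegree ≤ K) →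
      ∃ 𝒞 : ι → Finset (Set (ℝ × ℝ)), IsAcyclicDecomposition T (2 * K + 4) S 𝒜 𝒞 ∧
        ∑ i ∈ S, ((𝒞 i).card : ℝ) ≤ A * (4 / 3) ^ j * (S.card : ℝ) ^ α by
    intro S
    simpa using h S.card S rfl 0 (fun _ => ∅) (by simp) (by simp)
  intro n
  induction n using Nat.strong_induction_on with
  | _ n ih =>
  intro S hS j 𝒜 h𝒜c h𝒜K
  rcases S.eq_empty_or_nonempty with rfl | hSne
  · refine ⟨fun _ => ∅, ⟨by simp, by simp, by simp, by simp, by simp, ?_⟩, ?_⟩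
    · exact fun k o C ho => absurd (ho 0) (by simp)
    · rw [Finset.sum_empty]
      positivity
  obtain ⟨F, J, hJ, O, hF, hFD, hO, hOF, hσ, hsum⟩ := hD ι T S
  obtain ⟨hFN, hFK⟩ := hN F hFD
  set ℬ : ι → Finset (MvPolynomial (Fin 3) ℝ) := fun i =>
    𝒜 i ∪ (guardFamily F ∪ insert ((T i).pullback F) (Finset.univ.image (T i).edge)) with hℬ
  have hℬc : ∀ i, (ℬ i).card ≤ c * (j + 1) := by
    intro i
    refine (Finset.card_union_le _ _).trans ?_
    have h1 := Finset.card_union_le (guardFamily F)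
      (insert ((T i).pullback F) (Finset.univ.image (T i).edge))
    have h2 := Finset.card_insert_le ((T i).pullback F) (Finset.univ.image (T i).edge)
    have h3 : (Finset.univ.image (T i).edge).card ≤ 3 := by
      simpa using Finset.card_image_le (s := (Finset.univ : Finset (Fin 3))) (f := (T i).edge)
    have h4 := h𝒜c i
    rw [Nat.mul_succ]
    omega
  have hℬK : ∀ i, ∀ g ∈ ℬ i, g.totalDegree ≤ K := by
    intro i g hg
    simp only [hℬ, Finset.mem_union, Finset.mem_insert, Finset.mem_image, Finset.mem_univ,
      true_and] at hg
    rcases hg with hg | hg | rfl | ⟨l, rfl⟩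
    · exact h𝒜K i g hg
    · exact (hFK g hg).trans (le_max_left _ _)
    · exact ((T i).totalDegree_pullback_le F).trans
        (hFD.trans ((le_max_left _ _).trans (le_max_right _ _)))
    · exact ((T i).totalDegree_edge l).trans ((le_max_right _ _).trans (le_max_right _ _))
  have hSpos : (0 : ℝ) < (S.card : ℝ) ^ α := Real.rpow_pos_of_pos (by
    exact_mod_cast hSne.card_pos) _
  have hlt : ∀ u, (S.filter fun i => (T i).EdgeMeets (O u)).card < n := by
    intro u
    have h1 := (Finset.single_le_sum (f := fun u =>
      ((S.filter fun i => (T i).EdgeMeets (O u)).card : ℝ) ^ α)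
      (fun _ _ => by positivity) (Finset.mem_univ u)).trans hsum
    have h2 : ((S.filter fun i => (T i).EdgeMeets (O u)).card : ℝ) ^ α < (S.card : ℝ) ^ α := by
      linarith
    have h3 := (Real.rpow_lt_rpow_iff (Nat.cast_nonneg _) (Nat.cast_nonneg _)
      (by linarith : 0 < α)).1 h2
    rw [← hS]
    exact_mod_cast h3
  choose 𝒞 h𝒞 h𝒞sum using fun u => ih _ (hlt u) _ rfl (j + 1) ℬ hℬc hℬK
  choose 𝒟 h𝒟c h𝒟 h𝒟u h𝒟m using fun i => hC (ℬ i) (hℬK i)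
  obtain ⟨𝒬, h𝒬, h𝒬c⟩ := IsAcyclicDecomposition.combine (𝒜 := 𝒜) hT hF hO hOF hσ
    (fun i => Finset.subset_union_left)
    (fun i => Finset.subset_union_left.trans Finset.subset_union_right)
    (fun i => Finset.mem_union_right _ (Finset.mem_union_right _ (Finset.mem_insert_self _ _)))
    (fun i l => Finset.mem_union_right _ (Finset.mem_union_right _ (Finset.mem_insert_of_mem
      (Finset.mem_image_of_mem _ (Finset.mem_univ l)))))
    (𝒟 := 𝒟) (fun i E hE => by
      obtain ⟨h1, -, X, h3, h4, h5⟩ := h𝒟 i E hE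
      exact ⟨h1, X, h3, fun g hg => (h4 g hg).trans (by omega), h5⟩)
    (fun i E hE => (h𝒟 i E hE).2.1) h𝒟u h𝒟m h𝒞
  refine ⟨𝒬, h𝒬, ?_⟩
  have h1 : ∑ i ∈ S, ((𝒬 i).card : ℝ) ≤ ∑ i ∈ S, ((𝒟 i).card : ℝ) +
      ∑ u, ∑ i ∈ S.filter (fun i => (T i).EdgeMeets (O u)), ((𝒞 u i).card : ℝ) := by
    exact_mod_cast h𝒬c
  have h2 : ∑ i ∈ S, ((𝒟 i).card : ℝ) ≤ A / 3 * (4 / 3) ^ j * (S.card : ℝ) ^ α := by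
    have h3 : ∀ i ∈ S, ((𝒟 i).card : ℝ) ≤ A / 3 * (4 / 3) ^ j := by
      intro i _
      refine le_trans ?_ (hAj j)
      have h4 : (𝒟 i).card ≤ C * (c * j + c + 1) ^ 6 := by
        refine (h𝒟c i).trans ?_
        have := hℬc i
        rw [Nat.mul_succ] at this
        gcongr
      exact_mod_cast h4
    have h5 := Finset.sum_le_card_nsmul S (fun i => ((𝒟 i).card : ℝ)) _ h3
    rw [nsmul_eq_mul] at h5
    have h6 : (S.card : ℝ) ≤ (S.card : ℝ) ^ α := by
      refine Real.self_le_rpow_of_one_le ?_ (by linarith)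
      exact_mod_cast hSne.card_pos
    calc _ ≤ (S.card : ℝ) * (A / 3 * (4 / 3) ^ j) := h5
      _ ≤ (S.card : ℝ) ^ α * (A / 3 * (4 / 3) ^ j) := by gcongr
      _ = _ := mul_comm _ _
  have h3 : ∑ u, ∑ i ∈ S.filter (fun i => (T i).EdgeMeets (O u)), ((𝒞 u i).card : ℝ) ≤
      A * (4 / 3) ^ (j + 1) * (1 / 2 * (S.card : ℝ) ^ α) := by
    refine (Finset.sum_le_sum fun u _ => h𝒞sum u).trans ?_
    rw [← Finset.mul_sum]
    gcongr
  calc _ ≤ _ := h1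
    _ ≤ A / 3 * (4 / 3) ^ j * (S.card : ℝ) ^ α +
        A * (4 / 3) ^ (j + 1) * (1 / 2 * (S.card : ℝ) ^ α) := add_le_add h2 h3
    _ = _ := by ring

/-- Twice the signed area of the projection of a triangle to the `xy`-plane. -/
def planarArea (v : Fin 3 → Fin 3 → ℝ) : ℝ :=
  (v 1 0 - v 0 0) * (v 2 1 - v 0 1) - (v 1 1 - v 0 1) * (v 2 0 - v 0 0)

/-- The barycentric coordinates with respect to the projection of a triangle. -/
noncomputable def baryPoly (v : Fin 3 → Fin 3 → ℝ) (j : Fin 3) : MvPolynomial (Fin 3) ℝ :=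
  MvPolynomial.C ((v (j + 1) 1 - v (j + 2) 1) / planarArea v) * MvPolynomial.X 0 +
    MvPolynomial.C ((v (j + 2) 0 - v (j + 1) 0) / planarArea v) * MvPolynomial.X 1 +
    MvPolynomial.C ((v (j + 1) 0 * v (j + 2) 1 - v (j + 1) 1 * v (j + 2) 0) / planarArea v)

lemma planarEval_baryPoly (v : Fin 3 → Fin 3 → ℝ) (j : Fin 3) (p : ℝ × ℝ) :
    planarEval (baryPoly v j) p = (v (j + 1) 1 - v (j + 2) 1) / planarArea v * p.1 +
      (v (j + 2) 0 - v (j + 1) 0) / planarArea v * p.2 +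
      (v (j + 1) 0 * v (j + 2) 1 - v (j + 1) 1 * v (j + 2) 0) / planarArea v := by
  simp [planarEval, baryPoly]

lemma totalDegree_baryPoly (v : Fin 3 → Fin 3 → ℝ) (j : Fin 3) :
    (baryPoly v j).totalDegree ≤ 1 := by
  have h : ∀ (a : ℝ) (i : Fin 3),
      (MvPolynomial.C a * MvPolynomial.X i : MvPolynomial (Fin 3) ℝ).totalDegree ≤ 1 := by
    intro a i
    refine (MvPolynomial.totalDegree_mul _ _).trans ?_
    simp
  refine (MvPolynomial.totalDegree_add _ _).trans (max_le ?_ (by simp))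
  exact (MvPolynomial.totalDegree_add _ _).trans (max_le (h _ _) (h _ _))

lemma sum_planarEval_baryPoly {v : Fin 3 → Fin 3 → ℝ} (hv : planarArea v ≠ 0) (p : ℝ × ℝ) :
    ∑ j, planarEval (baryPoly v j) p = 1 := by
  simp only [Fin.sum_univ_three, planarEval_baryPoly, Fin.isValue, Fin.reduceAdd, zero_add]
  field_simp
  rw [planarArea]
  ring

lemma sum_planarEval_baryPoly_mul_zero {v : Fin 3 → Fin 3 → ℝ} (hv : planarArea v ≠ 0)
    (p : ℝ × ℝ) : ∑ j, planarEval (baryPoly v j) p * v j 0 = p.1 := by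
  simp only [Fin.sum_univ_three, planarEval_baryPoly, Fin.isValue, Fin.reduceAdd, zero_add]
  field_simp
  rw [planarArea]
  ring

lemma sum_planarEval_baryPoly_mul_one {v : Fin 3 → Fin 3 → ℝ} (hv : planarArea v ≠ 0)
    (p : ℝ × ℝ) : ∑ j, planarEval (baryPoly v j) p * v j 1 = p.2 := by
  simp only [Fin.sum_univ_three, planarEval_baryPoly, Fin.isValue, Fin.reduceAdd, zero_add]
  field_simp
  rw [planarArea]
  ring

lemma planarEval_baryPoly_vertex {v : Fin 3 → Fin 3 → ℝ} (hv : planarArea v ≠ 0) (i j : Fin 3) :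
    planarEval (baryPoly v j) (v i 0, v i 1) = if i = j then 1 else 0 := by
  rw [planarEval_baryPoly]
  fin_cases i <;> fin_cases j <;> simp <;> field_simp <;> simp only [planarArea] <;> ring

/-- The height of the plane through a triangle. -/
noncomputable def heightPoly (v : Fin 3 → Fin 3 → ℝ) : MvPolynomial (Fin 3) ℝ :=
  ∑ j, MvPolynomial.C (v j 2) * baryPoly v j

lemma planarEval_heightPoly (v : Fin 3 → Fin 3 → ℝ) (p : ℝ × ℝ) :
    planarEval (heightPoly v) p = ∑ j, planarEval (baryPoly v j) p * v j 2 := by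
  simp [planarEval, heightPoly, mul_comm]

lemma sum_planarEval_baryPoly_smul {v : Fin 3 → Fin 3 → ℝ} (hv : planarArea v ≠ 0) (p : ℝ × ℝ) :
    ∑ j, planarEval (baryPoly v j) p • v j = ![p.1, p.2, planarEval (heightPoly v) p] := by
  ext i
  rw [Finset.sum_apply]
  simp only [Pi.smul_apply, smul_eq_mul]
  fin_cases i
  · exact sum_planarEval_baryPoly_mul_zero hv p
  · exact sum_planarEval_baryPoly_mul_one hv p
  · exact (planarEval_heightPoly v p).symm

/-- The facet spanned by the vertices `v`. -/
noncomputable def Facet.ofVertices (v : Fin 3 → Fin 3 → ℝ) (hv : planarArea v ≠ 0) : Facet where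
  height := heightPoly v
  edge := baryPoly v
  base j := v (j + 1)
  dir j := v (j + 2) - v (j + 1)
  totalDegree_height := by
    refine MvPolynomial.totalDegree_finsetSum_le fun j _ => ?_
    refine (MvPolynomial.totalDegree_mul _ _).trans ?_
    rw [MvPolynomial.totalDegree_C, zero_add]
    exact totalDegree_baryPoly v j
  totalDegree_edge := totalDegree_baryPoly v
  dir_ne j := by
    by_contra! h
    simp only [Pi.sub_apply, sub_eq_zero] at h
    refine hv ?_
    fin_cases j <;> simp at h <;> rw [planarArea, h.1, h.2] <;> ring
  exists_param j p h := by
    refine ⟨planarEval (baryPoly v (j + 2)) p, ?_⟩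
    have h1 := sum_planarEval_baryPoly hv p
    rw [← sum_planarEval_baryPoly_smul hv p]
    rw [Fin.sum_univ_three] at h1 ⊢
    ext i
    simp only [Pi.add_apply, Pi.smul_apply, Pi.sub_apply, smul_eq_mul]
    fin_cases j <;> simp only [Fin.isValue, Fin.zero_eta, Fin.mk_one, Fin.reduceFinMk,
      Fin.reduceAdd, zero_add] at h h1 ⊢ <;> rw [h] at h1 ⊢ <;> linear_combination (-h1) * v _ i

lemma convexHull_eq_ofVertices (v : Fin 3 → Fin 3 → ℝ) (hv : planarArea v ≠ 0) :
    convexHull ℝ (Set.range v) = (Facet.ofVertices v hv).lift '' (Facet.ofVertices v hv).region := by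
  apply Set.Subset.antisymm
  · refine convexHull_min ?_ ?_
    · rintro _ ⟨i, rfl⟩
      refine ⟨(v i 0, v i 1), fun j => ?_, ?_⟩
      · refine le_of_le_of_eq ?_ (planarEval_baryPoly_vertex hv i j).symm
        split_ifs <;> norm_num
      · refine (sum_planarEval_baryPoly_smul hv _).symm.trans ?_
        simp [planarEval_baryPoly_vertex hv]
    · rintro _ ⟨p, hp, rfl⟩ _ ⟨q, hq, rfl⟩ s t hs ht hst
      have key : ∀ j, planarEval (baryPoly v j) (s * p.1 + t * q.1, s * p.2 + t * q.2) =
          s * planarEval (baryPoly v j) p + t * planarEval (baryPoly v j) q := by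
        intro j
        simp only [planarEval_baryPoly]
        linear_combination
          (-((v (j + 1) 0 * v (j + 2) 1 - v (j + 1) 1 * v (j + 2) 0) / planarArea v)) * hst
      refine ⟨(s * p.1 + t * q.1, s * p.2 + t * q.2), fun j => ?_, ?_⟩
      · exact le_of_le_of_eq (add_nonneg (mul_nonneg hs (hp j)) (mul_nonneg ht (hq j)))
          (key j).symm
      · refine (sum_planarEval_baryPoly_smul hv _).symm.trans ?_
        have h1 := sum_planarEval_baryPoly_smul hv p
        have h2 := sum_planarEval_baryPoly_smul hv q
        change _ = s • ![p.1, p.2, planarEval (heightPoly v) p] +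
          t • ![q.1, q.2, planarEval (heightPoly v) q]
        rw [← h1, ← h2, Finset.smul_sum, Finset.smul_sum, ← Finset.sum_add_distrib]
        refine Finset.sum_congr rfl fun j _ => ?_
        rw [key, add_smul, mul_smul, mul_smul]
  · rintro _ ⟨p, hp, rfl⟩
    have h : (Facet.ofVertices v hv).lift p = ∑ j, planarEval (baryPoly v j) p • v j :=
      (sum_planarEval_baryPoly_smul hv p).symm
    rw [h]
    exact (convex_convexHull ℝ _).sum_mem (fun j _ => hp j) (sum_planarEval_baryPoly hv p)
      fun j _ => subset_convexHull ℝ _ ⟨j, rfl⟩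

lemma planarArea_ne_zero {v : Fin 3 → Fin 3 → ℝ} (hv : AffineIndependent ℝ v)
    (h : (![0, 0, 1] : Fin 3 → ℝ) ∉ (affineSpan ℝ (Set.range v)).direction) :
    planarArea v ≠ 0 := by
  intro h0
  obtain ⟨w, hw, hw0⟩ := (Matrix.exists_mulVec_eq_zero_iff
    (M := !![v 1 0 - v 0 0, v 2 0 - v 0 0; v 1 1 - v 0 1, v 2 1 - v 0 1])).2 (by
      rw [Matrix.det_fin_two_of, ← h0, planarArea]
      ring)
  have e0 := congrFun hw0 0
  have e1 := congrFun hw0 1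
  simp [Matrix.mulVec, dotProduct] at e0 e1
  set z := w 0 * (v 1 2 - v 0 2) + w 1 * (v 2 2 - v 0 2) with hz
  have hsum : w 0 • (v 1 - v 0) + w 1 • (v 2 - v 0) = z • ![0, 0, 1] := by
    ext i
    fin_cases i
    · simp
      linarith
    · simp
      linarith
    · simp [hz]
  by_cases hz0 : z = 0
  · rw [hz0, zero_smul] at hsum
    have h3 := affineIndependent_iff.1 hv Finset.univ ![-(w 0 + w 1), w 0, w 1]
      (by simp [Fin.sum_univ_three])
      (by
        rw [Fin.sum_univ_three, ← hsum]
        simp only [Matrix.cons_val]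
        module)
    refine hw ?_
    ext i
    fin_cases i
    · exact h3 1 (Finset.mem_univ _)
    · exact h3 2 (Finset.mem_univ _)
  · refine h ?_
    have hm : ∀ i, v i ∈ affineSpan ℝ (Set.range v) := fun i => mem_affineSpan ℝ ⟨i, rfl⟩
    have h4 : (![0, 0, 1] : Fin 3 → ℝ) = z⁻¹ • (w 0 • (v 1 - v 0) + w 1 • (v 2 - v 0)) := by
      rw [hsum, smul_smul, inv_mul_cancel₀ hz0, one_smul]
    rw [h4]
    exact Submodule.smul_mem _ _ (Submodule.add_mem _
      (Submodule.smul_mem _ _ (AffineSubspace.vsub_mem_direction (hm 1) (hm 0)))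
      (Submodule.smul_mem _ _ (AffineSubspace.vsub_mem_direction (hm 2) (hm 0))))

lemma IsNonVerticalTriangle.exists_facet {s : Set (Fin 3 → ℝ)} (hs : IsNonVerticalTriangle s) :
    ∃ Δ : Facet, s = Δ.lift '' Δ.region := by
  obtain ⟨a, b, c, h, rfl, hd⟩ := hs
  have hr : Set.range ![a, b, c] = {a, b, c} := by
    rw [Matrix.range_cons, Matrix.range_cons, Matrix.range_cons, Matrix.range_empty,
      Set.union_empty]
    rfl
  rw [← hr] at hd ⊢
  exact ⟨_, convexHull_eq_ofVertices _ (planarArea_ne_zero h hd)⟩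

lemma Facet.mem_lift_image {Δ : Facet} {E : Set (ℝ × ℝ)} {x : Fin 3 → ℝ} :
    x ∈ Δ.lift '' E ↔ (x 0, x 1) ∈ E ∧ x 2 = planarEval Δ.height (x 0, x 1) := by
  constructor
  · rintro ⟨p, hp, rfl⟩
    exact ⟨hp, rfl⟩
  · rintro ⟨h1, h2⟩
    refine ⟨_, h1, ?_⟩
    ext i
    fin_cases i
    · rfl
    · rfl
    · exact h2.symm

/-- A polynomial in the first two variables with the planar values of `F`. -/
noncomputable def flatten (F : MvPolynomial (Fin 3) ℝ) : MvPolynomial (Fin 3) ℝ :=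
  MvPolynomial.aeval ![MvPolynomial.X 0, MvPolynomial.X 1, 0] F

lemma eval_flatten (F : MvPolynomial (Fin 3) ℝ) (x : Fin 3 → ℝ) :
    MvPolynomial.eval x (flatten F) = planarEval F (x 0, x 1) := by
  rw [flatten, planarEval, ← MvPolynomial.coe_aeval_eq_eval, ← MvPolynomial.coe_aeval_eq_eval]
  simp only [RingHom.coe_coe]
  rw [← AlgHom.comp_apply]
  refine congrArg (fun f : MvPolynomial (Fin 3) ℝ →ₐ[ℝ] ℝ => f F) ?_
  ext i
  fin_cases i <;> simp

lemma totalDegree_flatten_le (F : MvPolynomial (Fin 3) ℝ) :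
    (flatten F).totalDegree ≤ F.totalDegree := by
  refine totalDegree_aeval_le F _ fun i => ?_
  fin_cases i <;> simp

lemma exists_sign_predicate (y : ℝ) : ∃ c : ℝ → Prop,
    (c = (· = 0) ∨ c = (· < 0) ∨ c = (· ≤ 0) ∨ c = (0 < ·) ∨ c = (0 ≤ ·)) ∧
      ∀ x, c x ↔ SignType.sign x = SignType.sign y := by
  rcases lt_trichotomy y 0 with h | rfl | h
  · exact ⟨(· < 0), by simp, fun x => by rw [sign_neg h, sign_eq_neg_one_iff]⟩
  · exact ⟨(· = 0), by simp, fun x => by rw [sign_zero, sign_eq_zero_iff]⟩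
  · exact ⟨(0 < ·), by simp, fun x => by rw [sign_pos h, sign_eq_one_iff]⟩

lemma IsPlanarCell.semialgOfComplexity_lift {δ : ℕ} {E : Set (ℝ × ℝ)} (hE : IsPlanarCell δ E)
    (Δ : Facet) : SemialgOfComplexity (δ + 1) (Δ.lift '' E) := by
  obtain ⟨-, S, hS, hSδ, p, rfl⟩ := hE
  choose c hc hcs using fun i : Fin S.card =>
    exists_sign_predicate (planarEval (S.equivFin.symm i : MvPolynomial (Fin 3) ℝ) p)
  refine ⟨S.card + 1, by omega,
    Fin.cons (MvPolynomial.X 2 - flatten Δ.height)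
      fun i => flatten (S.equivFin.symm i : MvPolynomial (Fin 3) ℝ),
    Fin.cons (· = 0) c, ?_, ?_, ?_⟩
  · refine Fin.cases ?_ fun i => ?_
    · rw [Fin.cons_zero]
      refine (MvPolynomial.totalDegree_sub _ _).trans (max_le (by simp) ?_)
      exact (totalDegree_flatten_le _).trans (Δ.totalDegree_height.trans (by omega))
    · rw [Fin.cons_succ]
      exact (totalDegree_flatten_le _).trans
        ((hSδ _ (S.equivFin.symm i).2).trans (Nat.le_succ δ))
  · refine Fin.cases ?_ fun i => ?_
    · exact Or.inl rfl
    · exact hc i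
  · ext x
    rw [Facet.mem_lift_image]
    change _ ↔ ∀ i, _
    rw [Fin.forall_fin_succ]
    simp only [Fin.cons_zero, Fin.cons_succ, eval_flatten, map_sub, MvPolynomial.eval_X, hcs,
      sub_eq_zero]
    rw [and_comm]
    refine and_congr_right fun _ => ?_
    constructor
    · exact fun h i => h _ (S.equivFin.symm i).2
    · intro h g hg
      simpa using h (S.equivFin ⟨g, hg⟩)

lemma Facet.isConnected_lift {E : Set (ℝ × ℝ)} (hE : IsConnected E) (Δ : Facet) :
    IsConnected (Δ.lift '' E) :=
  hE.image _ Δ.continuous_lift.continuousOn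

lemma pairwiseSeparated_of_disjoint {ι : Type*} {T : ι → Facet}
    (h : ∀ i j, i ≠ j → Disjoint ((T i).lift '' (T i).region) ((T j).lift '' (T j).region)) :
    PairwiseSeparated T := by
  intro i j hij p hi hj he
  refine Set.disjoint_left.1 (h i j hij) ⟨p, hi, rfl⟩ ⟨p, hj, ?_⟩
  rw [Facet.lift, Facet.lift, he]

/-- Facets with an acyclic decomposition can be cut into pieces with acyclic depth relation. -/
lemma IsAcyclicDecomposition.exists_pieces {ι : Type} [Fintype ι] {T : ι → Facet} {δ : ℕ}
    {𝒜 : ι → Finset (MvPolynomial (Fin 3) ℝ)} {𝒞 : ι → Finset (Set (ℝ × ℝ))}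
    (hT : ∀ i j, i ≠ j → Disjoint ((T i).lift '' (T i).region) ((T j).lift '' (T j).region))
    (h𝒞 : IsAcyclicDecomposition T δ Finset.univ 𝒜 𝒞) :
    ∃ (piece : Fin (∑ i, (𝒞 i).card) → Set (Fin 3 → ℝ)) (owner : Fin (∑ i, (𝒞 i).card) → ι),
      (∀ p, IsConnected (piece p)) ∧
      (∀ p, SemialgOfComplexity (δ + 1) (piece p)) ∧
      (∀ p q, p ≠ q → Disjoint (piece p) (piece q)) ∧
      (∀ i, (T i).lift '' (T i).region = ⋃ p ∈ {p | owner p = i}, piece p) ∧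
      DepthAcyclic (Set.range piece) := by
  have hcard : Fintype.card (Σ i, 𝒞 i) = ∑ i, (𝒞 i).card := by simp
  let e : Fin (∑ i, (𝒞 i).card) ≃ Σ i, 𝒞 i := (Fintype.equivFinOfCardEq hcard).symm
  have hcell : ∀ p, IsPlanarCell δ (e p).2.1 := fun p =>
    h𝒞.isPlanarCell _ (Finset.mem_univ _) _ (e p).2.2
  have hsub : ∀ p, (e p).2.1 ⊆ (T (e p).1).region := fun p =>
    h𝒞.subset_region _ (Finset.mem_univ _) _ (e p).2.2
  refine ⟨fun p => (T (e p).1).lift '' (e p).2.1, fun p => (e p).1,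
    fun p => Facet.isConnected_lift (hcell p).1 _,
    fun p => (hcell p).semialgOfComplexity_lift _, ?_, ?_, ?_⟩
  · intro p q hpq
    by_cases h : (e p).1 = (e q).1
    · rw [Set.disjoint_left]
      intro x hx hx'
      rw [Facet.mem_lift_image] at hx hx'
      refine hpq (e.injective ?_)
      generalize e p = P at *
      generalize e q = Q at *
      obtain ⟨i, E, hE⟩ := P
      obtain ⟨i', E', hE'⟩ := Q
      obtain rfl : i = i' := h
      obtain rfl : E = E' := h𝒞.eq_of_mem i (Finset.mem_univ _) E hE E' hE' _ hx.1 hx'.1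
      rfl
    · exact (hT _ _ h).mono (Set.image_mono (hsub p)) (Set.image_mono (hsub q))
  · intro i
    ext x
    simp only [Set.mem_iUnion, exists_prop]
    constructor
    · rintro ⟨y, hy, rfl⟩
      obtain ⟨E, hE, hyE⟩ := h𝒞.exists_mem i (Finset.mem_univ _) y hy
      refine ⟨e.symm ⟨i, E, hE⟩, ?_, ?_⟩
      · change (e (e.symm _)).1 = i
        rw [e.apply_symm_apply]
      · rw [e.apply_symm_apply]
        exact ⟨y, hyE, rfl⟩
    · rintro ⟨p, rfl, hx⟩
      exact Set.image_mono (hsub p) hx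
  · rintro ⟨k, o, ho, hb⟩
    choose p hp using ho
    refine h𝒞.not_cycle k (fun a => (e (p a)).1) (fun a => (e (p a)).2.1)
      (fun a => Finset.mem_univ _) (fun a => (e (p a)).2.2) fun a => ?_
    obtain ⟨x, hx, y, hy, h0, h1, h2⟩ := hb a
    rw [← hp, Facet.mem_lift_image] at hx hy
    rw [← h0, ← h1] at hy
    exact ⟨_, hx.1, hy.1, by rwa [← hx.2, ← hy.2]⟩

/-- For every `ε > 0` there are constants `C = C(ε)` and `δ = δ(ε)` such
that the `n` triangles of any collection of pairwise disjoint non-vertical triangles in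
`ℝ³` can be cut into at most `C·n^{3/2+ε}` connected semialgebraic pieces, each defined by
at most `δ` polynomial (in)equalities of degree at most `δ`, so that the depth relation
on the resulting pieces is acyclic. -/
theorem cycle_elimination_triangles :
    ∀ ε : ℝ, 0 < ε → ∃ (C : ℝ) (δ : ℕ), 0 < C ∧
      ∀ (n : ℕ) (T : Fin n → Set (Fin 3 → ℝ)),
        (∀ i, IsNonVerticalTriangle (T i)) →
        (∀ i j, i ≠ j → Disjoint (T i) (T j)) →
        ∃ (m : ℕ) (piece : Fin m → Set (Fin 3 → ℝ)) (owner : Fin m → Fin n),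
          (m : ℝ) ≤ C * (n : ℝ) ^ ((3 : ℝ) / 2 + ε) ∧
          (∀ p, IsConnected (piece p)) ∧
          (∀ p, SemialgOfComplexity δ (piece p)) ∧
          (∀ p q, p ≠ q → Disjoint (piece p) (piece q)) ∧
          (∀ i, T i = ⋃ p ∈ {p | owner p = i}, piece p) ∧
          DepthAcyclic (Set.range piece) := by
  intro ε hε
  obtain ⟨A, δ, hA, h⟩ := exists_isAcyclicDecomposition (α := 3 / 2 + ε) (by linarith)
  refine ⟨A, δ + 1, hA, fun n T hT hd => ?_⟩
  choose Δ hΔ using fun i => (hT i).exists_facet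
  obtain rfl : T = fun i => (Δ i).lift '' (Δ i).region := funext hΔ
  obtain ⟨𝒞, h𝒞, hc⟩ := h (Fin n) Δ (pairwiseSeparated_of_disjoint hd) Finset.univ
  obtain ⟨piece, owner, hp⟩ := h𝒞.exists_pieces hd
  refine ⟨_, piece, owner, ?_, hp⟩
  simpa using hc
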